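/- arXiv:1402.4053 — 4 statements merged into one kernel-verified Lean document; each statement's English description precedes it below -/
import Mathlib

section
/- Let n, k ≥ 1, γ ∈ {1,2}, let S ⊆ (ℂ^{n×n})^γ be an irreducible Zariski-closed set, let A = (A_1,…,A_k) with A_i ∈ (ℂ^{n×n})^γ, and let φ_A : S → ℂ^k, φ_A(Z) = (Tr(Z·A_1),…,Tr(Z·A_k)). Assume φ_A is generically unramified. If there exists a signal Z ∈ S that is perturbation-stably identifiable from φ_A(Z), then the set of Y ∈ S that are NOT perturbation-stably identifiable is contained in a Zariski-closed set meeting S in a proper subset; in particular, it cannot happen that the perturbation-stably identifiable signals and their complement in S both contain a nonempty relatively Zariski-open subset of S. -/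
/-- Index set of `(ℂ^{n×n})^γ`, identified with `ℂ^{γn²}`. -/
abbrev MIdx (γ n : ℕ) := Fin γ × Fin n × Fin n

/-- The space `(ℂ^{n×n})^γ` of (pairs of) matrices, as functions `MIdx γ n → ℂ`;
it carries the standard Euclidean (product) topology as its topology instance. -/
abbrev MSpace (γ n : ℕ) := MIdx γ n → ℂ

/-- `Tr(Z·A)`: for `γ = 1` the ordinary trace of the matrix product, and for
`γ = 2`, with `Z = (X,Y)`, `A = (B,C)`, the value `Tr(X·B + Y·C)`. -/
noncomputable def trPair {γ n : ℕ} (Z A : MSpace γ n) : ℂ :=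
  ∑ g : Fin γ, ∑ i : Fin n, ∑ j : Fin n, Z (g, i, j) * A (g, j, i)

/-- A set is Zariski-closed iff it is the common zero set of a family of
polynomials with complex coefficients. -/
def IsZClosed {σ : Type*} (X : Set (σ → ℂ)) : Prop :=
  ∃ T : Set (MvPolynomial σ ℂ), X = {x | ∀ p ∈ T, MvPolynomial.eval x p = 0}

/-- The Zariski topology on `σ → ℂ`. -/
def zTop (σ : Type*) : TopologicalSpace (σ → ℂ) :=
  TopologicalSpace.generateFrom
    {U | ∃ p : MvPolynomial σ ℂ, U = {x | MvPolynomial.eval x p ≠ 0}}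

/-- The fiber `φ_A⁻¹(φ_A(Z))` of the forward map `φ_A : S → ℂ^k`,
`W ↦ (Tr(W·A_1), …, Tr(W·A_k))`. -/
def prFiber {γ n k : ℕ} (S : Set (MSpace γ n)) (A : Fin k → MSpace γ n)
    (Z : MSpace γ n) : Set (MSpace γ n) :=
  {W | W ∈ S ∧ ∀ i : Fin k, trPair W (A i) = trPair Z (A i)}

/-- `Z ∈ S` is identifiable from `φ_A(Z)`: `φ_A⁻¹(φ_A(Z)) = {Z}`. -/
def Identifiable {γ n k : ℕ} (S : Set (MSpace γ n)) (A : Fin k → MSpace γ n)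
    (Z : MSpace γ n) : Prop :=
  prFiber S A Z = {Z}

/-- `φ_A` is unramified over `Z`: on some Euclidean-open neighbourhood `U` of
`Z` in the ambient space, all fibers over `U ∩ S` have the same cardinality as
the fiber of `Z`. -/
def UnramifiedAt {γ n k : ℕ} (S : Set (MSpace γ n)) (A : Fin k → MSpace γ n)
    (Z : MSpace γ n) : Prop :=
  ∃ U : Set (MSpace γ n), IsOpen U ∧ Z ∈ U ∧
    ∀ W ∈ U ∩ S, Cardinal.mk ↥(prFiber S A W) = Cardinal.mk ↥(prFiber S A Z)

/-- `φ_A` is generically unramified: the points of `S` over which it is not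
unramified are contained in a Zariski-closed set meeting `S` in a proper subset. -/
def GenericallyUnramified {γ n k : ℕ} (S : Set (MSpace γ n))
    (A : Fin k → MSpace γ n) : Prop :=
  ∃ C : Set (MSpace γ n), IsZClosed C ∧ C ∩ S ≠ S ∧
    {Z | Z ∈ S ∧ ¬ UnramifiedAt S A Z} ⊆ C

/-- `Z ∈ S` is perturbation-stably identifiable: on some Euclidean-open
neighbourhood `U` of `Z`, every `W ∈ U ∩ S` satisfies `φ_A⁻¹(φ_A(W)) = {W}`. -/
def PerturbStable {γ n k : ℕ} (S : Set (MSpace γ n)) (A : Fin k → MSpace γ n)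
    (Z : MSpace γ n) : Prop :=
  ∃ U : Set (MSpace γ n), IsOpen U ∧ Z ∈ U ∧ ∀ W ∈ U ∩ S, prFiber S A W = {W}

/-- The tuple `A` is generically identifying: the non-identifiable signals of
`S` are contained in a Zariski-closed set meeting `S` in a proper subset. -/
def GenericallyIdentifying {γ n k : ℕ} (S : Set (MSpace γ n))
    (A : Fin k → MSpace γ n) : Prop :=
  ∃ C : Set (MSpace γ n), IsZClosed C ∧ C ∩ S ≠ S ∧
    {Z | Z ∈ S ∧ ¬ Identifiable S A Z} ⊆ C

/-- The tuple `A` is completely identifying: every `Z ∈ S` is identifiable. -/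
def CompletelyIdentifying {γ n k : ℕ} (S : Set (MSpace γ n))
    (A : Fin k → MSpace γ n) : Prop :=
  ∀ Z ∈ S, Identifiable S A Z

open Filter Topology

lemma exists_algHom_kill {R : Type*} [CommRing R] [Algebra ℂ R] [Algebra.FiniteType ℂ R]
    (I : Ideal R) (hI : I ≠ ⊤) : ∃ χ : R →ₐ[ℂ] ℂ, ∀ x ∈ I, χ x = 0 := by
  obtain ⟨M, hM, hIM⟩ := Ideal.exists_le_maximal I hI
  let : Field (R ⧸ M) := Ideal.Quotient.field M
  have : Module.Finite ℂ (R ⧸ M) := finite_of_finite_type_of_isJacobsonRing _ _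
  have hb := IsAlgClosed.algebraMap_bijective_of_isIntegral (k := ℂ) (K := R ⧸ M)
  let e : ℂ ≃ₐ[ℂ] (R ⧸ M) := AlgEquiv.ofBijective (Algebra.ofId ℂ (R ⧸ M)) hb
  refine ⟨e.symm.toAlgHom.comp (Ideal.Quotient.mkₐ ℂ M), fun x hx => ?_⟩
  have : Ideal.Quotient.mk M x = 0 := Ideal.Quotient.eq_zero_iff_mem.2 (hIM hx)
  simp [this]

lemma constructible_dichotomy {R : Type*} [CommRing R] [IsDomain R]
    (s : Set (PrimeSpectrum R)) (hs : Topology.IsConstructible s) :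
    ∃ f : R, f ≠ 0 ∧ ((PrimeSpectrum.basicOpen f : Set (PrimeSpectrum R)) ⊆ s ∨
      (PrimeSpectrum.basicOpen f : Set (PrimeSpectrum R)) ⊆ sᶜ) := by
  induction hs using Topology.IsConstructible.empty_union_induction with
  | open_retrocompact U hU hU' =>
    by_cases hne : U.Nonempty
    · obtain ⟨x, hx⟩ := hne
      obtain ⟨_, ⟨f, rfl⟩, hxf, hfU⟩ :=
        PrimeSpectrum.isTopologicalBasis_basic_opens.exists_subset_of_mem_open hx hU
      refine ⟨f, ?_, Or.inl hfU⟩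
      rintro rfl
      simp at hxf
    · rw [Set.not_nonempty_iff_eq_empty] at hne
      exact ⟨1, one_ne_zero, Or.inr (by simp [hne])⟩
  | union s hs t ht h1 h2 =>
    obtain ⟨f, hf, h1⟩ := h1
    obtain ⟨g, hg, h2⟩ := h2
    rcases h1 with h1 | h1
    · exact ⟨f, hf, Or.inl (h1.trans Set.subset_union_left)⟩
    rcases h2 with h2 | h2
    · exact ⟨g, hg, Or.inl (h2.trans Set.subset_union_right)⟩
    refine ⟨f * g, mul_ne_zero hf hg, Or.inr ?_⟩
    rw [Set.compl_union]
    rw [PrimeSpectrum.basicOpen_mul]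
    exact Set.inter_subset_inter h1 h2
  | compl s hs h =>
    obtain ⟨f, hf, h⟩ := h
    exact ⟨f, hf, by rw [compl_compl]; exact h.symm⟩

/-- Chevalley on the level of complex points. -/
lemma chevalley_points {A R : Type*} [CommRing A] [IsDomain A] [Algebra ℂ A]
    [Algebra.FiniteType ℂ A] [CommRing R] [Algebra A R] [Algebra ℂ R] [IsScalarTower ℂ A R]
    [Algebra.FiniteType A R] :
    ∃ f : A, f ≠ 0 ∧ ((∀ χ : A →ₐ[ℂ] ℂ, χ f ≠ 0 →
        ∃ ψ : R →ₐ[ℂ] ℂ, ∀ a, ψ (algebraMap A R a) = χ a) ∨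
      (∀ χ : A →ₐ[ℂ] ℂ, χ f ≠ 0 →
        ¬ ∃ ψ : R →ₐ[ℂ] ℂ, ∀ a, ψ (algebraMap A R a) = χ a)) := by
  have : IsNoetherianRing A := Algebra.FiniteType.isNoetherianRing ℂ A
  have : Algebra.FinitePresentation A R := Algebra.FinitePresentation.of_finiteType.1 inferInstance
  have : Algebra.FiniteType ℂ R := Algebra.FiniteType.trans ‹Algebra.FiniteType ℂ A› ‹_›
  obtain ⟨f, hf, h⟩ := constructible_dichotomy _ (PrimeSpectrum.isConstructible_range_comap
    (f := algebraMap A R) (RingHom.finitePresentation_algebraMap.2 inferInstance))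
  refine ⟨f, hf, h.imp (fun h χ hχ => ?_) (fun h χ hχ => ?_)⟩
  · have hp : (RingHom.ker χ).IsPrime := RingHom.ker_isPrime _
    obtain ⟨q, hq⟩ := h (show (⟨RingHom.ker χ, hp⟩ : PrimeSpectrum A) ∈ _ from hχ)
    obtain ⟨ψ, hψ⟩ := exists_algHom_kill q.asIdeal q.2.ne_top
    refine ⟨ψ, fun a => ?_⟩
    have h1 : a - algebraMap ℂ A (χ a) ∈ RingHom.ker χ := by simp [RingHom.mem_ker]
    have h2 : algebraMap A R (a - algebraMap ℂ A (χ a)) ∈ q.asIdeal := by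
      have := congrArg PrimeSpectrum.asIdeal hq
      simp only [PrimeSpectrum.comap_asIdeal] at this
      rw [← this] at h1
      exact h1
    have h3 := hψ _ h2
    rw [map_sub, map_sub, ← IsScalarTower.algebraMap_apply, AlgHom.commutes, sub_eq_zero] at h3
    exact h3
  · rintro ⟨ψ, hψ⟩
    have hp : (RingHom.ker χ).IsPrime := RingHom.ker_isPrime _
    refine h (show (⟨RingHom.ker χ, hp⟩ : PrimeSpectrum A) ∈ _ from hχ)
      ⟨⟨RingHom.ker ψ, RingHom.ker_isPrime _⟩, ?_⟩
    ext a
    simp [RingHom.mem_ker, hψ]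

/-- nonvanishing locus of nonzero polynomial is dense -/
lemma exists_seq_ne_zero {s : ℕ} (g : MvPolynomial (Fin s) ℂ) (hg : g ≠ 0) (p : Fin s → ℂ) :
    ∃ u : ℕ → Fin s → ℂ, Tendsto u atTop (𝓝 p) ∧ ∀ m, MvPolynomial.eval (u m) g ≠ 0 := by
  obtain ⟨q, hq⟩ : ∃ q, MvPolynomial.eval q g ≠ 0 := by
    by_contra! h
    exact hg (MvPolynomial.funext fun x => by simp [h x])
  let G : Polynomial ℂ := MvPolynomial.aeval
    (fun i => Polynomial.C (p i) + Polynomial.X * Polynomial.C (q i - p i)) g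
  have hG : ∀ t, G.eval t = MvPolynomial.eval (fun i => p i + t * (q i - p i)) g := by
    intro t
    have : (Polynomial.evalRingHom t).comp (MvPolynomial.aeval
      (fun i => Polynomial.C (p i) + Polynomial.X * Polynomial.C (q i - p i))).toRingHom
        = MvPolynomial.eval (fun i => p i + t * (q i - p i)) := by
      apply MvPolynomial.ringHom_ext <;> simp
    exact congrArg (fun F => F g) this
  have hG0 : G ≠ 0 := by
    intro h
    have := hG 1
    simp [h] at this
    exact hq this.symm
  have hfin : {t | G.IsRoot t}.Finite := Polynomial.finite_setOfPred_isRoot hG0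
  have hd : Dense ({t | G.IsRoot t}ᶜ) := hfin.countable.dense_compl ℂ
  obtain ⟨t, ht, htl⟩ := mem_closure_iff_seq_limit.1 (hd 0)
  refine ⟨fun m i => p i + t m * (q i - p i), ?_, fun m => ?_⟩
  · rw [tendsto_pi_nhds]
    intro i
    simpa using (htl.mul_const (q i - p i)).const_add (p i)
  · rw [← hG]
    exact ht m

lemma exists_small_root (F : Polynomial ℂ) (hF : F.Monic) (hd : F.natDegree ≠ 0) :
    ∃ t, F.IsRoot t ∧ ‖t‖ ^ F.natDegree ≤ ‖F.coeff 0‖ := by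
  have hs := IsAlgClosed.splits F
  by_contra! h
  have hc := hs.coeff_zero_eq_prod_roots_of_monic hF
  have hcard : F.roots.card = F.natDegree := hs.natDegree_eq_card_roots.symm
  have hne : F.roots ≠ 0 := by
    intro h0; rw [h0] at hcard; simp at hcard; exact hd hcard.symm
  obtain ⟨t, ht, hmin⟩ : ∃ t ∈ F.roots, ∀ r ∈ F.roots, ‖t‖ ≤ ‖r‖ := by
    have : F.roots.toFinset.Nonempty := by simpa using hne
    obtain ⟨t, ht, h⟩ := Finset.exists_min_image F.roots.toFinset (fun x => ‖x‖) this
    exact ⟨t, by simpa using ht, fun r hr => h r (by simpa using hr)⟩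
  have h2 := h t (Polynomial.isRoot_of_mem_roots ht)
  have h3 : ‖t‖ ^ F.natDegree ≤ ‖F.coeff 0‖ := by
    rw [hc, norm_mul, norm_pow, norm_neg, norm_one, one_pow, one_mul, ← hcard]
    clear h h2 hc hcard hne ht
    generalize F.roots = r at hmin
    induction r using Multiset.induction_on with
    | empty => simp
    | cons a r ih =>
      rw [Multiset.prod_cons, norm_mul, Multiset.card_cons, pow_succ']
      gcongr
      · exact hmin a (by simp)
      · exact ih fun x hx => hmin x (by simp [hx])
  exact absurd h3 (not_le.2 h2)

section Density
variable {s : ℕ} {A : Type*} [CommRing A] [IsDomain A] [Algebra ℂ A]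
  [Algebra (MvPolynomial (Fin s) ℂ) A] [IsScalarTower ℂ (MvPolynomial (Fin s) ℂ) A]

/-- Evaluating an integral equation at a point. -/
lemma isRoot_map_of_aeval (χ : A →ₐ[ℂ] ℂ) (p : Fin s → ℂ)
    (hχ : ∀ q : MvPolynomial (Fin s) ℂ, χ (algebraMap _ A q) = MvPolynomial.eval p q)
    (a : A) (G : Polynomial (MvPolynomial (Fin s) ℂ)) (hG : Polynomial.aeval a G = 0) :
    (G.map (MvPolynomial.eval p)).IsRoot (χ a) := by
  have h1 : (χ : A →+* ℂ).comp (algebraMap (MvPolynomial (Fin s) ℂ) A) = MvPolynomial.eval p := by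
    ext q <;> simp [hχ]
  rw [Polynomial.IsRoot, Polynomial.eval_map, ← h1]
  have h2 := Polynomial.hom_eval₂ G (algebraMap (MvPolynomial (Fin s) ℂ) A) (χ : A →+* ℂ) a
  rw [Polynomial.aeval_def] at hG
  rw [hG, map_zero] at h2
  exact h2.symm

/-- Bound for the roots of a monic polynomial. -/
lemma root_bound (F : Polynomial ℂ) (hF : F.Monic) (r : ℂ) (hr : F.IsRoot r) :
    ‖r‖ ≤ (∑ i ∈ Finset.range F.natDegree, ‖F.coeff i‖) + 1 := by
  have h := hr.norm_lt_cauchyBound hF.ne_zero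
  have h2 : F.cauchyBound ≤ (∑ i ∈ Finset.range F.natDegree, ‖F.coeff i‖₊) + 1 := by
    rw [Polynomial.cauchyBound, hF.leadingCoeff, nnnorm_one, div_one]
    gcongr
    refine Finset.sup_le fun i hi => ?_
    exact Finset.single_le_sum (f := fun i => ‖F.coeff i‖₊) (fun _ _ => zero_le) hi
  have h3 : ‖r‖₊ ≤ (∑ i ∈ Finset.range F.natDegree, ‖F.coeff i‖₊) + 1 := h.le.trans h2
  have h4 := NNReal.coe_le_coe.2 h3
  simpa using h4

variable [Algebra.IsIntegral (MvPolynomial (Fin s) ℂ) A]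

/-- Lifting points through the integral extension, with prescribed value of `l`. -/
lemma exists_lift_point [Algebra.FiniteType ℂ A]
    (hinj : Function.Injective (algebraMap (MvPolynomial (Fin s) ℂ) A))
    (l : A) (p : Fin s → ℂ) (t : ℂ)
    (ht : ((minpoly (MvPolynomial (Fin s) ℂ) l).map (MvPolynomial.eval p)).IsRoot t) :
    ∃ χ : A →ₐ[ℂ] ℂ, (∀ q : MvPolynomial (Fin s) ℂ, χ (algebraMap _ A q) = MvPolynomial.eval p q)
      ∧ χ l = t := by
  have : FaithfulSMul (MvPolynomial (Fin s) ℂ) A := (faithfulSMul_iff_algebraMap_injective _ _).2 hinj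
  have hl : IsIntegral (MvPolynomial (Fin s) ℂ) l := Algebra.IsIntegral.isIntegral l
  let Φ : Polynomial (MvPolynomial (Fin s) ℂ) →+* A := (Polynomial.aeval l).toRingHom
  have hΦ : RingHom.ker Φ = Ideal.span {minpoly (MvPolynomial (Fin s) ℂ) l} :=
    minpoly.ker_eval hl
  let ev : Polynomial (MvPolynomial (Fin s) ℂ) →+* ℂ := Polynomial.eval₂RingHom (MvPolynomial.eval p) t
  have hevs : Function.Surjective ev := fun c => ⟨Polynomial.C (MvPolynomial.C c), by simp [ev]⟩
  have hmax : (RingHom.ker ev).IsMaximal := RingHom.ker_isMaximal_of_surjective ev hevs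
  have hle : RingHom.ker Φ ≤ RingHom.ker ev := by
    rw [hΦ, Ideal.span_le, Set.singleton_subset_iff]
    rw [Polynomial.IsRoot, Polynomial.eval_map] at ht
    exact ht
  have hint : Φ.IsIntegral := by
    have h0 : (algebraMap (MvPolynomial (Fin s) ℂ) A).IsIntegral :=
      fun x => Algebra.IsIntegral.isIntegral x
    have h1 : Φ.comp Polynomial.C = algebraMap (MvPolynomial (Fin s) ℂ) A := by
      ext q <;> simp [Φ]
    rw [← h1] at h0
    exact RingHom.IsIntegral.tower_top _ _ h0
  obtain ⟨Q, hQ, hQc⟩ : ∃ Q : Ideal A, Q.IsMaximal ∧ Q.comap Φ = RingHom.ker ev := by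
    let : Algebra (Polynomial (MvPolynomial (Fin s) ℂ)) A := Φ.toAlgebra
    have : Algebra.IsIntegral (Polynomial (MvPolynomial (Fin s) ℂ)) A := ⟨hint⟩
    exact Ideal.exists_ideal_over_maximal_of_isIntegral (RingHom.ker ev) hle
  obtain ⟨χ, hχ⟩ := exists_algHom_kill Q hQ.ne_top
  have key : ∀ G, χ (Φ G) = ev G := by
    intro G
    have h1 : G - Polynomial.C (MvPolynomial.C (ev G)) ∈ Q.comap Φ := by
      rw [hQc, RingHom.mem_ker]; simp [ev]
    have h2 := hχ _ h1
    have h3 : Φ (Polynomial.C (MvPolynomial.C (ev G))) = algebraMap ℂ A (ev G) := by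
      simp only [Φ, AlgHom.toRingHom_eq_coe, RingHom.coe_coe, Polynomial.aeval_C]
      rw [IsScalarTower.algebraMap_apply ℂ (MvPolynomial (Fin s) ℂ) A]; rfl
    rw [map_sub, map_sub, h3, AlgHom.commutes, sub_eq_zero] at h2
    exact h2
  refine ⟨χ, fun q => ?_, ?_⟩
  · simpa [Φ, ev] using key (Polynomial.C q)
  · simpa [Φ, ev] using key Polynomial.X

/-- The fibers are finite. -/
lemma finite_fiber [Algebra.FiniteType ℂ A] (p : Fin s → ℂ) :
    {χ : A →ₐ[ℂ] ℂ | ∀ q : MvPolynomial (Fin s) ℂ,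
      χ (algebraMap _ A q) = MvPolynomial.eval p q}.Finite := by
  obtain ⟨S, hS⟩ := (inferInstance : Algebra.FiniteType ℂ A).out
  let P := fun a : A => (minpoly (MvPolynomial (Fin s) ℂ) a).map (MvPolynomial.eval p)
  have hP : ∀ a, P a ≠ 0 := fun a =>
    ((minpoly.monic (Algebra.IsIntegral.isIntegral a)).map _).ne_zero
  have hfin : (Set.pi Set.univ (fun a : S => {t | (P a).IsRoot t})).Finite :=
    Set.Finite.pi fun a => Polynomial.finite_setOfPred_isRoot (hP a)
  refine Set.Finite.of_finite_image (f := fun χ => fun a : S => χ a) (hfin.subset ?_) ?_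
  · rintro _ ⟨χ, hχ, rfl⟩ a -
    exact isRoot_map_of_aeval χ p hχ a _ (minpoly.aeval _ _)
  · intro χ _ ψ _ h
    refine AlgHom.ext_of_adjoin_eq_top hS fun a ha => ?_
    exact congrFun h ⟨a, ha⟩

lemma density_aux [Algebra.FiniteType ℂ A]
    (hinj : Function.Injective (algebraMap (MvPolynomial (Fin s) ℂ) A))
    (f : A) (hf : f ≠ 0) (χ₀ : A →ₐ[ℂ] ℂ) :
    ∃ (𝓕 : Ultrafilter ℕ) (χ : ℕ → A →ₐ[ℂ] ℂ), (∀ m, χ m f ≠ 0) ∧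
      ∀ a, Tendsto (fun m => χ m a) 𝓕 (𝓝 (χ₀ a)) := by
  classical
  have : FaithfulSMul (MvPolynomial (Fin s) ℂ) A := (faithfulSMul_iff_algebraMap_injective _ _).2 hinj
  -- the base point
  let p : Fin s → ℂ := fun i => χ₀ (algebraMap (MvPolynomial (Fin s) ℂ) A (MvPolynomial.X i))
  have hp : ∀ q : MvPolynomial (Fin s) ℂ, χ₀ (algebraMap _ A q) = MvPolynomial.eval p q := by
    intro q
    have : (χ₀ : A →+* ℂ).comp (algebraMap (MvPolynomial (Fin s) ℂ) A) = MvPolynomial.eval p := by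
      apply MvPolynomial.ringHom_ext
      · intro c
        have h : algebraMap (MvPolynomial (Fin s) ℂ) A (MvPolynomial.C c) = algebraMap ℂ A c := by
          rw [IsScalarTower.algebraMap_apply ℂ (MvPolynomial (Fin s) ℂ) A]; rfl
        simp [h]
      · intro i; simp [p]
    exact congrArg (fun F => F q) this
  -- separating element
  obtain ⟨l, hl0, hl⟩ : ∃ l : A, χ₀ l = 0 ∧ ∀ ψ : A →ₐ[ℂ] ℂ,
      (∀ q : MvPolynomial (Fin s) ℂ, ψ (algebraMap _ A q) = MvPolynomial.eval p q) →
      ψ l = 0 → ψ = χ₀ := by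
    have hfin := finite_fiber (A := A) p
    have hsep : ∀ ψ : A →ₐ[ℂ] ℂ, ∃ b : A, ψ b = 0 ∧ (ψ ≠ χ₀ → χ₀ b ≠ 0) := by
      intro ψ
      by_cases h : ψ = χ₀
      · exact ⟨0, by simp, fun h' => absurd h h'⟩
      · obtain ⟨a, ha⟩ : ∃ a, ψ a ≠ χ₀ a := by
          by_contra! h'
          exact h (AlgHom.ext h')
        refine ⟨a - algebraMap ℂ A (ψ a), by simp, fun _ => ?_⟩
        simpa [sub_eq_zero] using ha.symm
    choose b hb hb' using hsep
    let B : A := ∏ ψ ∈ hfin.toFinset.erase χ₀, b ψ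
    refine ⟨B - algebraMap ℂ A (χ₀ B), by simp, fun ψ hψ hψl => ?_⟩
    by_contra hne
    have h1 : ψ B = 0 := by
      rw [map_prod]
      exact Finset.prod_eq_zero (i := ψ) (by simpa [hne] using hψ) (hb ψ)
    have h2 : χ₀ B ≠ 0 := by
      rw [map_prod]
      refine Finset.prod_ne_zero_iff.2 fun θ hθ => hb' θ ?_
      exact (Finset.mem_erase.1 hθ).1
    rw [map_sub, h1, AlgHom.commutes] at hψl
    simp at hψl
    exact h2 hψl
  -- approximating base points
  have hif : IsIntegral (MvPolynomial (Fin s) ℂ) f := Algebra.IsIntegral.isIntegral f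
  have hf0 : (minpoly (MvPolynomial (Fin s) ℂ) f).coeff 0 ≠ 0 := by
    intro h0
    have hirr := minpoly.irreducible hif
    have hass := Polynomial.irreducible_X.associated_of_dvd hirr (Polynomial.X_dvd_iff.2 h0)
    obtain ⟨c, hc⟩ := hass.symm.dvd
    have h1 : Polynomial.aeval f (Polynomial.X : Polynomial (MvPolynomial (Fin s) ℂ)) = 0 := by
      rw [hc, map_mul, minpoly.aeval, zero_mul]
    rw [Polynomial.aeval_X] at h1
    exact hf h1
  obtain ⟨u, hu, hune⟩ := exists_seq_ne_zero _ hf0 p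
  have hil : IsIntegral (MvPolynomial (Fin s) ℂ) l := Algebra.IsIntegral.isIntegral l
  let M := minpoly (MvPolynomial (Fin s) ℂ) l
  have hM : M.Monic := minpoly.monic hil
  have hMd : M.natDegree ≠ 0 := (minpoly.natDegree_pos hil).ne'
  have hMm : ∀ v, (M.map (MvPolynomial.eval v)).natDegree = M.natDegree := fun v =>
    hM.natDegree_map _
  have hroot : ∀ m, ∃ t, (M.map (MvPolynomial.eval (u m))).IsRoot t ∧
      ‖t‖ ^ M.natDegree ≤ ‖MvPolynomial.eval (u m) (M.coeff 0)‖ := by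
    intro m
    obtain ⟨t, h1, h2⟩ := exists_small_root (M.map (MvPolynomial.eval (u m))) (hM.map _)
      (by rw [hMm]; exact hMd)
    exact ⟨t, h1, by simpa [hMm] using h2⟩
  choose t ht ht' using hroot
  have hχ := fun m => exists_lift_point hinj l (u m) (t m) (ht m)
  choose χ hχ hχl using hχ
  have hcont : ∀ q : MvPolynomial (Fin s) ℂ,
      Tendsto (fun m => MvPolynomial.eval (u m) q) atTop (𝓝 (MvPolynomial.eval p q)) := fun q =>
    ((MvPolynomial.continuous_eval q).tendsto p).comp hu
  -- `t m → 0`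
  have hc0 : MvPolynomial.eval p (M.coeff 0) = 0 := by
    have h := isRoot_map_of_aeval χ₀ p hp l M (minpoly.aeval _ _)
    rw [hl0, Polynomial.IsRoot, ← Polynomial.coeff_zero_eq_eval_zero, Polynomial.coeff_map] at h
    exact h
  have htpow : Tendsto (fun m => (t m) ^ M.natDegree) atTop (𝓝 0) := by
    rw [tendsto_zero_iff_norm_tendsto_zero]
    have h := (hcont (M.coeff 0)).norm
    rw [hc0, norm_zero] at h
    refine squeeze_zero (fun _ => norm_nonneg _) (fun m => ?_) h
    rw [norm_pow]; exact ht' m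
  let 𝓕 : Ultrafilter ℕ := Ultrafilter.of atTop
  have h𝓕 : (𝓕 : Filter ℕ) ≤ atTop := Ultrafilter.of_le _
  -- limits exist
  have hlim : ∀ a, ∃ L, Tendsto (fun m => χ m a) 𝓕 (𝓝 L) := by
    intro a
    let G := minpoly (MvPolynomial (Fin s) ℂ) a
    have hG : G.Monic := minpoly.monic (Algebra.IsIntegral.isIntegral a)
    have hb : ∀ m, ‖χ m a‖ ≤
        (∑ i ∈ Finset.range G.natDegree, ‖MvPolynomial.eval (u m) (G.coeff i)‖) + 1 := by
      intro m
      have h := root_bound _ (hG.map (MvPolynomial.eval (u m))) _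
        (isRoot_map_of_aeval (χ m) (u m) (hχ m) a G (minpoly.aeval _ _))
      simpa [hG.natDegree_map] using h
    have hbl : Tendsto (fun m =>
        (∑ i ∈ Finset.range G.natDegree, ‖MvPolynomial.eval (u m) (G.coeff i)‖) + 1) atTop
        (𝓝 ((∑ i ∈ Finset.range G.natDegree, ‖MvPolynomial.eval p (G.coeff i)‖) + 1)) :=
      (tendsto_finsetSum _ fun i _ => (hcont (G.coeff i)).norm).add_const 1
    set K := (∑ i ∈ Finset.range G.natDegree, ‖MvPolynomial.eval p (G.coeff i)‖) + 1
    have hev : ∀ᶠ m in atTop, χ m a ∈ Metric.closedBall (0 : ℂ) (K + 1) := by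
      filter_upwards [hbl.eventually (gt_mem_nhds (lt_add_one K))] with m hm
      rw [mem_closedBall_zero_iff]
      exact (hb m).trans hm.le
    obtain ⟨L, -, hL⟩ := (isCompact_closedBall (0 : ℂ) (K + 1)).ultrafilter_le_nhds
      (𝓕.map fun m => χ m a) (le_principal_iff.2 (h𝓕 hev))
    exact ⟨L, hL⟩
  choose L hL using hlim
  let ψ : A →ₐ[ℂ] ℂ :=
    { toFun := L
      map_one' := tendsto_nhds_unique (hL 1) (by simp)
      map_zero' := tendsto_nhds_unique (hL 0) (by simp)
      map_mul' := fun a b => tendsto_nhds_unique (hL _) (by simpa using (hL a).mul (hL b))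
      map_add' := fun a b => tendsto_nhds_unique (hL _) (by simpa using (hL a).add (hL b))
      commutes' := fun c => tendsto_nhds_unique (hL _) (by simp) }
  have hψ : ψ = χ₀ := by
    refine hl ψ (fun q => ?_) ?_
    · refine tendsto_nhds_unique (hL _) ?_
      simp only [hχ]
      exact (hcont q).mono_left h𝓕
    · have h1 : Tendsto (fun m => (χ m l) ^ M.natDegree) 𝓕 (𝓝 (L l ^ M.natDegree)) := (hL l).pow _
      simp only [hχl] at h1
      have h2 := tendsto_nhds_unique h1 (htpow.mono_left h𝓕)
      exact pow_eq_zero_iff hMd |>.1 h2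
  refine ⟨𝓕, χ, fun m hm => ?_, fun a => ?_⟩
  · have h := isRoot_map_of_aeval (χ m) (u m) (hχ m) f _ (minpoly.aeval _ _)
    rw [hm, Polynomial.IsRoot, ← Polynomial.coeff_zero_eq_eval_zero, Polynomial.coeff_map] at h
    exact hune m h
  · rw [← hψ]; exact hL a

end Density

/-- Euclidean density of principal Zariski-open sets, in terms of complex points of
a finitely generated domain. -/
lemma density_points {A : Type*} [CommRing A] [IsDomain A] [Algebra ℂ A] [Algebra.FiniteType ℂ A]
    (f : A) (hf : f ≠ 0) (χ₀ : A →ₐ[ℂ] ℂ) :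
    ∃ (𝓕 : Ultrafilter ℕ) (χ : ℕ → A →ₐ[ℂ] ℂ), (∀ m, χ m f ≠ 0) ∧
      ∀ a, Tendsto (fun m => χ m a) 𝓕 (𝓝 (χ₀ a)) := by
  obtain ⟨s, g, hinj, hint⟩ := exists_integral_inj_algHom_of_fg ℂ A
  let : Algebra (MvPolynomial (Fin s) ℂ) A := g.toRingHom.toAlgebra
  have : IsScalarTower ℂ (MvPolynomial (Fin s) ℂ) A :=
    IsScalarTower.of_algebraMap_eq fun c => (g.commutes c).symm
  have : Algebra.IsIntegral (MvPolynomial (Fin s) ℂ) A := ⟨hint⟩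
  exact density_aux hinj f hf χ₀

/-- Chevalley for explicit systems of equations with coefficients in `A`. -/
lemma chevalley_eqs {A : Type*} [CommRing A] [IsDomain A] [Algebra ℂ A]
    [Algebra.FiniteType ℂ A] {τ : Type*} [Finite τ] (E : Set (MvPolynomial τ A)) :
    ∃ f : A, f ≠ 0 ∧ ((∀ χ : A →ₐ[ℂ] ℂ, χ f ≠ 0 →
        ∃ v : τ → ℂ, ∀ e ∈ E, MvPolynomial.eval₂Hom (χ : A →+* ℂ) v e = 0) ∨
      (∀ χ : A →ₐ[ℂ] ℂ, χ f ≠ 0 →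
        ¬ ∃ v : τ → ℂ, ∀ e ∈ E, MvPolynomial.eval₂Hom (χ : A →+* ℂ) v e = 0)) := by
  have key : ∀ χ : A →ₐ[ℂ] ℂ,
      (∃ ψ : (MvPolynomial τ A ⧸ Ideal.span E) →ₐ[ℂ] ℂ,
        ∀ a, ψ (algebraMap A (MvPolynomial τ A ⧸ Ideal.span E) a) = χ a) ↔
      ∃ v : τ → ℂ, ∀ e ∈ E, MvPolynomial.eval₂Hom (χ : A →+* ℂ) v e = 0 := by
    intro χ
    constructor
    · rintro ⟨ψ, hψ⟩
      refine ⟨fun i => ψ (Ideal.Quotient.mk _ (MvPolynomial.X i)), fun e he => ?_⟩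
      have h : (ψ : _ →+* ℂ).comp (Ideal.Quotient.mk (Ideal.span E)) =
          MvPolynomial.eval₂Hom (χ : A →+* ℂ)
            (fun i => ψ (Ideal.Quotient.mk _ (MvPolynomial.X i))) := by
        apply MvPolynomial.ringHom_ext
        · intro a
          rw [MvPolynomial.eval₂Hom_C]
          exact hψ a
        · intro i
          simp
      rw [← h, RingHom.comp_apply, Ideal.Quotient.eq_zero_iff_mem.2 (Ideal.subset_span he), map_zero]
    · rintro ⟨v, hv⟩
      have hle : ∀ e ∈ Ideal.span E, MvPolynomial.eval₂Hom (χ : A →+* ℂ) v e = 0 := by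
        intro e he
        have : Ideal.span E ≤ RingHom.ker (MvPolynomial.eval₂Hom (χ : A →+* ℂ) v) :=
          Ideal.span_le.2 hv
        exact this he
      let ψ := Ideal.Quotient.lift (Ideal.span E) (MvPolynomial.eval₂Hom (χ : A →+* ℂ) v) hle
      have hψ : ∀ a, ψ (algebraMap A (MvPolynomial τ A ⧸ Ideal.span E) a) = χ a := by
        intro a
        change ψ (Ideal.Quotient.mk _ (MvPolynomial.C a)) = χ a
        simp [ψ]
      refine ⟨{ ψ with commutes' := fun c => ?_ }, hψ⟩
      have := hψ (algebraMap ℂ A c)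
      rw [← IsScalarTower.algebraMap_apply, AlgHom.commutes] at this
      exact this
  simp only [← key]
  exact chevalley_points

/-- The vanishing ideal of a set. -/
def vanIdeal {σ : Type*} (S : Set (σ → ℂ)) : Ideal (MvPolynomial σ ℂ) where
  carrier := {p | ∀ x ∈ S, MvPolynomial.eval x p = 0}
  zero_mem' := by simp
  add_mem' := by
    intro a b ha hb x hx
    simp [ha x hx, hb x hx]
  smul_mem' := by
    intro c a ha x hx
    simp [ha x hx]

lemma vanIdeal_prime {σ : Type*} (S : Set (σ → ℂ)) (h : @IsIrreducible _ (zTop σ) S) :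
    (vanIdeal S).IsPrime := by
  obtain ⟨⟨x, hx⟩, hpre⟩ := h
  refine ⟨fun h => ?_, fun {p q} hpq => ?_⟩
  · have : (1 : MvPolynomial σ ℂ) ∈ vanIdeal S := by rw [h]; trivial
    simpa using this x hx
  · by_contra! hcon
    obtain ⟨h1, h2⟩ := hcon
    have h1' : ∃ y ∈ S, MvPolynomial.eval y p ≠ 0 := by
      by_contra! h'; exact h1 h'
    have h2' : ∃ y ∈ S, MvPolynomial.eval y q ≠ 0 := by
      by_contra! h'; exact h2 h'
    obtain ⟨y, hy, hyp⟩ := h1'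
    obtain ⟨z, hz, hzq⟩ := h2'
    obtain ⟨w, hw, hwp, hwq⟩ := hpre {x | MvPolynomial.eval x p ≠ 0} {x | MvPolynomial.eval x q ≠ 0}
      (TopologicalSpace.GenerateOpen.basic _ ⟨p, rfl⟩)
      (TopologicalSpace.GenerateOpen.basic _ ⟨q, rfl⟩) ⟨y, hy, hyp⟩ ⟨z, hz, hzq⟩
    have := hpq w hw
    rw [map_mul] at this
    exact mul_ne_zero hwp hwq this

/-- The point of affine space given by a complex point of the coordinate ring. -/
noncomputable def ptOf {σ : Type*} {I : Ideal (MvPolynomial σ ℂ)}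
    (χ : (MvPolynomial σ ℂ ⧸ I) →ₐ[ℂ] ℂ) : σ → ℂ :=
  fun i => χ (Ideal.Quotient.mk I (MvPolynomial.X i))

lemma eval_ptOf {σ : Type*} {I : Ideal (MvPolynomial σ ℂ)}
    (χ : (MvPolynomial σ ℂ ⧸ I) →ₐ[ℂ] ℂ) (p : MvPolynomial σ ℂ) :
    χ (Ideal.Quotient.mk I p) = MvPolynomial.eval (ptOf χ) p := by
  have h : χ.comp (Ideal.Quotient.mkₐ ℂ I) = MvPolynomial.aeval (ptOf χ) := by
    apply MvPolynomial.algHom_ext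
    intro i
    simp [ptOf]
  have := congrArg (fun F => F p) h
  simpa [MvPolynomial.aeval_eq_eval] using this

lemma ptOf_mem {σ : Type*} {S : Set (σ → ℂ)} (hS : IsZClosed S)
    (χ : (MvPolynomial σ ℂ ⧸ vanIdeal S) →ₐ[ℂ] ℂ) : ptOf χ ∈ S := by
  obtain ⟨T, hT⟩ := hS
  suffices h : ∀ p ∈ T, MvPolynomial.eval (ptOf χ) p = 0 from hT.symm ▸ h
  intro p hp
  rw [← eval_ptOf]
  have : p ∈ vanIdeal S := by
    intro x hx
    rw [hT] at hx
    exact hx p hp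
  rw [Ideal.Quotient.eq_zero_iff_mem.2 this, map_zero]

lemma exists_ptOf {σ : Type*} {S : Set (σ → ℂ)} {x : σ → ℂ} (hx : x ∈ S) :
    ∃ χ : (MvPolynomial σ ℂ ⧸ vanIdeal S) →ₐ[ℂ] ℂ, ptOf χ = x := by
  refine ⟨Ideal.Quotient.liftₐ (vanIdeal S) (MvPolynomial.aeval x) fun p hp => ?_, ?_⟩
  · rw [MvPolynomial.aeval_eq_eval]
    exact hp x hx
  · ext i
    simp [ptOf]

/-- The equations of the locus of `(W', u)` with `W' ∈ S`, `φ W' = φ W`, `u (W_j - W'_j) = 1`,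
over the coordinate ring of `S` (with `W` the universal point). -/
noncomputable def pairEqs {γ n k : ℕ} (S : Set (MSpace γ n)) (A : Fin k → MSpace γ n)
    (j : MIdx γ n) :
    Set (MvPolynomial (Option (MIdx γ n)) (MvPolynomial (MIdx γ n) ℂ ⧸ vanIdeal S)) :=
  {e | ∃ p ∈ vanIdeal S, e = MvPolynomial.rename some
      (MvPolynomial.map (algebraMap ℂ (MvPolynomial (MIdx γ n) ℂ ⧸ vanIdeal S)) p)} ∪
  {e | ∃ m : Fin k, e = ∑ g : Fin γ, ∑ i : Fin n, ∑ l : Fin n,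
      (MvPolynomial.X (some (g, i, l)) -
        MvPolynomial.C (Ideal.Quotient.mk (vanIdeal S) (MvPolynomial.X (g, i, l)))) *
        MvPolynomial.C (algebraMap ℂ _ (A m (g, l, i)))} ∪
  {MvPolynomial.X none *
    (MvPolynomial.C (Ideal.Quotient.mk (vanIdeal S) (MvPolynomial.X j)) -
      MvPolynomial.X (some j)) - 1}

lemma pairEqs_iff {γ n k : ℕ} (S : Set (MSpace γ n)) (hS : IsZClosed S)
    (A : Fin k → MSpace γ n) (j : MIdx γ n)
    (χ : (MvPolynomial (MIdx γ n) ℂ ⧸ vanIdeal S) →ₐ[ℂ] ℂ) :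
    (∃ v : Option (MIdx γ n) → ℂ, ∀ e ∈ pairEqs S A j,
      MvPolynomial.eval₂Hom (χ : _ →+* ℂ) v e = 0) ↔
    ∃ W ∈ prFiber S A (ptOf χ), W j ≠ ptOf χ j := by
  have e1 : ∀ (v : Option (MIdx γ n) → ℂ) (p : MvPolynomial (MIdx γ n) ℂ),
      MvPolynomial.eval₂Hom (χ : _ →+* ℂ) v (MvPolynomial.rename some
      (MvPolynomial.map (algebraMap ℂ (MvPolynomial (MIdx γ n) ℂ ⧸ vanIdeal S)) p)) =
      MvPolynomial.eval (fun i => v (some i)) p := by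
    intro v p
    have hc : (χ : _ →+* ℂ).comp (algebraMap ℂ (MvPolynomial (MIdx γ n) ℂ ⧸ vanIdeal S)) =
        RingHom.id ℂ := by
      ext c; simp
    rw [MvPolynomial.coe_eval₂Hom, MvPolynomial.eval₂_rename, MvPolynomial.eval₂_map, hc]
    rfl
  have e2 : ∀ (v : Option (MIdx γ n) → ℂ) (m : Fin k),
      MvPolynomial.eval₂Hom (χ : _ →+* ℂ) v (∑ g : Fin γ, ∑ i : Fin n, ∑ l : Fin n,
      (MvPolynomial.X (some (g, i, l)) -
        MvPolynomial.C (Ideal.Quotient.mk (vanIdeal S) (MvPolynomial.X (g, i, l)))) *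
        MvPolynomial.C (algebraMap ℂ _ (A m (g, l, i)))) =
      trPair (fun i => v (some i)) (A m) - trPair (ptOf χ) (A m) := by
    intro v m
    simp only [trPair, ← Finset.sum_sub_distrib, map_sum, map_mul, map_sub,
      MvPolynomial.eval₂Hom_X', MvPolynomial.eval₂Hom_C, RingHom.coe_coe, AlgHom.commutes,
      ptOf, sub_mul, Algebra.algebraMap_self, RingHom.id_apply]
  have e3 : ∀ (v : Option (MIdx γ n) → ℂ),
      MvPolynomial.eval₂Hom (χ : _ →+* ℂ) v (MvPolynomial.X none *
    (MvPolynomial.C (Ideal.Quotient.mk (vanIdeal S) (MvPolynomial.X j)) -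
      MvPolynomial.X (some j)) - 1) = v none * (ptOf χ j - v (some j)) - 1 := by
    intro v
    simp [ptOf]
  constructor
  · rintro ⟨v, hv⟩
    refine ⟨fun i => v (some i), ⟨?_, fun m => ?_⟩, fun h => ?_⟩
    · have hS' := hS
      obtain ⟨T, hT⟩ := hS'
      rw [hT]
      intro p hp
      rw [← e1]
      refine hv _ (Or.inl (Or.inl ⟨p, fun x hx => ?_, rfl⟩))
      rw [hT] at hx
      exact hx p hp
    · have := hv _ (Or.inl (Or.inr ⟨m, rfl⟩))
      rw [e2, sub_eq_zero] at this
      exact this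
    · have := hv _ (Or.inr rfl)
      have h' : v (some j) = ptOf χ j := h
      rw [e3, h'] at this
      simp at this
  · rintro ⟨W, ⟨hWS, hW⟩, hj⟩
    refine ⟨fun o => o.elim ((ptOf χ j - W j)⁻¹) W, ?_⟩
    rintro e ((⟨p, hp, rfl⟩ | ⟨m, rfl⟩) | rfl)
    · rw [e1]
      exact hp W hWS
    · rw [e2, sub_eq_zero]
      exact hW m
    · rw [e3]
      have : ptOf χ j - W j ≠ 0 := sub_ne_zero.2 hj.symm
      simp [this]

/-- The core: a nonempty Zariski-open part of `S` consists of identifiable points. -/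
lemma exists_generic_identifiable {γ n k : ℕ}
    (S : Set (MSpace γ n)) (hScl : IsZClosed S)
    (hSirr : @IsIrreducible _ (zTop (MIdx γ n)) S) (A : Fin k → MSpace γ n)
    (hex : ∃ Z ∈ S, PerturbStable S A Z) :
    ∃ F : MvPolynomial (MIdx γ n) ℂ, (∃ x ∈ S, MvPolynomial.eval x F ≠ 0) ∧
      ∀ x ∈ S, MvPolynomial.eval x F ≠ 0 → prFiber S A x = {x} := by
  have hprime := vanIdeal_prime S hSirr
  choose f hf hd using fun j => chevalley_eqs (pairEqs S A j)
  simp only [pairEqs_iff S hScl] at hd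
  have hall : ∀ j, ∀ χ : (MvPolynomial (MIdx γ n) ℂ ⧸ vanIdeal S) →ₐ[ℂ] ℂ, χ (f j) ≠ 0 →
      ¬ ∃ W ∈ prFiber S A (ptOf χ), W j ≠ ptOf χ j := by
    intro j
    refine (hd j).resolve_left fun h => ?_
    obtain ⟨Z, hZ, U, hU, hZU, hstab⟩ := hex
    obtain ⟨χ₀, rfl⟩ := exists_ptOf hZ
    obtain ⟨𝓕, χ, hχ, hlim⟩ := density_points (f j) (hf j) χ₀
    have ht : Tendsto (fun m => ptOf (χ m)) 𝓕 (𝓝 (ptOf χ₀)) := by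
      rw [tendsto_pi_nhds]
      intro i
      exact hlim _
    obtain ⟨m, hm⟩ := (ht.eventually (hU.mem_nhds hZU)).exists
    obtain ⟨W, hW, hne⟩ := h (χ m) (hχ m)
    rw [hstab _ ⟨hm, ptOf_mem hScl _⟩] at hW
    exact hne (by rw [Set.mem_singleton_iff.1 hW])
  obtain ⟨F, hF⟩ := Ideal.Quotient.mk_surjective (∏ j, f j)
  have hF0 : F ∉ vanIdeal S := by
    rw [← Ideal.Quotient.eq_zero_iff_mem, hF]
    exact Finset.prod_ne_zero_iff.2 fun j _ => hf j
  refine ⟨F, ?_, fun x hx hxF => ?_⟩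
  · by_contra! h
    exact hF0 h
  · obtain ⟨χ, rfl⟩ := exists_ptOf hx
    rw [← eval_ptOf, hF, map_prod, Finset.prod_ne_zero_iff] at hxF
    ext W
    rw [Set.mem_singleton_iff]
    constructor
    · intro hW
      ext j
      by_contra hne
      exact hall j χ (hxF j (Finset.mem_univ j)) ⟨W, hW, hne⟩
    · rintro rfl
      exact ⟨hx, fun _ => rfl⟩

/-- Let `S ⊆ (ℂ^{n×n})^γ` (`γ ∈ {1,2}`) be an irreducible
Zariski-closed signal set and `A` a measurement tuple whose forward map `φ_A` is
generically unramified. If some `Z ∈ S` is perturbation-stably identifiable,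
then the non-perturbation-stably-identifiable signals are contained in a
Zariski-closed set meeting `S` in a proper subset; in particular the stable
signals and their complement in `S` cannot both contain a nonempty relatively
Zariski-open subset of `S`. -/
theorem stmt_15 (n k γ : ℕ) (hn : 1 ≤ n) (hk : 1 ≤ k) (hγ : γ = 1 ∨ γ = 2)
    (S : Set (MSpace γ n)) (hScl : IsZClosed S)
    (hSirr : @IsIrreducible _ (zTop (MIdx γ n)) S)
    (A : Fin k → MSpace γ n)
    (hgu : GenericallyUnramified S A)
    (hex : ∃ Z ∈ S, PerturbStable S A Z) :
    (∃ C : Set (MSpace γ n), IsZClosed C ∧ C ∩ S ≠ S ∧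
      {Z | Z ∈ S ∧ ¬ PerturbStable S A Z} ⊆ C) ∧
    ¬ ∃ U V : Set (MSpace γ n), IsZClosed Uᶜ ∧ IsZClosed Vᶜ ∧
        (U ∩ S).Nonempty ∧ (V ∩ S).Nonempty ∧
        (∀ Z ∈ U ∩ S, PerturbStable S A Z) ∧
        (∀ Z ∈ V ∩ S, ¬ PerturbStable S A Z) := by
  obtain ⟨F, ⟨x₀, hx₀, hFx₀⟩, hF⟩ := exists_generic_identifiable S hScl hSirr A hex
  have hgood : ∀ Z ∈ S, MvPolynomial.eval Z F ≠ 0 → PerturbStable S A Z := by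
    intro Z hZ hZF
    refine ⟨{x | MvPolynomial.eval x F ≠ 0}, ?_, hZF, fun W hW => hF W hW.2 hW.1⟩
    exact isOpen_ne_fun (MvPolynomial.continuous_eval F) continuous_const
  refine ⟨⟨{x | MvPolynomial.eval x F = 0}, ⟨{F}, by simp⟩, fun h => ?_, ?_⟩, ?_⟩
  · rw [← h] at hx₀
    exact hFx₀ hx₀.1
  · rintro Z ⟨hZ, hns⟩
    by_contra h
    exact hns (hgood Z hZ h)
  · rintro ⟨U, V, -, ⟨T, hT⟩, -, ⟨y, hyV, hyS⟩, -, hV⟩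
    have hy : ∃ p ∈ T, MvPolynomial.eval y p ≠ 0 := by
      by_contra! h
      have : y ∈ Vᶜ := by rw [hT]; exact h
      exact this hyV
    obtain ⟨p, hpT, hyp⟩ := hy
    obtain ⟨w, hw, hwp, hwF⟩ := hSirr.2 {x | MvPolynomial.eval x p ≠ 0}
      {x | MvPolynomial.eval x F ≠ 0}
      (TopologicalSpace.GenerateOpen.basic _ ⟨p, rfl⟩)
      (TopologicalSpace.GenerateOpen.basic _ ⟨F, rfl⟩) ⟨y, hyS, hyp⟩ ⟨x₀, hx₀, hFx₀⟩
    refine hV w ⟨?_, hw⟩ (hgood w hw hwF)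
    by_contra hwV
    have : w ∈ Vᶜ := hwV
    rw [hT] at this
    exact hwp (this p hpT)
end

section
/- Let n, k ≥ 1, γ ∈ {1,2}, let S ⊆ (ℂ^{n×n})^γ be an irreducible Zariski-closed set, let A = (A_1,…,A_k) with A_i ∈ (ℂ^{n×n})^γ, and let φ_A : S → ℂ^k, φ_A(Z) = (Tr(Z·A_1),…,Tr(Z·A_k)). Assume φ_A is generically unramified. Then exactly one of the following holds: (a) the set of Z ∈ S with φ_A⁻¹(φ_A(Z)) = {Z} is contained in a Zariski-closed set meeting S in a proper subset (a generic signal is not identifiable); (b) the set of Z ∈ S with φ_A⁻¹(φ_A(Z)) ≠ {Z} is nonempty and contained in a Zariski-closed set meeting S in a proper subset (a generic, but not every, signal is identifiable); (c) φ_A⁻¹(φ_A(Z)) = {Z} for every Z ∈ S (every signal is identifiable). Moreover these cases are respectively equivalent to: (a') no Z ∈ S is perturbation-stably identifiable; (b') the set of Z ∈ S that are not perturbation-stably identifiable is nonempty and contained in a Zariski-closed set meeting S in a proper subset; (c') every Z ∈ S is perturbation-stably identifiable. -/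
theorem constr_dichotomy {R : Type*} [CommRing R] (η : PrimeSpectrum R) (s : Set (PrimeSpectrum R))
    (hs : Topology.IsConstructible s) : ∃ f, f ∉ η.asIdeal ∧
      ((∀ x : PrimeSpectrum R, η.asIdeal ≤ x.asIdeal → f ∉ x.asIdeal → x ∈ s) ∨
       (∀ x : PrimeSpectrum R, η.asIdeal ≤ x.asIdeal → f ∉ x.asIdeal → x ∉ s)) := by
  induction hs using Topology.IsConstructible.empty_union_induction with
  | open_retrocompact U hU _ =>
    by_cases h : η ∈ U
    · obtain ⟨_, ⟨f, rfl⟩, hf, hfU⟩ :=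
        PrimeSpectrum.isTopologicalBasis_basic_opens.exists_subset_of_mem_open h hU
      exact ⟨f, hf, Or.inl fun x _ hx => hfU hx⟩
    · refine ⟨1, fun h1 => η.2.ne_top ((Ideal.eq_top_iff_one _).2 h1), Or.inr fun x hx _ hxU => h ?_⟩
      exact ((PrimeSpectrum.le_iff_specializes η x).1 hx).mem_open hU hxU
  | union s hs t ht ihs iht =>
    obtain ⟨f, hf, h1⟩ := ihs
    obtain ⟨g, hg, h2⟩ := iht
    refine ⟨f * g, fun h => (η.2.mem_or_mem h).elim hf hg, ?_⟩
    have key : ∀ x : PrimeSpectrum R, f * g ∉ x.asIdeal → f ∉ x.asIdeal ∧ g ∉ x.asIdeal :=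
      fun x h => ⟨fun h' => h (Ideal.mul_mem_right _ _ h'), fun h' => h (Ideal.mul_mem_left _ _ h')⟩
    rcases h1 with h1 | h1
    · exact Or.inl fun x hx hfx => Or.inl (h1 x hx (key x hfx).1)
    · rcases h2 with h2 | h2
      · exact Or.inl fun x hx hfx => Or.inr (h2 x hx (key x hfx).2)
      · exact Or.inr fun x hx hfx h => h.elim (h1 x hx (key x hfx).1) (h2 x hx (key x hfx).2)
  | compl s hs ih =>
    obtain ⟨f, hf, h⟩ := ih
    refine ⟨f, hf, ?_⟩
    rcases h with h | h
    · exact Or.inr fun x hx hfx h' => h' (h x hx hfx)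
    · exact Or.inl fun x hx hfx h' => (h x hx hfx h')

open MvPolynomial in
/-- Dichotomy for projections of locally closed sets `{p = 0 ∀ p ∈ T, some q ∈ Q nonzero}`. -/
theorem proj_dichotomy {σ : Type*} [Finite σ] (P : Ideal (MvPolynomial σ ℂ)) [hP : P.IsPrime]
    (T : Set (MvPolynomial (σ ⊕ σ) ℂ)) (Q : Set (MvPolynomial (σ ⊕ σ) ℂ)) :
    ∃ f, f ∉ P ∧
     ((∀ z : σ → ℂ, (∀ p ∈ P, eval z p = 0) → eval z f ≠ 0 →
        ∃ w : σ → ℂ, (∀ p ∈ T, eval (Sum.elim z w) p = 0) ∧ ∃ q ∈ Q, eval (Sum.elim z w) q ≠ 0) ∨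
      (∀ z : σ → ℂ, (∀ p ∈ P, eval z p = 0) → eval z f ≠ 0 →
        ¬ ∃ w : σ → ℂ, (∀ p ∈ T, eval (Sum.elim z w) p = 0) ∧ ∃ q ∈ Q, eval (Sum.elim z w) q ≠ 0)) := by
  let ι : MvPolynomial σ ℂ →+* MvPolynomial (σ ⊕ σ) ℂ := (rename Sum.inl : _ →ₐ[ℂ] _).toRingHom
  have hι : ι.FinitePresentation := by
    rw [← RingHom.FinitePresentation.of_finiteType]
    apply RingHom.FiniteType.of_comp_finiteType (f := (C : ℂ →+* MvPolynomial σ ℂ))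
    have : ι.comp C = (C : ℂ →+* MvPolynomial (σ ⊕ σ) ℂ) := by ext x; simp [ι]
    rw [this]
    have : Algebra.FiniteType ℂ (MvPolynomial (σ ⊕ σ) ℂ) := inferInstance
    exact (RingHom.finiteType_algebraMap (A := ℂ)).2 this
  let E : Set (PrimeSpectrum (MvPolynomial (σ ⊕ σ) ℂ)) :=
    PrimeSpectrum.zeroLocus T ∩ (PrimeSpectrum.zeroLocus Q)ᶜ
  have hE : Topology.IsConstructible E := by
    have h : ∀ X : Set (MvPolynomial (σ ⊕ σ) ℂ),
        Topology.IsConstructible (PrimeSpectrum.zeroLocus X)ᶜ := fun X =>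
      (TopologicalSpace.NoetherianSpace.isCompact _).isConstructible
        (PrimeSpectrum.isClosed_zeroLocus X).isOpen_compl
    exact (h T).of_compl.inter (h Q)
  obtain ⟨f, hf, h⟩ := constr_dichotomy ⟨P, hP⟩ _ (PrimeSpectrum.isConstructible_comap_image hι hE)
  refine ⟨f, hf, ?_⟩
  have key : ∀ z : σ → ℂ, (pointToPoint (k := ℂ) z ∈ PrimeSpectrum.comap ι '' E ↔
      ∃ w : σ → ℂ, (∀ p ∈ T, eval (Sum.elim z w) p = 0) ∧
        ∃ q ∈ Q, eval (Sum.elim z w) q ≠ 0) := by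
    intro z
    constructor
    · rintro ⟨x, ⟨hxT, hxQ⟩, hx⟩
      obtain ⟨q, hq, hqx⟩ := Set.not_subset.1 hxQ
      have hj : x.asIdeal.jacobson = x.asIdeal :=
        IsJacobsonRing.out inferInstance x.2.isRadical
      have hqx' : q ∉ x.asIdeal := hqx
      rw [← hj, Ideal.jacobson, Ideal.mem_sInf] at hqx'
      push Not at hqx'
      obtain ⟨M, ⟨hxM, hM⟩, hqM⟩ := hqx'
      obtain ⟨v, rfl⟩ := isMaximal_iff_eq_vanishingIdeal_singleton.1 hM
      have hv : ∀ p, p ∈ (vanishingIdeal ℂ {v} : Ideal _) ↔ eval v p = 0 := fun p => by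
        rw [mem_vanishingIdeal_singleton_iff]; rfl
      have hz : ∀ i, v (Sum.inl i) = z i := by
        intro i
        have h1 : (X i - C (z i) : MvPolynomial σ ℂ) ∈ (PrimeSpectrum.comap ι x).asIdeal := by
          rw [hx]
          change _ ∈ (vanishingIdeal ℂ {z} : Ideal _)
          rw [mem_vanishingIdeal_singleton_iff]
          simp
        have h2 := hxM (show ι (X i - C (z i)) ∈ x.asIdeal from h1)
        rw [hv] at h2
        simpa [ι, sub_eq_zero] using h2
      have hvz : v = Sum.elim z (v ∘ Sum.inr) := by
        funext i; rcases i with i | i <;> simp [hz]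
      refine ⟨v ∘ Sum.inr, fun p hp => ?_, q, hq, ?_⟩
      · rw [← hvz]; exact (hv p).1 (hxM (hxT hp))
      · rw [← hvz]; exact fun h => hqM ((hv q).2 h)
    · rintro ⟨w, hw, q, hq, hqw⟩
      have hv : ∀ p, p ∈ (pointToPoint (k := ℂ) (Sum.elim z w)).asIdeal ↔
          eval (Sum.elim z w) p = 0 := fun p => by
        change _ ∈ (vanishingIdeal ℂ {Sum.elim z w} : Ideal _) ↔ _
        rw [mem_vanishingIdeal_singleton_iff]; rfl
      refine ⟨pointToPoint (Sum.elim z w), ⟨fun p hp => (hv p).2 (hw p hp),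
        fun h => hqw ((hv q).1 (h hq))⟩, ?_⟩
      apply PrimeSpectrum.ext
      ext p
      change ι p ∈ (pointToPoint (k := ℂ) (Sum.elim z w)).asIdeal ↔
        _ ∈ (vanishingIdeal ℂ {z} : Ideal _)
      rw [hv, mem_vanishingIdeal_singleton_iff]
      simp [ι, eval_rename, aeval_eq_eval]
  have key2 : ∀ z : σ → ℂ, (∀ p ∈ P, eval z p = 0) → P ≤ (pointToPoint (k := ℂ) z).asIdeal :=
    fun z hz p hp => (mem_vanishingIdeal_singleton_iff z p).2 (hz p hp)
  have key3 : ∀ z : σ → ℂ, eval z f ≠ 0 → f ∉ (pointToPoint (k := ℂ) z).asIdeal :=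
    fun z hz hp => hz ((mem_vanishingIdeal_singleton_iff z f).1 hp)
  rcases h with h | h
  · exact Or.inl fun z hz hfz => (key z).1 (h _ (key2 z hz) (key3 z hfz))
  · exact Or.inr fun z hz hfz hw => h _ (key2 z hz) (key3 z hfz) ((key z).2 hw)

open MvPolynomial in
theorem lift_point {B : Type*} [CommRing B] [IsDomain B] [Algebra ℂ B] [Algebra.FiniteType ℂ B]
    {s : ℕ} [Algebra (MvPolynomial (Fin s) ℂ) B] [IsScalarTower ℂ (MvPolynomial (Fin s) ℂ) B]
    [FaithfulSMul (MvPolynomial (Fin s) ℂ) B] [Algebra.IsIntegral (MvPolynomial (Fin s) ℂ) B]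
    (b : B) (y : Fin s → ℂ) (τ : ℂ)
    (h : ((minpoly (MvPolynomial (Fin s) ℂ) b).map (eval y)).IsRoot τ) :
    ∃ χ : B →ₐ[ℂ] ℂ, χ b = τ ∧
      ∀ r, χ (algebraMap (MvPolynomial (Fin s) ℂ) B r) = eval y r := by
  let R := MvPolynomial (Fin s) ℂ
  let ψ : Polynomial R →+* ℂ := Polynomial.eval₂RingHom (eval y) τ
  have hψC : ∀ r : R, ψ (Polynomial.C r) = eval y r := fun r => by simp [ψ]
  have hψX : ψ Polynomial.X = τ := by simp [ψ]
  have hψ : Function.Surjective ψ := fun c => ⟨Polynomial.C (C c), by rw [hψC]; simp⟩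
  let alg : Algebra (Polynomial R) B := (Polynomial.aeval (R := R) b).toRingHom.toAlgebra
  have halg : ∀ p, algebraMap (Polynomial R) B p = Polynomial.aeval b p := fun p => rfl
  have : IsScalarTower R (Polynomial R) B := IsScalarTower.of_algebraMap_eq fun r => by
    rw [halg]; simp
  have : Algebra.IsIntegral (Polynomial R) B := Algebra.IsIntegral.tower_top R
  have hm : (RingHom.ker ψ).IsMaximal := RingHom.ker_isMaximal_of_surjective ψ hψ
  have : Module.IsTorsionFree R B := inferInstance
  obtain ⟨Q, hQ, hQc⟩ := Ideal.exists_ideal_over_maximal_of_isIntegral (S := B) (RingHom.ker ψ) (by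
    intro p hp
    rw [RingHom.mem_ker, halg] at hp
    obtain ⟨q, rfl⟩ := minpoly.isIntegrallyClosed_dvd (Algebra.IsIntegral.isIntegral (R := R) b) hp
    rw [RingHom.mem_ker, map_mul]
    have : ψ (minpoly R b) = 0 := by
      have h' := h
      rw [Polynomial.IsRoot, Polynomial.eval_map] at h'
      exact h'
    rw [this, zero_mul])
  let : Field (B ⧸ Q) := Ideal.Quotient.field Q
  have : Module.Finite ℂ (B ⧸ Q) := finite_of_finite_type_of_isJacobsonRing ℂ (B ⧸ Q)
  have hbij : Function.Bijective (algebraMap ℂ (B ⧸ Q)) :=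
    IsAlgClosed.algebraMap_bijective_of_isIntegral
  let e : ℂ ≃ₐ[ℂ] (B ⧸ Q) := AlgEquiv.ofBijective (Algebra.ofId ℂ (B ⧸ Q)) hbij
  let χ : B →ₐ[ℂ] ℂ := e.symm.toAlgHom.comp (Ideal.Quotient.mkₐ ℂ Q)
  have hχ : ∀ x ∈ Q, χ x = 0 := fun x hx => by
    have : Ideal.Quotient.mk Q x = 0 := Ideal.Quotient.eq_zero_iff_mem.2 hx
    simp [χ, this]
  have key : ∀ p : Polynomial R, χ (Polynomial.aeval b p) = ψ p := by
    intro p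
    have h1 : p - Polynomial.C (C (ψ p)) ∈ Q.comap (algebraMap (Polynomial R) B) := by
      rw [hQc, RingHom.mem_ker, map_sub, hψC]; simp
    have h2 := hχ _ h1
    rw [halg, map_sub, map_sub, Polynomial.aeval_C, sub_eq_zero] at h2
    rw [h2]
    have : algebraMap R B (C (ψ p)) = algebraMap ℂ B (ψ p) :=
      (IsScalarTower.algebraMap_apply ℂ R B (ψ p)).symm
    rw [this, AlgHom.commutes]; rfl
  refine ⟨χ, ?_, fun r => ?_⟩
  · have := key Polynomial.X
    rwa [Polynomial.aeval_X, hψX] at this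
  · have := key (Polynomial.C r)
    rwa [Polynomial.aeval_C, hψC] at this

open MvPolynomial Topology Filter in
theorem line_nonvanish {s : ℕ} (h : MvPolynomial (Fin s) ℂ) (hh : h ≠ 0) (y0 : Fin s → ℂ) :
    ∃ d : Fin s → ℂ, ∀ᶠ t in 𝓝[≠] (0 : ℂ), eval (y0 + t • d) h ≠ 0 := by
  have : ∃ y1, eval y1 h ≠ 0 := by
    by_contra hc
    push Not at hc
    exact hh (MvPolynomial.funext fun x => by simp [hc x])
  obtain ⟨y1, hy1⟩ := this
  refine ⟨y1 - y0, ?_⟩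
  let q : Polynomial ℂ := aeval (fun i => Polynomial.C (y0 i) +
    Polynomial.X * Polynomial.C (y1 i - y0 i)) h
  have hq : ∀ t, q.eval t = eval (y0 + t • (y1 - y0)) h := by
    intro t
    have : ((Polynomial.aeval t).comp (aeval (fun i => Polynomial.C (y0 i) +
      Polynomial.X * Polynomial.C (y1 i - y0 i))) : MvPolynomial (Fin s) ℂ →ₐ[ℂ] ℂ) =
      aeval (y0 + t • (y1 - y0)) := by
      apply MvPolynomial.algHom_ext
      intro i
      simp
    have h2 := DFunLike.congr_fun this h
    simpa [q, aeval_eq_eval, Polynomial.aeval_def] using h2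
  have hq0 : q ≠ 0 := by
    intro h0
    have := hq 1
    rw [h0] at this
    simp at this
    exact hy1 this.symm
  have hfin : (({t | q.IsRoot t} : Set ℂ) \ {0}).Finite :=
    (Polynomial.finite_setOfPred_isRoot hq0).subset Set.sdiff_subset
  have hn : (({t | q.IsRoot t} : Set ℂ) \ {0})ᶜ ∈ 𝓝 (0 : ℂ) :=
    hfin.isClosed.isOpen_compl.mem_nhds (by simp)
  filter_upwards [nhdsWithin_le_nhds hn, self_mem_nhdsWithin] with t ht ht0 h0
  exact ht ⟨by rw [Set.mem_ofPred_eq, Polynomial.IsRoot, hq, h0], ht0⟩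

open MvPolynomial Topology Filter in
theorem root_bound_s16 {s : ℕ} (p : Polynomial (MvPolynomial (Fin s) ℂ)) (hp : p.Monic)
    (y0 : Fin s → ℂ) :
    ∃ M : ℝ, ∀ᶠ y in 𝓝 y0, ∀ τ, (p.map (eval y)).IsRoot τ → ‖τ‖ ≤ M := by
  let F : (Fin s → ℂ) → ℝ := fun y => ∑ i ∈ Finset.range p.natDegree, ‖eval y (p.coeff i)‖ + 1
  have hF : Continuous F := by
    refine (continuous_finsetSum _ fun i _ => ?_).add continuous_const
    exact (MvPolynomial.continuous_eval (p.coeff i)).norm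
  refine ⟨F y0 + 1, ?_⟩
  filter_upwards [hF.continuousAt.eventually (gt_mem_nhds (lt_add_one (F y0)))] with y hy τ hτ
  have hm := hp.map (eval y)
  have h1 := hτ.norm_lt_cauchyBound hm.ne_zero
  have h2 : ((p.map (eval y)).cauchyBound : ℝ) ≤ F y := by
    rw [Polynomial.cauchyBound, hm.leadingCoeff, hp.natDegree_map]
    simp only [nnnorm_one, div_one, NNReal.coe_add, NNReal.coe_one, F, Polynomial.coeff_map]
    gcongr
    have : (Finset.range p.natDegree).sup (fun i => ‖eval y (p.coeff i)‖₊) ≤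
        ∑ i ∈ Finset.range p.natDegree, ‖eval y (p.coeff i)‖₊ :=
      Finset.sup_le fun i hi => Finset.single_le_sum (f := fun i => ‖eval y (p.coeff i)‖₊)
        (fun _ _ => zero_le) hi
    have h' := NNReal.coe_le_coe.2 this
    rw [NNReal.coe_sum] at h'
    exact h'
  have h3 : ‖τ‖ < ((p.map (eval y)).cauchyBound : ℝ) := by exact_mod_cast h1
  linarith

theorem near_root (q : Polynomial ℂ) (hq : q.Monic) (hd : q.natDegree ≠ 0) (τ : ℂ) :
    ∃ r, q.IsRoot r ∧ ‖r - τ‖ ^ q.natDegree ≤ ‖q.eval τ‖ := by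
  classical
  have hs : q.Splits := IsAlgClosed.splits q
  have hcard : q.roots.card = q.natDegree := hs.natDegree_eq_card_roots.symm
  have hne : q.roots.toFinset.Nonempty := by
    obtain ⟨x, hx⟩ := Multiset.card_pos_iff_exists_mem.1 (hcard ▸ Nat.pos_of_ne_zero hd)
    exact ⟨x, Multiset.mem_toFinset.2 hx⟩
  obtain ⟨r, hr, hmin⟩ := Finset.exists_min_image _ (fun r => ‖r - τ‖) hne
  refine ⟨r, Polynomial.isRoot_of_mem_roots (Multiset.mem_toFinset.1 hr), ?_⟩
  have hev : q.eval τ = (q.roots.map (fun a => τ - a)).prod := by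
    conv_lhs => rw [hs.eq_prod_roots_of_monic hq]
    simp [Polynomial.eval_multiset_prod, Multiset.map_map]
  rw [hev, ← hcard]
  have : ∀ m : Multiset ℂ, (∀ a ∈ m, ‖r - τ‖ ≤ ‖a - τ‖) →
      ‖r - τ‖ ^ m.card ≤ ‖(m.map (fun a => τ - a)).prod‖ := by
    intro m
    induction m using Multiset.induction_on with
    | empty => simp
    | cons a m ih =>
      intro h
      rw [Multiset.map_cons, Multiset.prod_cons, norm_mul, Multiset.card_cons, pow_succ', norm_sub_rev τ a]
      exact mul_le_mul (h a (Multiset.mem_cons_self a m))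
        (ih fun b hb => h b (Multiset.mem_cons_of_mem hb)) (by positivity) (norm_nonneg _)
  exact this _ fun a ha => hmin a (Multiset.mem_toFinset.2 ha)

open MvPolynomial in
theorem separate {σ : Type*} (z0 : σ → ℂ) (F : Set (σ → ℂ)) (hF : F.Finite) :
    ∃ g : MvPolynomial σ ℂ, eval z0 g ≠ 0 ∧ ∀ z ∈ F, eval z g ≠ 0 → z = z0 := by
  induction F, hF using Set.Finite.induction_on with
  | empty => exact ⟨1, by simp, by simp⟩
  | @insert a F _ _ ih =>
    obtain ⟨g, h0, h⟩ := ih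
    by_cases ha : a = z0
    · refine ⟨g, h0, ?_⟩
      rintro z (rfl | hz) hg
      · exact ha
      · exact h z hz hg
    · obtain ⟨i, hi⟩ := Function.ne_iff.1 ha
      refine ⟨g * (X i - C (a i)), ?_, ?_⟩
      · simp [h0, sub_eq_zero, Ne.symm hi]
      · rintro z (rfl | hz) hg
        · simp at hg
        · refine h z hz fun h => hg ?_
          simp [h]

set_option maxHeartbeats 1000000 in
open MvPolynomial Topology Filter in
/-- Zariski-open dense subsets of an irreducible variety are Euclidean-dense. -/
theorem zariski_dense {σ : Type*} [Finite σ] (P : Ideal (MvPolynomial σ ℂ)) [hP : P.IsPrime]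
    (f : MvPolynomial σ ℂ) (hf : f ∉ P) (z0 : σ → ℂ) (hz0 : ∀ p ∈ P, eval z0 p = 0)
    (U : Set (σ → ℂ)) (hU : IsOpen U) (hzU : z0 ∈ U) :
    ∃ z ∈ U, (∀ p ∈ P, eval z p = 0) ∧ eval z f ≠ 0 := by
  have := Fintype.ofFinite σ
  let B := MvPolynomial σ ℂ ⧸ P
  obtain ⟨s, g, ginj, gint⟩ := exists_integral_inj_algHom_of_fg ℂ B
  let R := MvPolynomial (Fin s) ℂ
  let : Algebra R B := g.toRingHom.toAlgebra
  have halg : ∀ r : R, algebraMap R B r = g r := fun r => rfl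
  have : IsScalarTower ℂ R B := IsScalarTower.of_algebraMap_eq fun c => by
    rw [halg]; exact (g.commutes c).symm
  have : FaithfulSMul R B := (faithfulSMul_iff_algebraMap_injective R B).2 ginj
  have : Algebra.IsIntegral R B := ⟨gint⟩
  have hmk : Function.Surjective (Ideal.Quotient.mk P) := Ideal.Quotient.mk_surjective
  choose Y hY using fun j : Fin s => hmk (g (X j))
  let π : (σ → ℂ) → Fin s → ℂ := fun z j => eval z (Y j)
  have hπ : Continuous π := continuous_pi fun j => MvPolynomial.continuous_eval (Y j)
  -- evaluation at a point
  have hev : ∀ z : σ → ℂ, (∀ p ∈ P, eval z p = 0) → ∃ χ : B →ₐ[ℂ] ℂ,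
      (∀ p, χ (Ideal.Quotient.mk P p) = eval z p) ∧ ∀ r : R, χ (algebraMap R B r) = eval (π z) r := by
    intro z hz
    let χ : B →ₐ[ℂ] ℂ := Ideal.Quotient.liftₐ P (aeval z) hz
    have h1 : ∀ p, χ (Ideal.Quotient.mk P p) = eval z p := fun p => rfl
    refine ⟨χ, h1, fun r => ?_⟩
    have : χ.comp g = aeval (π z) := by
      apply MvPolynomial.algHom_ext
      intro j
      rw [AlgHom.comp_apply, ← hY j, h1, aeval_X]
    exact DFunLike.congr_fun this r
  have hroot : ∀ (z : σ → ℂ), (∀ p ∈ P, eval z p = 0) → ∀ q : MvPolynomial σ ℂ,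
      ((minpoly R (Ideal.Quotient.mk P q)).map (eval (π z))).IsRoot (eval z q) := by
    intro z hz q
    obtain ⟨χ, h1, h2⟩ := hev z hz
    have h3 : χ.toRingHom.comp (algebraMap R B) = eval (π z) := RingHom.ext h2
    have h4 := congrArg χ.toRingHom (minpoly.aeval R (Ideal.Quotient.mk P q))
    rw [Polynomial.aeval_def, Polynomial.hom_eval₂, h3, map_zero] at h4
    rw [Polynomial.IsRoot, Polynomial.eval_map, ← h1]
    exact h4
  have hBint : ∀ b : B, IsIntegral R b := fun b => Algebra.IsIntegral.isIntegral b
  -- the nonvanishing of `f` follows from that of `h`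
  have hfB : Ideal.Quotient.mk P f ≠ 0 := fun h => hf (Ideal.Quotient.eq_zero_iff_mem.1 h)
  obtain ⟨h, hh, hdvd⟩ := (hBint (Ideal.Quotient.mk P f)).isAlgebraic.exists_nonzero_dvd
    (mem_nonZeroDivisors_of_ne_zero hfB)
  have hhf : ∀ z : σ → ℂ, (∀ p ∈ P, eval z p = 0) → eval (π z) h ≠ 0 → eval z f ≠ 0 := by
    intro z hz hne h0
    obtain ⟨χ, h1, h2⟩ := hev z hz
    obtain ⟨c, hc⟩ := hdvd
    apply hne
    rw [← h2, hc, map_mul, h1, h0, zero_mul]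
  -- finite fiber
  have hfib : {z : σ → ℂ | (∀ p ∈ P, eval z p = 0) ∧ π z = π z0}.Finite := by
    refine (Set.Finite.pi' (t := fun i : σ => {τ : ℂ | ((minpoly R (Ideal.Quotient.mk P
      (X i : MvPolynomial σ ℂ))).map (eval (π z0))).IsRoot τ}) fun i => ?_).subset ?_
    · exact Polynomial.finite_setOfPred_isRoot ((minpoly.monic (hBint _)).map _).ne_zero
    · rintro z ⟨hz, hzz⟩ i
      have := hroot z hz (X i)
      rw [hzz, eval_X] at this
      exact this
  obtain ⟨q, hq0, hq⟩ := separate z0 _ hfib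
  obtain ⟨d, hd⟩ := line_nonvanish h hh (π z0)
  let b : B := Ideal.Quotient.mk P q
  let m := minpoly R b
  have hm : m.Monic := minpoly.monic (hBint b)
  have hmd : m.natDegree ≠ 0 := (minpoly.natDegree_pos (hBint b)).ne'
  let y : ℂ → Fin s → ℂ := fun t => π z0 + t • d
  have hy : Tendsto y (𝓝[≠] 0) (𝓝 (π z0)) := by
    have hc : Continuous y := by fun_prop
    have := (hc.tendsto 0).mono_left (nhdsWithin_le_nhds (s := {0}ᶜ))
    simpa [y] using this
  have hlift : ∀ t : ℂ, ∃ z : σ → ℂ, (∀ p ∈ P, eval z p = 0) ∧ π z = y t ∧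
      ‖eval z q - eval z0 q‖ ^ m.natDegree ≤ ‖(m.map (eval (y t))).eval (eval z0 q)‖ := by
    intro t
    obtain ⟨r, hr, hle⟩ := near_root (m.map (eval (y t))) (hm.map _)
      (by rw [hm.natDegree_map]; exact hmd) (eval z0 q)
    rw [hm.natDegree_map] at hle
    obtain ⟨χ, h1, h2⟩ := lift_point b (y t) r hr
    have hχ : ∀ p : MvPolynomial σ ℂ, χ (Ideal.Quotient.mk P p) =
        eval (fun i => χ (Ideal.Quotient.mk P (X i))) p := by
      intro p
      have : χ.comp (Ideal.Quotient.mkₐ ℂ P) = aeval (fun i => χ (Ideal.Quotient.mk P (X i))) := by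
        apply MvPolynomial.algHom_ext
        intro i
        rw [aeval_X]; rfl
      exact DFunLike.congr_fun this p
    refine ⟨fun i => χ (Ideal.Quotient.mk P (X i)), fun p hp => ?_, ?_, ?_⟩
    · rw [← hχ, Ideal.Quotient.eq_zero_iff_mem.2 hp, map_zero]
    · funext j
      change eval _ (Y j) = _
      rw [← hχ, hY, ← halg, h2, eval_X]
    · rw [← hχ, h1]; exact hle
  choose z hzP hzπ hzq using hlift
  -- an ultrafilter
  let 𝒰 : Ultrafilter ℂ := Ultrafilter.of (𝓝[≠] (0 : ℂ))
  have h𝒰 : (𝒰 : Filter ℂ) ≤ 𝓝[≠] 0 := Ultrafilter.of_le _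
  have hbd : ∀ i : σ, ∃ M : ℝ, ∀ᶠ t in 𝓝[≠] (0 : ℂ), ‖z t i‖ ≤ M := by
    intro i
    obtain ⟨M, hM⟩ := root_bound_s16 (minpoly R (Ideal.Quotient.mk P (X i : MvPolynomial σ ℂ)))
      (minpoly.monic (hBint _)) (π z0)
    refine ⟨M, ?_⟩
    filter_upwards [hy.eventually hM] with t ht
    apply ht
    have := hroot (z t) (hzP t) (X i)
    rwa [hzπ, eval_X] at this
  choose M hM using hbd
  have hK : IsCompact (Set.pi Set.univ fun i : σ => Metric.closedBall (0 : ℂ) (M i)) :=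
    isCompact_univ_pi fun i => isCompact_closedBall _ _
  have hzK : ∀ᶠ t in (𝒰 : Filter ℂ),
      z t ∈ Set.pi Set.univ fun i : σ => Metric.closedBall (0 : ℂ) (M i) := by
    filter_upwards [h𝒰 (eventually_all.2 hM)] with t ht i _
    simpa using ht i
  obtain ⟨zs, -, hzs⟩ := hK.ultrafilter_le_nhds (𝒰.map z) (Filter.le_principal_iff.2 hzK)
  have hzs : Tendsto z 𝒰 (𝓝 zs) := hzs
  have hzsP : ∀ p ∈ P, eval zs p = 0 := by
    intro p hp
    have h1 := ((MvPolynomial.continuous_eval p).tendsto zs).comp hzs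
    refine tendsto_nhds_unique h1 ?_
    exact (tendsto_const_nhds (x := (0 : ℂ))).congr fun t => (hzP t p hp).symm
  have hzsπ : π zs = π z0 := by
    have h1 := (hπ.tendsto zs).comp hzs
    refine tendsto_nhds_unique h1 ?_
    exact (hy.mono_left h𝒰).congr fun t => (hzπ t).symm
  have hzsq : eval zs q = eval z0 q := by
    have h1 := ((MvPolynomial.continuous_eval q).tendsto zs).comp hzs
    have h2 : Tendsto (fun t => ‖eval (z t) q - eval z0 q‖ ^ m.natDegree) 𝒰
        (𝓝 (‖eval zs q - eval z0 q‖ ^ m.natDegree)) := ((h1.sub_const _).norm).pow _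
    have h3 : Continuous fun v : Fin s → ℂ => ‖(m.map (eval v)).eval (eval z0 q)‖ := by
      have : (fun v : Fin s → ℂ => ‖(m.map (eval v)).eval (eval z0 q)‖) =
          fun v => ‖∑ i ∈ Finset.range (m.natDegree + 1), eval v (m.coeff i) * (eval z0 q) ^ i‖ := by
        funext v
        rw [Polynomial.eval_map, Polynomial.eval₂_eq_sum_range]
      rw [this]
      exact (continuous_finsetSum _ fun i _ =>
        (MvPolynomial.continuous_eval (m.coeff i)).mul continuous_const).norm
    have h4 := ((h3.tendsto (π z0)).comp hy).mono_left h𝒰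
    have h5 := le_of_tendsto_of_tendsto' h2 h4 hzq
    have h6 : (m.map (eval (π z0))).eval (eval z0 q) = 0 := hroot z0 hz0 q
    rw [h6, norm_zero] at h5
    have h7 := pow_eq_zero_iff hmd |>.1 (le_antisymm h5 (by positivity))
    exact sub_eq_zero.1 (norm_eq_zero.1 h7)
  have hzz : zs = z0 := hq zs ⟨hzsP, hzsπ⟩ (by rw [hzsq]; exact hq0)
  rw [hzz] at hzs
  obtain ⟨t, ht1, ht2⟩ := ((hzs.eventually (hU.mem_nhds hzU)).and (h𝒰 hd)).exists
  refine ⟨z t, ht1, hzP t, hhf _ (hzP t) ?_⟩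
  rw [hzπ]; exact ht2

open MvPolynomial in
theorem generic_iff {σ : Type*} (S : Set (σ → ℂ)) (Q : (σ → ℂ) → Prop) :
    (∃ C : Set (σ → ℂ), IsZClosed C ∧ C ∩ S ≠ S ∧ {Z | Z ∈ S ∧ Q Z} ⊆ C) ↔
    ∃ f : MvPolynomial σ ℂ, (∃ x ∈ S, eval x f ≠ 0) ∧ ∀ Z ∈ S, eval Z f ≠ 0 → ¬ Q Z := by
  constructor
  · rintro ⟨C, ⟨T, rfl⟩, hne, hsub⟩
    have : ∃ x ∈ S, ∃ p ∈ T, eval x p ≠ 0 := by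
      by_contra hc
      push Not at hc
      exact hne (Set.inter_eq_right.2 fun x hx p hp => hc x hx p hp)
    obtain ⟨x, hx, p, hp, hpx⟩ := this
    exact ⟨p, ⟨x, hx, hpx⟩, fun Z hZ hpZ hQ => hpZ (hsub ⟨hZ, hQ⟩ p hp)⟩
  · rintro ⟨f, ⟨x, hx, hfx⟩, h⟩
    refine ⟨{x | ∀ p ∈ ({f} : Set (MvPolynomial σ ℂ)), eval x p = 0}, ⟨_, rfl⟩, ?_, ?_⟩
    · intro he
      rw [← he] at hx
      exact hfx (hx.1 f rfl)
    · rintro Z ⟨hZ, hQ⟩ p rfl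
      by_contra hc
      exact h Z hZ hc hQ

open MvPolynomial in
theorem irr_mul {σ : Type*} {S : Set (σ → ℂ)} (hS : @IsIrreducible _ (zTop σ) S)
    {f g : MvPolynomial σ ℂ} (hf : ∃ x ∈ S, eval x f ≠ 0) (hg : ∃ x ∈ S, eval x g ≠ 0) :
    ∃ x ∈ S, eval x f ≠ 0 ∧ eval x g ≠ 0 := by
  have ho : ∀ p : MvPolynomial σ ℂ, @IsOpen _ (zTop σ) {x | eval x p ≠ 0} := fun p =>
    TopologicalSpace.isOpen_generateFrom_of_mem ⟨p, rfl⟩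
  exact hS.2 _ _ (ho f) (ho g) hf hg

/-- Let `S ⊆ (ℂ^{n×n})^γ` (`γ ∈ {1,2}`) be an irreducible
Zariski-closed signal set and `A` a measurement tuple whose forward map `φ_A` is
generically unramified. Then exactly one of the following holds:
(a) a generic signal is not identifiable; (b) a generic, but not every, signal
is identifiable; (c) every signal is identifiable. Moreover (a), (b), (c) are
respectively equivalent to the corresponding statements (a'), (b'), (c') with
"identifiable" replaced by "perturbation-stably identifiable". -/
theorem stmt_16 (n k γ : ℕ) (hn : 1 ≤ n) (hk : 1 ≤ k) (hγ : γ = 1 ∨ γ = 2)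
    (S : Set (MSpace γ n)) (hScl : IsZClosed S)
    (hSirr : @IsIrreducible _ (zTop (MIdx γ n)) S)
    (A : Fin k → MSpace γ n)
    (hgu : GenericallyUnramified S A) :
    let a : Prop := ∃ C : Set (MSpace γ n), IsZClosed C ∧ C ∩ S ≠ S ∧
      {Z | Z ∈ S ∧ Identifiable S A Z} ⊆ C
    let b : Prop := {Z | Z ∈ S ∧ ¬ Identifiable S A Z}.Nonempty ∧
      GenericallyIdentifying S A
    let c : Prop := CompletelyIdentifying S A
    let a' : Prop := ∀ Z ∈ S, ¬ PerturbStable S A Z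
    let b' : Prop := {Z | Z ∈ S ∧ ¬ PerturbStable S A Z}.Nonempty ∧
      ∃ C : Set (MSpace γ n), IsZClosed C ∧ C ∩ S ≠ S ∧
        {Z | Z ∈ S ∧ ¬ PerturbStable S A Z} ⊆ C
    let c' : Prop := ∀ Z ∈ S, PerturbStable S A Z
    (a ∨ b ∨ c) ∧ ¬ (a ∧ b) ∧ ¬ (a ∧ c) ∧ ¬ (b ∧ c) ∧
      (a ↔ a') ∧ (b ↔ b') ∧ (c ↔ c') := by
  intro a b c a' b' c'
  have hne : S.Nonempty := hSirr.1
  -- the vanishing ideal of `S`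
  let P : Ideal (MvPolynomial (MIdx γ n) ℂ) := MvPolynomial.vanishingIdeal ℂ S
  have hPmem : ∀ p, p ∉ P ↔ ∃ x ∈ S, MvPolynomial.eval x p ≠ 0 := by
    intro p
    have : p ∈ P ↔ ∀ x ∈ S, MvPolynomial.eval x p = 0 := Iff.rfl
    rw [this]; push Not; rfl
  have hPprime : P.IsPrime := by
    refine ⟨fun h => ?_, fun {p q} hpq => ?_⟩
    · obtain ⟨x, hx⟩ := hne
      have h1 : (1 : MvPolynomial (MIdx γ n) ℂ) ∉ P := (hPmem 1).2 ⟨x, hx, by simp⟩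
      exact h1 (h ▸ Submodule.mem_top)
    · by_contra hc
      push Not at hc
      obtain ⟨x, hx, h1, h2⟩ := irr_mul hSirr ((hPmem p).1 hc.1) ((hPmem q).1 hc.2)
      exact (hPmem (p * q)).2 ⟨x, hx, by simp [h1, h2]⟩ hpq
  have hSP : ∀ z, z ∈ S ↔ ∀ p ∈ P, MvPolynomial.eval z p = 0 := by
    intro z
    refine ⟨fun hz p hp => hp z hz, fun h => ?_⟩
    obtain ⟨T, hT⟩ := hScl
    rw [hT]
    intro p hp
    refine h p fun x hx => ?_
    rw [hT] at hx
    exact hx p hp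
  have hself : ∀ Z ∈ S, Z ∈ prFiber S A Z := fun Z hZ => ⟨hZ, fun _ => rfl⟩
  have hnid : ∀ Z ∈ S, (¬ Identifiable S A Z ↔ ∃ W, (W ∈ S ∧
      ∀ i, trPair W (A i) = trPair Z (A i)) ∧ W ≠ Z) := by
    intro Z hZ
    rw [Identifiable, Set.eq_singleton_iff_unique_mem]
    constructor
    · intro h
      by_contra hc
      push Not at hc
      exact h ⟨hself Z hZ, fun W hW => hc W hW⟩
    · rintro ⟨W, hW, hWZ⟩ h
      exact hWZ (h.2 W hW)
  -- Chevalley dichotomy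
  have hdich : a ∨ GenericallyIdentifying S A := by
    let L : Fin k → MvPolynomial (MIdx γ n ⊕ MIdx γ n) ℂ := fun l =>
      ∑ g : Fin γ, ∑ i : Fin n, ∑ j : Fin n,
        (MvPolynomial.X (Sum.inr (g, i, j)) - MvPolynomial.X (Sum.inl (g, i, j))) *
          MvPolynomial.C (A l (g, j, i))
    have hL : ∀ l z w, MvPolynomial.eval (Sum.elim z w) (L l) =
        trPair w (A l) - trPair z (A l) := by
      intro l z w
      simp [L, trPair, sub_mul, Finset.sum_sub_distrib]
    obtain ⟨f, hf, h⟩ := proj_dichotomy P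
      (((MvPolynomial.rename Sum.inr : MvPolynomial (MIdx γ n) ℂ → _) '' (P : Set _)) ∪ Set.range L)
      (Set.range fun i : MIdx γ n => MvPolynomial.X (Sum.inr i) - MvPolynomial.X (Sum.inl i))
    have key : ∀ z ∈ S, ((∃ w : MIdx γ n → ℂ, (∀ p ∈ ((MvPolynomial.rename Sum.inr :
        MvPolynomial (MIdx γ n) ℂ → _) '' (P : Set _)) ∪ Set.range L,
          MvPolynomial.eval (Sum.elim z w) p = 0) ∧
        ∃ q ∈ (Set.range fun i : MIdx γ n => MvPolynomial.X (Sum.inr i) -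
          (MvPolynomial.X (Sum.inl i) : MvPolynomial (MIdx γ n ⊕ MIdx γ n) ℂ)),
          MvPolynomial.eval (Sum.elim z w) q ≠ 0) ↔ ¬ Identifiable S A z) := by
      intro z hz
      rw [hnid z hz]
      refine exists_congr fun w => and_congr ?_ ?_
      · rw [hSP w]
        constructor
        · intro h
          refine ⟨fun p hp => ?_, fun l => ?_⟩
          · have := h _ (Or.inl ⟨p, hp, rfl⟩)
            simpa [MvPolynomial.eval_rename] using this
          · have := h _ (Or.inr ⟨l, rfl⟩)
            rw [hL] at this
            exact sub_eq_zero.1 this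
        · rintro ⟨h1, h2⟩ _ (⟨p, hp, rfl⟩ | ⟨l, rfl⟩)
          · simpa [MvPolynomial.eval_rename] using h1 p hp
          · rw [hL, h2, sub_self]
      · rw [Function.ne_iff]
        simp [sub_eq_zero]
    rcases h with h | h
    · left
      refine (generic_iff S _).2 ⟨f, (hPmem f).1 hf, fun Z hZ hfZ => ?_⟩
      exact (key Z hZ).1 (h Z ((hSP Z).1 hZ) hfZ)
    · right
      refine (generic_iff S _).2 ⟨f, (hPmem f).1 hf, fun Z hZ hfZ hc => ?_⟩
      exact h Z ((hSP Z).1 hZ) hfZ ((key Z hZ).2 hc)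
  have hPSid : ∀ Z ∈ S, PerturbStable S A Z → Identifiable S A Z := by
    rintro Z hZ ⟨U, _, hZU, h⟩
    exact h Z ⟨hZU, hZ⟩
  have hcc : c → c' := fun hc Z hZ => ⟨Set.univ, isOpen_univ, trivial, fun W hW => hc W hW.2⟩
  have hcc2 : c' → c := fun hc Z hZ => hPSid Z hZ (hc Z hZ)
  have hidPS : ∀ Z ∈ S, UnramifiedAt S A Z → Identifiable S A Z → PerturbStable S A Z := by
    rintro Z hZ ⟨U, hU, hZU, h⟩ hid
    refine ⟨U, hU, hZU, fun W hW => ?_⟩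
    have h1 := h W hW
    rw [Identifiable] at hid
    rw [hid, Cardinal.mk_singleton, Cardinal.mk_set_eq_one_iff] at h1
    obtain ⟨x, hx⟩ := h1
    have h2 := hself W hW.2
    rw [hx, Set.mem_singleton_iff] at h2
    rw [hx, h2]
  have hGI : GenericallyIdentifying S A → ∃ C : Set (MSpace γ n), IsZClosed C ∧ C ∩ S ≠ S ∧
        {Z | Z ∈ S ∧ ¬ PerturbStable S A Z} ⊆ C := by
    intro hG
    obtain ⟨f, hf, h1⟩ := (generic_iff S _).1 hG
    obtain ⟨g, hg, h2⟩ := (generic_iff S _).1 hgu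
    obtain ⟨x, hx, hfx, hgx⟩ := irr_mul hSirr hf hg
    refine (generic_iff S _).2 ⟨f * g, ⟨x, hx, by simp [hfx, hgx]⟩, fun Z hZ hZne hn => ?_⟩
    rw [map_mul] at hZne
    exact hn (hidPS Z hZ (not_not.1 (h2 Z hZ (right_ne_zero_of_mul hZne)))
      (not_not.1 (h1 Z hZ (left_ne_zero_of_mul hZne))))
  have hcG : c → GenericallyIdentifying S A := by
    intro hc
    obtain ⟨x, hx⟩ := hne
    exact (generic_iff S _).2 ⟨1, ⟨x, hx, by simp⟩, fun Z hZ _ hn => hn (hc Z hZ)⟩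
  have haG : a → ¬ GenericallyIdentifying S A := by
    intro ha hG
    obtain ⟨f, hf, h1⟩ := (generic_iff S _).1 ha
    obtain ⟨g, hg, h2⟩ := (generic_iff S _).1 hG
    obtain ⟨x, hx, hfx, hgx⟩ := irr_mul hSirr hf hg
    exact h2 x hx hgx (h1 x hx hfx)
  refine ⟨?_, fun h => haG h.1 h.2.2, fun h => haG h.1 (hcG h.2), ?_, ⟨?_, ?_⟩, ⟨?_, ?_⟩,
    hcc, hcc2⟩
  · rcases hdich with h | h
    · exact Or.inl h
    · by_cases hc : c
      · exact Or.inr (Or.inr hc)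
      · refine Or.inr (Or.inl ⟨?_, h⟩)
        by_contra hemp
        refine hc fun Z hZ => ?_
        by_contra hn
        exact hemp ⟨Z, hZ, hn⟩
  · rintro ⟨⟨⟨Z, hZ, hn⟩, _⟩, hc⟩
    exact hn (hc Z hZ)
  · rintro ha Z hZ ⟨U, hU, hZU, h⟩
    obtain ⟨f, hf, h1⟩ := (generic_iff S _).1 ha
    obtain ⟨W, hWU, hWP, hfW⟩ := zariski_dense P f ((hPmem f).2 hf) Z ((hSP Z).1 hZ) U hU hZU
    have hWS := (hSP W).2 hWP
    exact h1 W hWS hfW (h W ⟨hWU, hWS⟩)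
  · intro ha'
    refine hdich.resolve_right fun hG => ?_
    obtain ⟨f, ⟨x, hx, hfx⟩, h1⟩ := (generic_iff S _).1 (hGI hG)
    exact h1 x hx hfx (ha' x hx)
  · rintro ⟨⟨Z, hZ, hn⟩, hG⟩
    exact ⟨⟨Z, hZ, fun h => hn (hPSid Z hZ h)⟩, hGI hG⟩
  · rintro ⟨⟨Z, hZ, hn⟩, hG⟩
    constructor
    · by_contra hemp
      refine hn (hcc (fun W hW => ?_) Z hZ)
      by_contra hnW
      exact hemp ⟨W, hW, hnW⟩
    · obtain ⟨f, hf, h1⟩ := (generic_iff S _).1 hG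
      exact (generic_iff S _).2 ⟨f, hf, fun Z hZ hfZ hn => h1 Z hZ hfZ fun hp => hn (hPSid Z hZ hp)⟩
end

section
/- Let n, k ≥ 1, γ ∈ {1,2}, let S ⊆ (ℂ^{n×n})^γ be an irreducible Zariski-closed set, let 𝒫_1,…,𝒫_k ⊆ (ℂ^{n×n})^γ be irreducible Zariski-closed sets, write 𝒫^{(k)} = 𝒫_1×⋯×𝒫_k, and let φ : 𝒫^{(k)}×S → 𝒫^{(k)}×ℂ^k, φ(A,Z) = (A, Tr(Z·A_1),…,Tr(Z·A_k)). Assume φ is generically unramified. Then the following two conditions on A ∈ 𝒫^{(k)} each define a Zariski-open subset of 𝒫^{(k)} (in the subspace topology): (i) there is a Euclidean-open set U ⊆ ((ℂ^{n×n})^γ)^k with A ∈ U such that every B ∈ U ∩ 𝒫^{(k)} is generically identifying; (ii) there is a Euclidean-open set U ⊆ ((ℂ^{n×n})^γ)^k with A ∈ U such that every B ∈ U ∩ 𝒫^{(k)} is completely identifying. -/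
/-- Index set of `((ℂ^{n×n})^γ)^k`. -/
abbrev TIdx (γ n k : ℕ) := Fin k × MIdx γ n

/-- The space of measurement tuples `((ℂ^{n×n})^γ)^k`. -/
abbrev TSpace (γ n k : ℕ) := Fin k → MSpace γ n

/-- Coordinates of a measurement tuple. -/
def tCoords {γ n k : ℕ} (A : TSpace γ n k) : TIdx γ n k → ℂ := fun p => A p.1 p.2

/-- A set of measurement tuples is Zariski-closed iff it is the common zero set
of a family of polynomials in the coordinates. -/
def IsZClosedT {γ n k : ℕ} (X : Set (TSpace γ n k)) : Prop :=
  ∃ T : Set (MvPolynomial (TIdx γ n k) ℂ),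
    X = {A | ∀ p ∈ T, MvPolynomial.eval (tCoords A) p = 0}

/-- Index set of `((ℂ^{n×n})^γ)^k × (ℂ^{n×n})^γ`. -/
abbrev PIdx (γ n k : ℕ) := TIdx γ n k ⊕ MIdx γ n

/-- Coordinates of a pair (measurement tuple, signal). -/
def pCoords {γ n k : ℕ} (x : TSpace γ n k × MSpace γ n) : PIdx γ n k → ℂ :=
  Sum.elim (tCoords x.1) x.2

/-- A set of (tuple, signal) pairs is Zariski-closed iff it is the common zero
set of a family of polynomials in the coordinates. -/
def IsZClosedP {γ n k : ℕ} (X : Set (TSpace γ n k × MSpace γ n)) : Prop :=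
  ∃ T : Set (MvPolynomial (PIdx γ n k) ℂ),
    X = {x | ∀ p ∈ T, MvPolynomial.eval (pCoords x) p = 0}

/-- The fiber `φ⁻¹(φ(x))` of the extended forward map
`φ : 𝒫^{(k)} × S → 𝒫^{(k)} × ℂ^k`, `(A, Z) ↦ (A, Tr(Z·A_1), …, Tr(Z·A_k))`,
where `P ⊆ TSpace γ n k` is the set of admissible tuples. -/
def bigFiber {γ n k : ℕ} (P : Set (TSpace γ n k)) (S : Set (MSpace γ n))
    (x : TSpace γ n k × MSpace γ n) : Set (TSpace γ n k × MSpace γ n) :=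
  {y | y.1 ∈ P ∧ y.2 ∈ S ∧ y.1 = x.1 ∧
    ∀ i : Fin k, trPair y.2 (y.1 i) = trPair x.2 (x.1 i)}

/-- The extended forward map `φ` is unramified over `x ∈ 𝒫^{(k)} × S`: on some
Euclidean-open neighbourhood `U` of `x` in the ambient affine space, all fibers
over `U ∩ (𝒫^{(k)} × S)` have the same cardinality as the fiber of `x`. -/
def UnramifiedAtP {γ n k : ℕ} (P : Set (TSpace γ n k)) (S : Set (MSpace γ n))
    (x : TSpace γ n k × MSpace γ n) : Prop :=
  ∃ U : Set (TSpace γ n k × MSpace γ n), IsOpen U ∧ x ∈ U ∧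
    ∀ y ∈ U ∩ (P ×ˢ S), Cardinal.mk ↥(bigFiber P S y) = Cardinal.mk ↥(bigFiber P S x)

/-- The extended forward map `φ` is generically unramified: the points of
`𝒫^{(k)} × S` over which it is not unramified are contained in a Zariski-closed
set meeting `𝒫^{(k)} × S` in a proper subset. -/
def GenUnramifiedP {γ n k : ℕ} (P : Set (TSpace γ n k)) (S : Set (MSpace γ n)) :
    Prop :=
  ∃ C : Set (TSpace γ n k × MSpace γ n), IsZClosedP C ∧ C ∩ (P ×ˢ S) ≠ P ×ˢ S ∧
    {x | x ∈ P ×ˢ S ∧ ¬ UnramifiedAtP P S x} ⊆ C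

namespace ZD
open MvPolynomial Filter Topology

lemma root_small (p : Polynomial ℂ) (hp : p.Monic) (hd : p.natDegree ≠ 0) :
    ∃ t, p.IsRoot t ∧ ‖t‖ ^ p.natDegree ≤ ‖p.coeff 0‖ := by
  have hs : p.Splits := IsAlgClosed.splits p
  have hne : p.roots.toFinset.Nonempty := by
    obtain ⟨t, ht⟩ := IsAlgClosed.exists_root p (fun h => hd (Polynomial.natDegree_eq_of_degree_eq_some h))
    exact ⟨t, by simpa [hp.ne_zero] using ht⟩
  obtain ⟨t, ht, hmin⟩ := p.roots.toFinset.exists_min_image (fun z => ‖z‖₊) hne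
  refine ⟨t, by simpa [hp.ne_zero] using ht, ?_⟩
  have h1 := hs.coeff_zero_eq_prod_roots_of_monic hp
  have h2 : ‖p.coeff 0‖₊ = (p.roots.map (fun z => ‖z‖₊)).prod := by
    rw [h1]
    simp only [nnnorm_mul, nnnorm_pow, nnnorm_neg, nnnorm_one, one_pow, one_mul]
    exact map_multiset_prod (nnnormHom : ℂ →*₀ NNReal) _
  have h3 : ‖t‖₊ ^ p.natDegree ≤ ‖p.coeff 0‖₊ := by
    rw [h2, hs.natDegree_eq_card_roots]
    have := Multiset.pow_card_le_prod (s := p.roots.map (fun z => ‖z‖₊)) (a := ‖t‖₊) (by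
      intro x hx
      obtain ⟨z, hz, rfl⟩ := Multiset.mem_map.1 hx
      exact hmin z (by simpa using hz))
    simpa using this
  exact_mod_cast h3

lemma root_bound (p : Polynomial ℂ) (hp : p.Monic) (t : ℂ) (ht : p.IsRoot t) :
    ‖t‖ ≤ ∑ i ∈ Finset.range p.natDegree, ‖p.coeff i‖ + 1 := by
  have h := (ht.norm_lt_cauchyBound hp.ne_zero).le
  have h2 : p.cauchyBound ≤ ∑ i ∈ Finset.range p.natDegree, ‖p.coeff i‖₊ + 1 := by
    unfold Polynomial.cauchyBound
    rw [hp.leadingCoeff]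
    simp only [nnnorm_one, div_one]
    gcongr
    apply Finset.sup_le
    intro i hi
    exact Finset.single_le_sum (f := fun i => ‖p.coeff i‖₊) (fun _ _ => zero_le) hi
  have h3 := NNReal.coe_le_coe.2 (h.trans h2)
  simpa using h3

lemma dense_ne {s : ℕ} (G : MvPolynomial (Fin s) ℂ) (hG : G ≠ 0) (y : Fin s → ℂ) :
    y ∈ closure {z | eval z G ≠ 0} := by
  rw [Metric.mem_closure_iff]
  intro ε hε
  by_contra! hcon
  apply hG
  apply MvPolynomial.funext_set (fun i => Metric.ball (y i) ε)
  · intro i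
    exact infinite_of_mem_nhds (y i) (Metric.ball_mem_nhds _ hε)
  · intro x hx
    by_contra h
    have h1 := hcon x (by simpa using h)
    have h2 : dist x y < ε := (dist_pi_lt_iff hε).2 (fun i => hx i trivial)
    rw [dist_comm] at h2
    linarith

section
variable {s : ℕ} {B : Type} [CommRing B] [IsDomain B] [Algebra ℂ B]
  [Algebra (MvPolynomial (Fin s) ℂ) B] [IsScalarTower ℂ (MvPolynomial (Fin s) ℂ) B]
  [Algebra.IsIntegral (MvPolynomial (Fin s) ℂ) B]
  [Module.IsTorsionFree (MvPolynomial (Fin s) ℂ) B]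

lemma nst {B : Type} [CommRing B] [Algebra ℂ B] [Algebra.FiniteType ℂ B] (Q : Ideal B) (hQ : Q ≠ ⊤) :
    ∃ χ : B →ₐ[ℂ] ℂ, ∀ b ∈ Q, χ b = 0 := by
  obtain ⟨M, hM, hQM⟩ := Q.exists_le_maximal hQ
  let _ : Field (B ⧸ M) := Ideal.Quotient.field M
  have : Module.Finite ℂ (B ⧸ M) := finite_of_finite_type_of_isJacobsonRing ℂ (B ⧸ M)
  refine ⟨(IsAlgClosed.lift : (B ⧸ M) →ₐ[ℂ] ℂ).comp (Ideal.Quotient.mkₐ ℂ M), fun b hb => ?_⟩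
  have : Ideal.Quotient.mkₐ ℂ M b = 0 := by
    simpa using Ideal.Quotient.eq_zero_iff_mem.2 (hQM hb)
  rw [AlgHom.comp_apply, this, map_zero]

lemma lift_pt [Algebra.FiniteType ℂ B] (y : Fin s → ℂ) (h : B) (t : ℂ)
    (ht : ((minpoly (MvPolynomial (Fin s) ℂ) h).map (eval y)).IsRoot t) :
    ∃ χ : B →ₐ[ℂ] ℂ, (∀ a, χ (algebraMap (MvPolynomial (Fin s) ℂ) B a) = eval y a) ∧ χ h = t := by
  have hhInt : IsIntegral (MvPolynomial (Fin s) ℂ) h := Algebra.IsIntegral.isIntegral h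
  let Φ : Polynomial (MvPolynomial (Fin s) ℂ) →ₐ[MvPolynomial (Fin s) ℂ] B := Polynomial.aeval h
  let _ : Algebra (Polynomial (MvPolynomial (Fin s) ℂ)) B := Φ.toRingHom.toAlgebra
  have hΦ : ∀ p, algebraMap (Polynomial (MvPolynomial (Fin s) ℂ)) B p = Polynomial.aeval h p :=
    fun p => rfl
  have : IsScalarTower (MvPolynomial (Fin s) ℂ) (Polynomial (MvPolynomial (Fin s) ℂ)) B :=
    IsScalarTower.of_algebraMap_eq (fun a => by rw [hΦ]; simp)
  have : Algebra.IsIntegral (Polynomial (MvPolynomial (Fin s) ℂ)) B :=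
    Algebra.IsIntegral.tower_top (MvPolynomial (Fin s) ℂ)
  let P : Ideal (Polynomial (MvPolynomial (Fin s) ℂ)) :=
    RingHom.ker (Polynomial.eval₂RingHom (eval y) t)
  have hP : P.IsPrime := RingHom.ker_isPrime _
  have hker : RingHom.ker (algebraMap (Polynomial (MvPolynomial (Fin s) ℂ)) B) ≤ P := by
    intro p hp
    rw [RingHom.mem_ker, hΦ] at hp
    obtain ⟨q, rfl⟩ := minpoly.isIntegrallyClosed_dvd hhInt hp
    apply Ideal.mul_mem_right
    rw [RingHom.mem_ker]
    simpa [Polynomial.IsRoot, Polynomial.eval_map] using ht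
  obtain ⟨Q, hQ, hQP⟩ := Ideal.exists_ideal_over_prime_of_isIntegral_of_isDomain P hker
  obtain ⟨χ, hχ⟩ := nst Q hQ.ne_top
  have key : ∀ p ∈ P, χ (Polynomial.aeval h p) = 0 := by
    intro p hp
    rw [← hQP] at hp
    exact hχ _ hp
  refine ⟨χ, fun a => ?_, ?_⟩
  · have := key (Polynomial.C (a - C (eval y a))) (by simp [P, RingHom.mem_ker])
    rw [Polynomial.aeval_C, map_sub, map_sub, sub_eq_zero] at this
    rw [this]
    have h2 : algebraMap (MvPolynomial (Fin s) ℂ) B (C (eval y a)) = algebraMap ℂ B (eval y a) := by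
      rw [IsScalarTower.algebraMap_apply ℂ (MvPolynomial (Fin s) ℂ) B]; rfl
    rw [h2, AlgHom.commutes]; rfl
  · have := key (Polynomial.X - Polynomial.C (C t)) (by simp [P, RingHom.mem_ker])
    rw [map_sub, Polynomial.aeval_C, Polynomial.aeval_X, map_sub, sub_eq_zero] at this
    rw [this]
    have h2 : algebraMap (MvPolynomial (Fin s) ℂ) B (C t) = algebraMap ℂ B t := by
      rw [IsScalarTower.algebraMap_apply ℂ (MvPolynomial (Fin s) ℂ) B]; rfl
    rw [h2, AlgHom.commutes]; rfl

lemma chi_root {s : ℕ} {B : Type} [CommRing B] [Algebra ℂ B]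
    [Algebra (MvPolynomial (Fin s) ℂ) B] (χ : B →ₐ[ℂ] ℂ) (y : Fin s → ℂ)
    (hy : ∀ a, χ (algebraMap (MvPolynomial (Fin s) ℂ) B a) = eval y a) (b : B) :
    ((minpoly (MvPolynomial (Fin s) ℂ) b).map (eval y)).IsRoot (χ b) := by
  have h := minpoly.aeval (MvPolynomial (Fin s) ℂ) b
  have h2 := congrArg χ h
  rw [map_zero, Polynomial.aeval_def] at h2
  have h3 := Polynomial.hom_eval₂ (minpoly (MvPolynomial (Fin s) ℂ) b)
    (algebraMap (MvPolynomial (Fin s) ℂ) B) (χ : B →+* ℂ) b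
  rw [Polynomial.IsRoot, Polynomial.eval_map]
  have h4 : (χ : B →+* ℂ).comp (algebraMap (MvPolynomial (Fin s) ℂ) B) = eval y :=
    RingHom.ext hy
  rw [h4] at h3
  exact h3.symm.trans h2

lemma dens0 {σ : Type} [Finite σ] (s : ℕ) {B : Type} [CommRing B] [IsDomain B] [Algebra ℂ B]
    [Algebra (MvPolynomial (Fin s) ℂ) B] [IsScalarTower ℂ (MvPolynomial (Fin s) ℂ) B]
    [Algebra.IsIntegral (MvPolynomial (Fin s) ℂ) B]
    [Module.IsTorsionFree (MvPolynomial (Fin s) ℂ) B] [Algebra.FiniteType ℂ B] (π : MvPolynomial σ ℂ →ₐ[ℂ] B) (hπ : Function.Surjective π)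
    (χ : B →ₐ[ℂ] ℂ) (f : B) (hf : f ≠ 0) :
    (fun i => χ (π (X i))) ∈ closure {z : σ → ℂ | ∃ χ' : B →ₐ[ℂ] ℂ, χ' f ≠ 0 ∧
      z = fun i => χ' (π (X i))} := by
  classical
  have := Fintype.ofFinite σ
  have hco : ∀ (χ : B →ₐ[ℂ] ℂ) p, χ (π p) = eval (fun i => χ (π (X i))) p := by
    intro χ p
    have : χ.comp π = aeval (fun i => χ (π (X i))) := by
      ext i; simp
    exact (AlgHom.congr_fun this p).trans (by simp [aeval_eq_eval])
  have hinj : ∀ χ₁ χ₂ : B →ₐ[ℂ] ℂ, (∀ i, χ₁ (π (X i)) = χ₂ (π (X i))) → χ₁ = χ₂ := by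
    intro χ₁ χ₂ h
    ext b
    obtain ⟨p, rfl⟩ := hπ b
    rw [hco χ₁, hco χ₂]
    simp only [h]
  have hintg : ∀ b : B, IsIntegral (MvPolynomial (Fin s) ℂ) b := Algebra.IsIntegral.isIntegral
  have hmon : ∀ b : B, (minpoly (MvPolynomial (Fin s) ℂ) b).Monic := fun b => minpoly.monic (hintg b)
  let y : Fin s → ℂ := fun i => χ (algebraMap (MvPolynomial (Fin s) ℂ) B (X i))
  have hχX : ∀ (χ : B →ₐ[ℂ] ℂ) (y : Fin s → ℂ),
      (∀ i, χ (algebraMap (MvPolynomial (Fin s) ℂ) B (X i)) = y i) →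
      ∀ a, χ (algebraMap (MvPolynomial (Fin s) ℂ) B a) = eval y a := by
    intro χ y h a
    have : χ.comp (IsScalarTower.toAlgHom ℂ (MvPolynomial (Fin s) ℂ) B) = aeval y := by
      ext i; simpa using h i
    exact (AlgHom.congr_fun this a).trans (by simp [aeval_eq_eval])
  have hy := hχX χ y (fun i => rfl)
  -- the fibre is finite
  let F : Set (B →ₐ[ℂ] ℂ) := {χ' | ∀ a, χ' (algebraMap (MvPolynomial (Fin s) ℂ) B a) = eval y a}
  have hF : F.Finite := by
    let R : Set (σ → ℂ) := Set.univ.pi fun i =>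
      {t | ((minpoly (MvPolynomial (Fin s) ℂ) (π (X i))).map (eval y)).IsRoot t}
    have hR : R.Finite := Set.Finite.pi' (fun i =>
      Polynomial.finite_setOf_isRoot ((hmon _).map _).ne_zero) |>.subset (by
        intro z hz i; exact hz i trivial)
    refine Set.Finite.of_finite_image (f := fun χ' : B →ₐ[ℂ] ℂ => fun i => χ' (π (X i)))
      (hR.subset ?_) ?_
    · rintro _ ⟨χ', hχ', rfl⟩ i -
      exact chi_root χ' y hχ' _
    · intro χ₁ _ χ₂ _ h
      exact hinj _ _ (fun i => congrFun h i)
  -- separating element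
  obtain ⟨h, hh0, hh⟩ : ∃ h : B, χ h = 0 ∧ ∀ χ' ∈ F, χ' h = 0 → χ' = χ := by
    by_contra! hcon
    have hsub : ((RingHom.ker χ : Ideal B) : Set B) ⊆
        ⋃ i ∈ (↑(hF.toFinset.erase χ) : Set (B →ₐ[ℂ] ℂ)), ((RingHom.ker i : Ideal B) : Set B) := by
      intro b hb
      obtain ⟨χ', h1, h2, h3⟩ := hcon b hb
      simp only [Set.mem_iUnion]
      exact ⟨χ', by simp [h1, h3], h2⟩
    rw [Ideal.subset_union_prime χ χ (fun i _ _ _ => RingHom.ker_isPrime _)] at hsub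
    obtain ⟨χ', h1, h2⟩ := hsub
    apply (Finset.mem_erase.1 h1).1
    ext b
    have : b - algebraMap ℂ B (χ b) ∈ RingHom.ker χ := by
      simp [RingHom.mem_ker]
    have := h2 this
    rw [RingHom.mem_ker, map_sub, AlgHom.commutes, sub_eq_zero] at this
    exact this
  -- hypersurface
  obtain ⟨G, hG0, b, hGb⟩ : ∃ G : MvPolynomial (Fin s) ℂ, G ≠ 0 ∧ ∃ b,
      algebraMap (MvPolynomial (Fin s) ℂ) B G = f * b := by
    have := Ideal.comap_ne_bot_of_integral_mem (R := MvPolynomial (Fin s) ℂ) hf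
      (Ideal.mem_span_singleton_self f) (hintg f)
    obtain ⟨G, hG, hG0⟩ := (Submodule.ne_bot_iff _).1 this
    exact ⟨G, hG0, Ideal.mem_span_singleton.1 hG⟩
  obtain ⟨yn, hyn, hlim⟩ := mem_closure_iff_seq_limit.1 (dense_ne G hG0 y)
  have hlime : ∀ a : MvPolynomial (Fin s) ℂ, Tendsto (fun n => eval (yn n) a) atTop (𝓝 (eval y a)) :=
    fun a => ((MvPolynomial.continuous_eval a).tendsto y).comp hlim
  have hdeg : (minpoly (MvPolynomial (Fin s) ℂ) h).natDegree ≠ 0 :=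
    (minpoly.natDegree_pos (hintg h)).ne'
  choose tn htn htn' using fun n => root_small
    ((minpoly (MvPolynomial (Fin s) ℂ) h).map (eval (yn n))) ((hmon h).map _)
    (by rw [(hmon h).natDegree_map]; exact hdeg)
  have htlim : Tendsto tn atTop (𝓝 0) := by
    have h0 : eval y ((minpoly (MvPolynomial (Fin s) ℂ) h).coeff 0) = 0 := by
      have := chi_root χ y hy h
      rw [hh0, Polynomial.IsRoot, ← Polynomial.coeff_zero_eq_eval_zero, Polynomial.coeff_map] at this
      exact this
    have h1 := (hlime ((minpoly (MvPolynomial (Fin s) ℂ) h).coeff 0)).norm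
    rw [h0, norm_zero] at h1
    rw [Metric.tendsto_atTop]
    intro ε hε
    obtain ⟨N, hN⟩ := eventually_atTop.1 (h1.eventually (gt_mem_nhds (pow_pos hε
      (minpoly (MvPolynomial (Fin s) ℂ) h).natDegree)))
    refine ⟨N, fun n hn => ?_⟩
    have h2 := htn' n
    rw [(hmon h).natDegree_map, Polynomial.coeff_map] at h2
    rw [dist_zero_right]
    exact lt_of_pow_lt_pow_left₀ _ hε.le (h2.trans_lt (hN n hn))
  choose χn hχn hχnh using fun n => lift_pt (yn n) h (tn n) (htn n)
  have hbd : ∀ i, ∃ M : ℝ, ∀ n, ‖χn n (π (X i))‖ ≤ M := by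
    intro i
    let m := minpoly (MvPolynomial (Fin s) ℂ) (π (X i))
    have hc : Tendsto (fun n => ∑ j ∈ Finset.range m.natDegree, ‖eval (yn n) (m.coeff j)‖ + 1) atTop
        (𝓝 (∑ j ∈ Finset.range m.natDegree, ‖eval y (m.coeff j)‖ + 1)) :=
      (tendsto_finset_sum _ (fun j _ => (hlime _).norm)).add tendsto_const_nhds
    obtain ⟨M, hM⟩ := hc.bddAbove_range
    refine ⟨M, fun n => ?_⟩
    have := root_bound _ ((hmon (π (X i))).map (eval (yn n))) _ (chi_root (χn n) (yn n) (hχn n) _)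
    rw [(hmon (π (X i))).natDegree_map] at this
    simp only [Polynomial.coeff_map] at this
    exact this.trans (hM ⟨n, rfl⟩)
  choose M hM using hbd
  obtain ⟨x', -, ψ, hψ, hx'⟩ := (isCompact_univ_pi (fun i => isCompact_closedBall (0 : ℂ) (M i))).tendsto_subseq
    (x := fun n i => χn n (π (X i))) (fun n i _ => by simpa using hM i n)
  have hlimp : ∀ p : MvPolynomial σ ℂ, Tendsto (fun n => χn (ψ n) (π p)) atTop (𝓝 (eval x' p)) := by
    intro p
    have := ((MvPolynomial.continuous_eval p).tendsto x').comp hx'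
    refine this.congr (fun n => ?_)
    rw [hco]; rfl
  have hker : ∀ p, π p = 0 → eval x' p = 0 := by
    intro p hp
    refine tendsto_nhds_unique (hlimp p) ?_
    simp only [hp, map_zero]
    exact tendsto_const_nhds
  let χ' : B →ₐ[ℂ] ℂ := (Ideal.Quotient.liftₐ (RingHom.ker π) (aeval x') (by
      intro a ha; simpa [aeval_eq_eval] using hker a ha)).comp
      (Ideal.quotientKerAlgEquivOfSurjective hπ).symm.toAlgHom
  have hχ' : ∀ p, χ' (π p) = eval x' p := by
    intro p
    have : (Ideal.quotientKerAlgEquivOfSurjective hπ).symm (π p) = Ideal.Quotient.mk _ p := by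
      rw [AlgEquiv.symm_apply_eq]; rfl
    simp only [χ', AlgHom.comp_apply]
    erw [this]
    simp [aeval_eq_eval]
  have hlimb : ∀ b : B, Tendsto (fun n => χn (ψ n) b) atTop (𝓝 (χ' b)) := by
    intro b
    obtain ⟨p, rfl⟩ := hπ b
    rw [hχ']; exact hlimp p
  have hχ'F : χ' ∈ F := by
    intro a
    refine tendsto_nhds_unique (hlimb _) ?_
    simp only [hχn]
    exact (hlime a).comp hψ.tendsto_atTop
  have hχ'h : χ' h = 0 := by
    refine tendsto_nhds_unique (hlimb _) ?_
    simp only [hχnh]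
    exact htlim.comp hψ.tendsto_atTop
  have heq := hh χ' hχ'F hχ'h
  refine mem_closure_of_tendsto (b := atTop) (f := fun n i => χn (ψ n) (π (X i))) ?_
    (Eventually.of_forall fun n => ⟨χn (ψ n), ?_, rfl⟩)
  · rw [tendsto_pi_nhds]
    intro i
    rw [← heq]
    exact hlimb _
  · intro h0
    apply hyn (ψ n)
    rw [← hχn, hGb, map_mul, h0, zero_mul]

end

lemma dens1 {σ : Type} [Finite σ] {B : Type} [CommRing B] [IsDomain B] [Algebra ℂ B]
    [Algebra.FiniteType ℂ B] (π : MvPolynomial σ ℂ →ₐ[ℂ] B) (hπ : Function.Surjective π)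
    (χ : B →ₐ[ℂ] ℂ) (f : B) (hf : f ≠ 0) :
    (fun i => χ (π (X i))) ∈ closure {z : σ → ℂ | ∃ χ' : B →ₐ[ℂ] ℂ, χ' f ≠ 0 ∧
      z = fun i => χ' (π (X i))} := by
  obtain ⟨s, g, hg, hgi⟩ := exists_integral_inj_algHom_of_fg ℂ B
  let _ : Algebra (MvPolynomial (Fin s) ℂ) B := g.toRingHom.toAlgebra
  have : IsScalarTower ℂ (MvPolynomial (Fin s) ℂ) B :=
    IsScalarTower.of_algebraMap_eq (fun a => (g.commutes a).symm)
  have : Algebra.IsIntegral (MvPolynomial (Fin s) ℂ) B := ⟨hgi⟩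
  have : FaithfulSMul (MvPolynomial (Fin s) ℂ) B :=
    (faithfulSMul_iff_algebraMap_injective _ _).2 hg
  have : Module.IsTorsionFree (MvPolynomial (Fin s) ℂ) B := inferInstance
  exact dens0 s π hπ χ f hf

lemma dens {σ : Type} [Finite σ] (I : Ideal (MvPolynomial σ ℂ)) [hI : I.IsPrime]
    (f : MvPolynomial σ ℂ) (hf : f ∉ I) (x : σ → ℂ) (hx : ∀ p ∈ I, eval x p = 0) :
    x ∈ closure {z | (∀ p ∈ I, eval z p = 0) ∧ eval z f ≠ 0} := by
  let χ : (MvPolynomial σ ℂ ⧸ I) →ₐ[ℂ] ℂ := Ideal.Quotient.liftₐ I (aeval x) (by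
    intro a ha; simpa [aeval_eq_eval] using hx a ha)
  have h := dens1 (Ideal.Quotient.mkₐ ℂ I) (Ideal.Quotient.mkₐ_surjective ℂ I) χ
    (Ideal.Quotient.mk I f) (by rwa [Ne, Ideal.Quotient.eq_zero_iff_mem])
  have hx' : (fun i => χ (Ideal.Quotient.mkₐ ℂ I (X i))) = x := by
    ext i; simp [χ]
  rw [hx'] at h
  refine closure_mono ?_ h
  rintro z ⟨χ', h1, rfl⟩
  have hco : ∀ p, χ' (Ideal.Quotient.mkₐ ℂ I p) = eval (fun i => χ' (Ideal.Quotient.mkₐ ℂ I (X i))) p := by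
    intro p
    have : χ'.comp (Ideal.Quotient.mkₐ ℂ I) = aeval (fun i => χ' (Ideal.Quotient.mkₐ ℂ I (X i))) := by
      ext i; simp
    exact (AlgHom.congr_fun this p).trans (by simp [aeval_eq_eval])
  refine ⟨fun p hp => ?_, ?_⟩
  · rw [← hco]
    have : Ideal.Quotient.mkₐ ℂ I p = 0 := Ideal.Quotient.eq_zero_iff_mem.2 hp
    rw [this, map_zero]
  · rw [← hco]; exact h1


noncomputable def pt {σ : Type} (x : σ → ℂ) : PrimeSpectrum (MvPolynomial σ ℂ) :=
  ⟨RingHom.ker (eval x), RingHom.ker_isPrime _⟩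

/-- Constructible subsets of affine space. -/
def Cons {σ : Type} (X : Set (σ → ℂ)) : Prop :=
  ∃ K : Set (PrimeSpectrum (MvPolynomial σ ℂ)), IsConstructible K ∧ X = pt ⁻¹' K

section cons
variable {σ τ : Type}

lemma Cons.union {X Y : Set (σ → ℂ)} : Cons X → Cons Y → Cons (X ∪ Y) := by
  rintro ⟨K, hK, rfl⟩ ⟨L, hL, rfl⟩
  exact ⟨K ∪ L, hK.union hL, rfl⟩

lemma Cons.inter {X Y : Set (σ → ℂ)} : Cons X → Cons Y → Cons (X ∩ Y) := by
  rintro ⟨K, hK, rfl⟩ ⟨L, hL, rfl⟩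
  exact ⟨K ∩ L, hK.inter hL, rfl⟩

lemma Cons.diff {X Y : Set (σ → ℂ)} : Cons X → Cons Y → Cons (X \ Y) := by
  rintro ⟨K, hK, rfl⟩ ⟨L, hL, rfl⟩
  exact ⟨K \ L, hK.sdiff hL, rfl⟩

lemma Cons.empty : Cons (∅ : Set (σ → ℂ)) := ⟨∅, .empty, rfl⟩

lemma Cons.biUnion {ι : Type} (D : Finset ι) (X : ι → Set (σ → ℂ)) (h : ∀ d ∈ D, Cons (X d)) :
    Cons {x | ∃ d ∈ D, x ∈ X d} := by
  classical
  induction D using Finset.induction_on with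
  | empty => simpa using Cons.empty
  | insert a s ha ih =>
    have := (h a (by simp)).union (ih (fun d hd => h d (by simp [hd])))
    convert this using 1
    ext x; simp

lemma cons_of_closed [Finite σ] {X : Set (σ → ℂ)} (h : IsZClosed X) : Cons X := by
  obtain ⟨T, rfl⟩ := h
  refine ⟨PrimeSpectrum.zeroLocus T, ?_, ?_⟩
  · rw [← isConstructible_compl]
    exact IsCompact.isConstructible (TopologicalSpace.NoetherianSpace.isCompact _)
      (PrimeSpectrum.isClosed_zeroLocus T).isOpen_compl
  · ext x
    simp only [Set.mem_setOf_eq, Set.mem_preimage, PrimeSpectrum.mem_zeroLocus, pt]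
    rfl

lemma Cons.data {X : Set (σ → ℂ)} (h : Cons X) :
    ∃ D : Finset (PrimeSpectrum.BasicConstructibleSetData (MvPolynomial σ ℂ)),
      X = {x | ∃ d ∈ D, (∀ i, eval x (d.g i) = 0) ∧ eval x d.f ≠ 0} := by
  obtain ⟨K, hK, rfl⟩ := h
  obtain ⟨D, rfl⟩ := PrimeSpectrum.exists_constructibleSetData_iff.2 hK
  refine ⟨D, ?_⟩
  ext x
  simp only [PrimeSpectrum.ConstructibleSetData.toSet, Set.mem_preimage, Set.mem_iUnion,
    PrimeSpectrum.BasicConstructibleSetData.toSet, Set.mem_diff, PrimeSpectrum.mem_zeroLocus,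
    Set.singleton_subset_iff, Set.range_subset_iff, Set.mem_setOf_eq, exists_prop, pt,
    SetLike.mem_coe, RingHom.mem_ker]

lemma Cons.proj [Finite σ] [Finite τ] {X : Set (σ ⊕ τ → ℂ)} (h : Cons X) :
    Cons {x : σ → ℂ | ∃ y, Sum.elim x y ∈ X} := by
  obtain ⟨K, hK, rfl⟩ := h
  let f : MvPolynomial σ ℂ →+* MvPolynomial (σ ⊕ τ) ℂ := (rename Sum.inl).toRingHom
  have hf : f.FinitePresentation := by
    rw [← RingHom.FinitePresentation.of_finiteType]
    apply RingHom.FiniteType.of_comp_finiteType (f := (C : ℂ →+* MvPolynomial σ ℂ))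
    have : f.comp C = algebraMap ℂ (MvPolynomial (σ ⊕ τ) ℂ) := by
      ext a; simp [f]
    rw [this, RingHom.finiteType_algebraMap]
    infer_instance
  refine ⟨PrimeSpectrum.comap f '' K, PrimeSpectrum.isConstructible_comap_image hf hK, ?_⟩
  obtain ⟨D, rfl⟩ := PrimeSpectrum.exists_constructibleSetData_iff.2 hK
  ext x
  constructor
  · rintro ⟨y, hy⟩
    refine ⟨_, hy, ?_⟩
    apply PrimeSpectrum.ext
    ext p
    simp only [PrimeSpectrum.comap_asIdeal, Ideal.mem_comap, pt, RingHom.mem_ker, f]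
    change eval _ (rename Sum.inl p) = 0 ↔ _
    rw [eval_rename]
    simp
  · rintro ⟨q, hq, hqx⟩
    simp only [PrimeSpectrum.ConstructibleSetData.toSet, Set.mem_iUnion] at hq
    obtain ⟨d, hd, hq⟩ := hq
    have hfq : d.f ∉ q.asIdeal := by
      have := hq.2
      simpa [PrimeSpectrum.mem_zeroLocus] using this
    have hgq : ∀ i, d.g i ∈ q.asIdeal := by
      have := hq.1
      rw [PrimeSpectrum.mem_zeroLocus, Set.range_subset_iff] at this
      exact this
    rw [← MvPolynomial.IsPrime.vanishingIdeal_zeroLocus (K := ℂ) q.asIdeal] at hfq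
    rw [mem_vanishingIdeal_iff] at hfq
    push Not at hfq
    obtain ⟨z, hz, hzf⟩ := hfq
    have hz' : ∀ p ∈ q.asIdeal, eval z p = 0 := fun p hp => by
      simpa [aeval_eq_eval] using hz p hp
    have hzx : ∀ i, z (Sum.inl i) = x i := by
      intro i
      have h1 : (X i - C (x i) : MvPolynomial σ ℂ) ∈ (pt x).asIdeal := by
        simp [pt, RingHom.mem_ker]
      rw [← hqx] at h1
      have h2 := hz' _ h1
      simp only [f] at h2
      change eval _ (rename Sum.inl (X i - C (x i))) = 0 at h2
      rw [eval_rename] at h2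
      simpa [sub_eq_zero] using h2
    refine ⟨fun j => z (Sum.inr j), ?_⟩
    have hzz : Sum.elim x (fun j => z (Sum.inr j)) = z := by
      ext i; cases i <;> simp [hzx]
    rw [hzz]
    simp only [PrimeSpectrum.ConstructibleSetData.toSet, Set.mem_preimage, Set.mem_iUnion]
    refine ⟨d, hd, ?_, ?_⟩
    · rw [PrimeSpectrum.mem_zeroLocus, Set.range_subset_iff]
      exact fun i => hz' _ (hgq i)
    · rw [PrimeSpectrum.mem_zeroLocus, Set.singleton_subset_iff]
      intro h
      apply hzf
      simpa [aeval_eq_eval, pt, RingHom.mem_ker] using h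

/-- The Euclidean closure contains the Zariski closure. -/
def Sep (X : Set (σ → ℂ)) : Prop :=
  ∀ x, x ∈ closure X ∨ ∃ p : MvPolynomial σ ℂ, (∀ z ∈ X, eval z p = 0) ∧ eval x p ≠ 0

lemma sep_empty : Sep (∅ : Set (σ → ℂ)) := fun x => Or.inr ⟨1, by simp, by simp⟩

lemma Sep.union {X Y : Set (σ → ℂ)} (hX : Sep X) (hY : Sep Y) : Sep (X ∪ Y) := by
  intro x
  rw [closure_union]
  rcases hX x with h | ⟨p, hp, hpx⟩
  · exact Or.inl (Or.inl h)
  rcases hY x with h | ⟨q, hq, hqx⟩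
  · exact Or.inl (Or.inr h)
  refine Or.inr ⟨p * q, ?_, ?_⟩
  · rintro z (hz | hz)
    · simp [hp z hz]
    · simp [hq z hz]
  · simp [hpx, hqx]

lemma sep_biUnion {ι : Type} (D : Finset ι) (X : ι → Set (σ → ℂ)) (h : ∀ d ∈ D, Sep (X d)) :
    Sep {x | ∃ d ∈ D, x ∈ X d} := by
  classical
  induction D using Finset.induction_on with
  | empty => simpa using sep_empty
  | insert a s ha ih =>
    have := (h a (by simp)).union (ih (fun d hd => h d (by simp [hd])))
    convert this using 1
    ext x; simp

lemma Cons.sep [Finite σ] {X : Set (σ → ℂ)} (h : Cons X) : Sep X := by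
  obtain ⟨D, rfl⟩ := h.data
  refine sep_biUnion D (fun d => {x | (∀ i, eval x (d.g i) = 0) ∧ eval x d.f ≠ 0}) ?_
  intro d _
  let I := Ideal.span (Set.range d.g)
  have hfin := I.finite_minimalPrimes_of_isNoetherianRing
  have := sep_biUnion hfin.toFinset (fun q => {x : σ → ℂ | (∀ p ∈ q, eval x p = 0) ∧ eval x d.f ≠ 0}) ?_
  · convert this using 1
    ext x
    simp only [Set.mem_setOf_eq, Set.Finite.mem_toFinset]
    constructor
    · rintro ⟨h1, h2⟩
      have hI : I ≤ RingHom.ker (eval x) := by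
        rw [Ideal.span_le, Set.range_subset_iff]
        exact h1
      have : (RingHom.ker (eval x)).IsPrime := RingHom.ker_isPrime _
      obtain ⟨q, hq, hq'⟩ := Ideal.exists_minimalPrimes_le hI
      exact ⟨q, hq, fun p hp => hq' hp, h2⟩
    · rintro ⟨q, hq, h1, h2⟩
      exact ⟨fun i => h1 _ (hq.1.2 (Ideal.subset_span ⟨i, rfl⟩)), h2⟩
  · intro q hq
    have hq' : q.IsPrime := (hfin.mem_toFinset.1 hq).1.1
    intro x
    by_cases hf : d.f ∈ q
    · refine Or.inr ⟨1, ?_, by simp⟩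
      rintro z ⟨h1, h2⟩
      exact absurd (h1 _ hf) h2
    by_cases hx : ∀ p ∈ q, eval x p = 0
    · exact Or.inl (dens q d.f hf x hx)
    · push Not at hx
      obtain ⟨p, hp, hpx⟩ := hx
      exact Or.inr ⟨p, fun z hz => hz.1 p hp, hpx⟩

lemma Cons.closure [Finite σ] {X : Set (σ → ℂ)} (h : Cons X) : IsZClosed (closure X) := by
  refine ⟨{p | ∀ z ∈ X, eval z p = 0}, ?_⟩
  ext x
  constructor
  · intro hx p hp
    have hcl : IsClosed {z : σ → ℂ | eval z p = 0} :=
      isClosed_eq (MvPolynomial.continuous_eval p) continuous_const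
    exact closure_minimal hp hcl hx
  · intro hx
    rcases h.sep x with h | ⟨p, hp, hpx⟩
    · exact h
    · exact absurd (hx p hp) hpx

lemma zc_inter {X Y : Set (σ → ℂ)} : IsZClosed X → IsZClosed Y → IsZClosed (X ∩ Y) := by
  rintro ⟨T, rfl⟩ ⟨T', rfl⟩
  refine ⟨T ∪ T', ?_⟩
  ext x
  constructor
  · rintro ⟨h1, h2⟩ p (hp | hp)
    · exact h1 p hp
    · exact h2 p hp
  · intro h
    exact ⟨fun p hp => h p (Or.inl hp), fun p hp => h p (Or.inr hp)⟩

lemma zc_forall {ι : Type} {X : ι → Set (σ → ℂ)} (h : ∀ i, IsZClosed (X i)) :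
    IsZClosed {x | ∀ i, x ∈ X i} := by
  choose T hT using h
  refine ⟨⋃ i, T i, ?_⟩
  ext x
  constructor
  · intro hx p hp
    obtain ⟨i, hi⟩ := Set.mem_iUnion.1 hp
    have := hx i
    rw [hT i] at this
    exact this p hi
  · intro hx i
    rw [hT i]
    exact fun p hp => hx p (Set.mem_iUnion.2 ⟨i, hp⟩)

lemma zc_comap {X : Set (σ → ℂ)} (h : IsZClosed X) (e : σ → τ) :
    IsZClosed {u : τ → ℂ | (fun i => u (e i)) ∈ X} := by
  obtain ⟨T, rfl⟩ := h
  refine ⟨rename e '' T, ?_⟩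
  ext u
  simp only [Set.mem_setOf_eq, Set.forall_mem_image, eval_rename]
  rfl

lemma zc_polys {ι : Type} (q : ι → MvPolynomial σ ℂ) :
    IsZClosed {x | ∀ i, eval x (q i) = 0} :=
  ⟨Set.range q, by ext x; simp⟩

lemma zc_slice (S : Set (τ → ℂ)) (p : MvPolynomial (σ ⊕ τ) ℂ) :
    IsZClosed {a : σ → ℂ | ∀ z ∈ S, eval (Sum.elim a z) p = 0} := by
  have h := zc_polys (fun z : S => aeval (Sum.elim X (fun j => C (z.1 j))) p : S → MvPolynomial σ ℂ)
  convert h using 1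
  ext a
  have key : ∀ z : τ → ℂ, eval a (aeval (Sum.elim X (fun j => C (z j))) p) = eval (Sum.elim a z) p := by
    intro z
    have : (aeval a : MvPolynomial σ ℂ →ₐ[ℂ] ℂ).comp (aeval (Sum.elim X (fun j => C (z j)))) =
      aeval (Sum.elim a z) := by
      ext i; cases i <;> simp
    simpa [aeval_eq_eval] using AlgHom.congr_fun this p
  constructor
  · intro h z
    exact (key z.1).trans (h z.1 z.2)
  · intro h z hz
    exact (key z).symm.trans (h ⟨z, hz⟩)

end cons

section main
variable {γ n k : ℕ}

def uc (a : TIdx γ n k → ℂ) : TSpace γ n k := fun i m => a (i, m)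

lemma uc_tCoords (A : TSpace γ n k) : uc (tCoords A) = A := rfl
lemma tCoords_uc (a : TIdx γ n k → ℂ) : tCoords (uc a) = a := rfl

lemma continuous_uc : Continuous (uc : (TIdx γ n k → ℂ) → TSpace γ n k) :=
  continuous_pi fun _ => continuous_pi fun _ => continuous_apply _

lemma continuous_tCoords : Continuous (tCoords : TSpace γ n k → _) :=
  continuous_pi fun p => (continuous_apply p.2).comp (continuous_apply p.1)

lemma finish (Pk : Set (TSpace γ n k)) (good : TSpace γ n k → Prop)
    (Bad : Set (TIdx γ n k → ℂ)) (hBad : Cons Bad)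
    (h : ∀ A, tCoords A ∈ Bad ↔ A ∈ Pk ∧ ¬ good A) :
    ∃ U : Set (TSpace γ n k), IsZClosedT Uᶜ ∧
      {A | A ∈ Pk ∧ ∃ V : Set (TSpace γ n k), IsOpen V ∧ A ∈ V ∧
        ∀ B ∈ V ∩ Pk, good B} = U ∩ Pk := by
  refine ⟨{A | tCoords A ∉ closure Bad}, ?_, ?_⟩
  · obtain ⟨T, hT⟩ := hBad.closure
    refine ⟨T, ?_⟩
    ext A
    simp only [Set.mem_compl_iff, Set.mem_setOf_eq, not_not]
    rw [hT]; rfl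
  · ext A
    constructor
    · rintro ⟨hA, V, hV, hAV, hVg⟩
      refine ⟨?_, hA⟩
      intro hcl
      obtain ⟨b, hb, hb'⟩ := mem_closure_iff.1 hcl (uc ⁻¹' V) (hV.preimage continuous_uc) hAV
      rw [← tCoords_uc b, h] at hb'
      exact hb'.2 (hVg _ ⟨hb, hb'.1⟩)
    · rintro ⟨h1, h2⟩
      refine ⟨h2, _, (isClosed_closure (s := Bad)).isOpen_compl.preimage continuous_tCoords, h1, ?_⟩
      rintro B ⟨hB, hBP⟩
      by_contra hg
      exact hB (subset_closure ((h B).2 ⟨hBP, hg⟩))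

/-- The pairs `(A,Z)` for which `Z` is not identifiable. -/
def NN (Pfam : Fin k → Set (MSpace γ n)) (S : Set (MSpace γ n)) : Set (PIdx γ n k → ℂ) :=
  {v | ∃ w : MIdx γ n → ℂ, Sum.elim v w ∈
    ({u : PIdx γ n k ⊕ MIdx γ n → ℂ | (∀ i : Fin k, (fun m => u (Sum.inl (Sum.inl (i, m)))) ∈ Pfam i)} ∩
      ({u | (fun m => u (Sum.inl (Sum.inr m))) ∈ S} ∩
      ({u | (fun m => u (Sum.inr m)) ∈ S} ∩
      {u | ∀ i : Fin k, eval u (∑ g : Fin γ, ∑ a : Fin n, ∑ b : Fin n,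
        (X (Sum.inr (g, a, b)) - X (Sum.inl (Sum.inr (g, a, b)))) *
          X (Sum.inl (Sum.inl (i, (g, b, a)))) : MvPolynomial (PIdx γ n k ⊕ MIdx γ n) ℂ) = 0}))) \
    {u | ∀ m : MIdx γ n, eval u (X (Sum.inr m) - X (Sum.inl (Sum.inr m)) :
      MvPolynomial (PIdx γ n k ⊕ MIdx γ n) ℂ) = 0}}

lemma cons_NN (Pfam : Fin k → Set (MSpace γ n)) (S : Set (MSpace γ n)) (hS : IsZClosed S)
    (hP : ∀ i, IsZClosed (Pfam i)) : Cons (NN Pfam S) := by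
  apply Cons.proj
  refine Cons.diff (cons_of_closed ?_) (cons_of_closed (zc_polys _))
  refine zc_inter (zc_forall fun i => zc_comap (hP i) _) (zc_inter (zc_comap hS _)
    (zc_inter (zc_comap hS _) (zc_polys _)))

lemma mem_NN (Pfam : Fin k → Set (MSpace γ n)) (S : Set (MSpace γ n)) (A : TSpace γ n k)
    (Z : MSpace γ n) : Sum.elim (tCoords A) Z ∈ NN Pfam S ↔
      (∀ i, A i ∈ Pfam i) ∧ Z ∈ S ∧ ¬ Identifiable S A Z := by
  have e : (Sum.elim (tCoords A) Z ∈ NN Pfam S) ↔ ∃ W : MSpace γ n,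
      ((∀ i, A i ∈ Pfam i) ∧ Z ∈ S ∧ W ∈ S ∧ ∀ i, trPair W (A i) = trPair Z (A i)) ∧ W ≠ Z := by
    unfold NN
    simp only [Set.mem_setOf_eq, Set.mem_diff, Set.mem_inter_iff, Sum.elim_inl, Sum.elim_inr,
      map_sum, map_mul, map_sub, eval_X, tCoords, sub_mul, Finset.sum_sub_distrib, sub_eq_zero,
      trPair, ne_eq, funext_iff]
  rw [e]
  constructor
  · rintro ⟨W, ⟨h1, h2, h3, h4⟩, h5⟩
    refine ⟨h1, h2, fun hid => h5 ?_⟩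
    have : W ∈ prFiber S A Z := ⟨h3, h4⟩
    rw [hid] at this
    exact this
  · rintro ⟨h1, h2, h3⟩
    by_contra! hcon
    apply h3
    ext W
    constructor
    · rintro ⟨h4, h5⟩
      exact hcon W ⟨h1, h2, h4, h5⟩
    · rintro rfl
      exact ⟨h2, fun _ => rfl⟩

lemma slice_open {σ τ : Type} (a : σ → ℂ) (p : MvPolynomial (σ ⊕ τ) ℂ) :
    ∃ q : MvPolynomial τ ℂ, ∀ z, eval z q = eval (Sum.elim a z) p := by
  refine ⟨aeval (Sum.elim (fun i => C (a i)) X) p, fun z => ?_⟩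
  have : (aeval z : MvPolynomial τ ℂ →ₐ[ℂ] ℂ).comp (aeval (Sum.elim (fun i => C (a i)) X)) =
      aeval (Sum.elim a z) := by
    ext i; cases i <;> simp
  simpa [aeval_eq_eval] using AlgHom.congr_fun this p

lemma irr {σ : Type} {S : Set (σ → ℂ)} (hS : @IsIrreducible _ (zTop σ) S) (p : MvPolynomial σ ℂ)
    (f : (σ → ℂ) → ℂ) (hf : ∃ q : MvPolynomial σ ℂ, ∀ z, eval z q = f z)
    (h1 : ∃ z ∈ S, eval z p ≠ 0) (h2 : ∃ z ∈ S, f z ≠ 0) :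
    ∃ z ∈ S, eval z p ≠ 0 ∧ f z ≠ 0 := by
  obtain ⟨q, hq⟩ := hf
  have := hS.2 {z | eval z p ≠ 0} {z | eval z q ≠ 0}
    (TopologicalSpace.isOpen_generateFrom_of_mem ⟨p, rfl⟩)
    (TopologicalSpace.isOpen_generateFrom_of_mem ⟨q, rfl⟩) h1
    (by obtain ⟨z, hz, h⟩ := h2; exact ⟨z, hz, by rw [Set.mem_setOf_eq, hq]; exact h⟩)
  obtain ⟨z, hz, h3, h4⟩ := this
  rw [Set.mem_setOf_eq, hq] at h4
  exact ⟨z, hz, h3, h4⟩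

lemma comb {σ ι : Type} {S : Set (σ → ℂ)} (hS : @IsIrreducible _ (zTop σ) S) (D : Finset ι)
    (R : ι → (σ → ℂ) → Prop)
    (h : ∀ d ∈ D, ∃ q : MvPolynomial σ ℂ, (∃ z ∈ S, eval z q ≠ 0) ∧ ∀ z ∈ S, R d z → eval z q = 0) :
    ∃ q : MvPolynomial σ ℂ, (∃ z ∈ S, eval z q ≠ 0) ∧ ∀ d ∈ D, ∀ z ∈ S, R d z → eval z q = 0 := by
  classical
  induction D using Finset.induction_on with
  | empty =>
    obtain ⟨z, hz⟩ := hS.1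
    exact ⟨1, ⟨z, hz, by simp⟩, by simp⟩
  | insert a s ha ih =>
    obtain ⟨q, hq, hq'⟩ := ih (fun d hd => h d (by simp [hd]))
    obtain ⟨r, hr, hr'⟩ := h a (by simp)
    obtain ⟨z, hz, h1, h2⟩ := irr hS q (fun z => eval z r) ⟨r, fun _ => rfl⟩ hq hr
    refine ⟨q * r, ⟨z, hz, by simp [h1, h2]⟩, ?_⟩
    intro d hd z hz hR
    rcases Finset.mem_insert.1 hd with rfl | hd
    · simp [hr' z hz hR]
    · simp [hq' d hd z hz hR]

end main

end ZD

/-- Let `S ⊆ (ℂ^{n×n})^γ` (`γ ∈ {1,2}`) be an irreducible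
Zariski-closed signal set, `𝒫_1, …, 𝒫_k` irreducible Zariski-closed measurement
sets with product `𝒫^{(k)}`, and assume the extended forward map
`φ(A, Z) = (A, Tr(Z·A_1), …, Tr(Z·A_k))` is generically unramified. Then each
of the following conditions on `A ∈ 𝒫^{(k)}` cuts out a Zariski-open subset of
`𝒫^{(k)}`: (i) `A` is generically identifying on a Euclidean-open
neighbourhood in `𝒫^{(k)}`; (ii) `A` is completely identifying on
a Euclidean-open neighbourhood in `𝒫^{(k)}`. -/
theorem stmt_17 (n k γ : ℕ) (hn : 1 ≤ n) (hk : 1 ≤ k) (hγ : γ = 1 ∨ γ = 2)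
    (S : Set (MSpace γ n)) (hScl : IsZClosed S)
    (hSirr : @IsIrreducible _ (zTop (MIdx γ n)) S)
    (Pfam : Fin k → Set (MSpace γ n))
    (hPcl : ∀ i, IsZClosed (Pfam i))
    (hPirr : ∀ i, @IsIrreducible _ (zTop (MIdx γ n)) (Pfam i))
    (hgu : GenUnramifiedP {A : TSpace γ n k | ∀ i, A i ∈ Pfam i} S) :
    let Pk : Set (TSpace γ n k) := {A | ∀ i, A i ∈ Pfam i}
    (∃ U : Set (TSpace γ n k), IsZClosedT Uᶜ ∧
      {A | A ∈ Pk ∧ ∃ V : Set (TSpace γ n k), IsOpen V ∧ A ∈ V ∧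
        ∀ B ∈ V ∩ Pk, GenericallyIdentifying S B} = U ∩ Pk) ∧
    (∃ U : Set (TSpace γ n k), IsZClosedT Uᶜ ∧
      {A | A ∈ Pk ∧ ∃ V : Set (TSpace γ n k), IsOpen V ∧ A ∈ V ∧
        ∀ B ∈ V ∩ Pk, CompletelyIdentifying S B} = U ∩ Pk) := by
  intro Pk
  have hN := ZD.cons_NN Pfam S hScl hPcl
  have hPkc : IsZClosed {a : TIdx γ n k → ℂ | ∀ i, a ∈ {a : TIdx γ n k → ℂ | (fun m => a (i, m)) ∈ Pfam i}} :=
    ZD.zc_forall fun i => ZD.zc_comap (hPcl i) _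
  constructor
  · obtain ⟨D, hD⟩ := hN.data
    refine ZD.finish Pk _ ({a : TIdx γ n k → ℂ | ∀ i, a ∈ {a : TIdx γ n k → ℂ | (fun m => a (i, m)) ∈ Pfam i}} ∩
      {a | ∃ d ∈ D, a ∈ {a | ∀ i, a ∈ {a : TIdx γ n k → ℂ | ∀ z ∈ S, MvPolynomial.eval (Sum.elim a z) (d.g i) = 0}} \
        {a | ∀ z ∈ S, MvPolynomial.eval (Sum.elim a z) d.f = 0}}) ?_ ?_
    · refine (ZD.cons_of_closed hPkc).inter (ZD.Cons.biUnion D _ fun d _ => ?_)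
      exact (ZD.cons_of_closed (ZD.zc_forall fun i => ZD.zc_slice S _)).diff
        (ZD.cons_of_closed (ZD.zc_slice S _))
    · intro A
      have hmem : ∀ Z, A ∈ Pk → ((Z ∈ S ∧ ¬ Identifiable S A Z) ↔
          ∃ d ∈ D, (∀ i, MvPolynomial.eval (Sum.elim (tCoords A) Z) (d.g i) = 0) ∧
            MvPolynomial.eval (Sum.elim (tCoords A) Z) d.f ≠ 0) := by
        intro Z hA
        have h1 := ZD.mem_NN Pfam S A Z
        rw [hD] at h1
        constructor
        · intro h; exact h1.2 ⟨hA, h⟩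
        · intro h; exact (h1.1 h).2
      have hP : tCoords A ∈ {a : TIdx γ n k → ℂ | ∀ i, a ∈ {a : TIdx γ n k → ℂ | (fun m => a (i, m)) ∈ Pfam i}} ↔
        A ∈ Pk := Iff.rfl
      rw [Set.mem_inter_iff, hP]
      refine and_congr_right fun hA => ?_
      constructor
      · rintro ⟨d, hd, hg, hf⟩
        rintro ⟨C, ⟨T, rfl⟩, hCS, hC⟩
        apply hCS
        rw [Set.inter_eq_right]
        intro Z hZ p hp
        by_contra hpZ
        simp only [Set.mem_setOf_eq, not_forall] at hf
        obtain ⟨Z', hZ', hfZ'⟩ := hf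
        obtain ⟨W, hWS, hW1, hW2⟩ := ZD.irr hSirr p (fun z => MvPolynomial.eval (Sum.elim (tCoords A) z) d.f)
          (ZD.slice_open _ _) ⟨Z, hZ, hpZ⟩ ⟨Z', hZ', hfZ'⟩
        exact hW1 (hC ((hmem W hA).2 ⟨d, hd, fun i => hg i W hWS, hW2⟩) p hp)
      · intro hng
        by_contra hcon
        apply hng
        -- for every d pick a polynomial
        have hex : ∀ d ∈ D, ∃ q : MvPolynomial (MIdx γ n) ℂ, (∃ z ∈ S, MvPolynomial.eval z q ≠ 0) ∧
            ∀ z ∈ S, ((∀ i, MvPolynomial.eval (Sum.elim (tCoords A) z) (d.g i) = 0) ∧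
            MvPolynomial.eval (Sum.elim (tCoords A) z) d.f ≠ 0) → MvPolynomial.eval z q = 0 := by
          intro d hd
          by_cases hg : ∀ i, ∀ z ∈ S, MvPolynomial.eval (Sum.elim (tCoords A) z) (d.g i) = 0
          · by_cases hf : ∀ z ∈ S, MvPolynomial.eval (Sum.elim (tCoords A) z) d.f = 0
            · obtain ⟨z, hz⟩ := hSirr.1
              exact ⟨1, ⟨z, hz, by simp⟩, fun z hz h => absurd (hf z hz) h.2⟩
            · exact absurd ⟨d, hd, hg, hf⟩ hcon
          · push Not at hg
            obtain ⟨i, z, hz, hgz⟩ := hg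
            obtain ⟨q, hq⟩ := ZD.slice_open (tCoords A) (d.g i)
            exact ⟨q, ⟨z, hz, by rw [hq]; exact hgz⟩, fun z hz h => by rw [hq]; exact h.1 i⟩
        obtain ⟨q, ⟨z, hz, hqz⟩, hq⟩ := ZD.comb hSirr D _ hex
        refine ⟨{z | MvPolynomial.eval z q = 0}, ⟨{q}, by simp⟩, ?_, ?_⟩
        · intro h
          rw [Set.inter_eq_right] at h
          exact hqz (h hz)
        · rintro Z hZ
          obtain ⟨d, hd, h⟩ := (hmem Z hA).1 hZ
          exact hq d hd Z hZ.1 h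
  · refine ZD.finish Pk _ {a | ∃ z : MIdx γ n → ℂ, Sum.elim a z ∈ ZD.NN Pfam S} hN.proj ?_
    intro A
    simp only [Set.mem_setOf_eq, ZD.mem_NN, CompletelyIdentifying]
    constructor
    · rintro ⟨Z, h1, h2, h3⟩
      exact ⟨h1, fun h => h3 (h Z h2)⟩
    · rintro ⟨h1, h2⟩
      push Not at h2
      obtain ⟨Z, h3, h4⟩ := h2
      exact ⟨Z, h1, h3, h4⟩
end

section
/- Let n, k ≥ 1, γ ∈ {1,2}, let S ⊆ (ℂ^{n×n})^γ be an irreducible Zariski-closed set, let 𝒫_1,…,𝒫_k ⊆ (ℂ^{n×n})^γ be irreducible Zariski-closed sets with 𝒫^{(k)} = 𝒫_1×⋯×𝒫_k, and let φ : 𝒫^{(k)}×S → 𝒫^{(k)}×ℂ^k, φ(A,Z) = (A, Tr(Z·A_1),…,Tr(Z·A_k)). Assume φ is generically unramified. Then exactly one of the following holds: (a) the set of A ∈ 𝒫^{(k)} that are NOT non-identifying is contained in a Zariski-closed set meeting 𝒫^{(k)} in a proper subset (a generic measurement regime is non-identifying); (b) the set of A ∈ 𝒫^{(k)} that are NOT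 incompletely identifying is contained in a Zariski-closed set meeting 𝒫^{(k)} in a proper subset (a generic measurement regime is incompletely identifying); (c) the set of A ∈ 𝒫^{(k)} that are NOT completely identifying is contained in a Zariski-closed set meeting 𝒫^{(k)} in a proper subset (a generic measurement regime is completely identifying). -/
/-- The tuple `A` is non-identifying: no signal `Z ∈ S` is perturbation-stably
identifiable from `φ_A(Z)`. -/
def NonIdentifying {γ n k : ℕ} (S : Set (MSpace γ n)) (A : Fin k → MSpace γ n) :
    Prop :=
  ∀ Z ∈ S, ¬ PerturbStable S A Z

/-- The tuple `A` is incompletely identifying: generically, but not completely,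
identifying. -/
def IncompletelyIdentifying {γ n k : ℕ} (S : Set (MSpace γ n))
    (A : Fin k → MSpace γ n) : Prop :=
  GenericallyIdentifying S A ∧ ¬ CompletelyIdentifying S A

/-- A generic tuple `A` in `Pk` has property `Q`: the tuples without `Q` are
contained in a Zariski-closed set meeting `Pk` in a proper subset. -/
def GenericTupleHas {γ n k : ℕ} (Pk : Set (TSpace γ n k))
    (Q : TSpace γ n k → Prop) : Prop :=
  ∃ C : Set (TSpace γ n k), IsZClosedT C ∧ C ∩ Pk ≠ Pk ∧
    {A | A ∈ Pk ∧ ¬ Q A} ⊆ C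

section Helpers

open MvPolynomial

/-- Algebraic form of irreducibility. -/
def ZIrr {σ : Type*} (S : Set (σ → ℂ)) : Prop :=
  S.Nonempty ∧ ∀ f g : MvPolynomial σ ℂ, (∃ x ∈ S, eval x f ≠ 0) → (∃ x ∈ S, eval x g ≠ 0) →
    ∃ x ∈ S, eval x f ≠ 0 ∧ eval x g ≠ 0

theorem zIrr_of_isIrreducible {σ : Type*} {S : Set (σ → ℂ)}
    (h : @IsIrreducible _ (zTop σ) S) : ZIrr S := by
  refine ⟨h.1, ?_⟩
  rintro f g ⟨x, hx, hfx⟩ ⟨y, hy, hgy⟩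
  obtain ⟨z, hz, hz1, hz2⟩ := h.2 {x | eval x f ≠ 0} {x | eval x g ≠ 0}
    (TopologicalSpace.isOpen_generateFrom_of_mem ⟨f, rfl⟩)
    (TopologicalSpace.isOpen_generateFrom_of_mem ⟨g, rfl⟩) ⟨x, hx, hfx⟩ ⟨y, hy, hgy⟩
  exact ⟨z, hz, hz1, hz2⟩

theorem eval_bind_aux {σ τ : Type*} (x : τ → ℂ) (g : σ → MvPolynomial τ ℂ)
    (f : MvPolynomial σ ℂ) : eval x (bind₁ g f) = eval (fun i => eval x (g i)) f := by
  have := aeval_bind₁ (R := ℂ) (S := ℂ) x g f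
  simpa [aeval_eq_eval] using this

theorem ZIrr.isPrime {σ : Type*} {S : Set (σ → ℂ)} (h : ZIrr S) :
    (vanishingIdeal ℂ S).IsPrime := by
  refine ⟨?_, ?_⟩
  · intro ht
    obtain ⟨x, hx⟩ := h.1
    have : (1 : MvPolynomial σ ℂ) ∈ vanishingIdeal ℂ S := by rw [ht]; trivial
    have := (mem_vanishingIdeal_iff.1 this) x hx
    simp at this
  · intro f g hfg
    by_contra! hcon
    obtain ⟨hf, hg⟩ := hcon
    simp only [mem_vanishingIdeal_iff, aeval_eq_eval] at hf hg hfg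
    push Not at hf hg
    obtain ⟨x, hx, h1, h2⟩ := h.2 f g hf hg
    have := hfg x hx
    simp [h1, h2] at this

theorem mem_pt {σ : Type*} (x : σ → ℂ) (p : MvPolynomial σ ℂ) :
    p ∈ (pointToPoint (k := ℂ) x).asIdeal ↔ eval x p = 0 := by
  change p ∈ vanishingIdeal ℂ {x} ↔ _
  simp [aeval_eq_eval]

/-- A constructible set contains or avoids a neighbourhood of `p` in the closure of `p`. -/
theorem constructible_dichotomy_s18 {R : Type*} [CommRing R] (p : PrimeSpectrum R)
    {C : Set (PrimeSpectrum R)} (hC : Topology.IsConstructible C) :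
    ∃ f : R, f ∉ p.asIdeal ∧
      ((∀ q : PrimeSpectrum R, p.asIdeal ≤ q.asIdeal → f ∉ q.asIdeal → q ∈ C) ∨
       (∀ q : PrimeSpectrum R, p.asIdeal ≤ q.asIdeal → f ∉ q.asIdeal → q ∉ C)) := by
  induction hC using Topology.IsConstructible.empty_union_induction with
  | open_retrocompact U hU _ =>
    by_cases hp : p ∈ U
    · obtain ⟨_, ⟨f, rfl⟩, hf, hfU⟩ :=
        PrimeSpectrum.isTopologicalBasis_basic_opens.exists_subset_of_mem_open hp hU
      exact ⟨f, hf, Or.inl fun q _ hq => hfU hq⟩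
    · refine ⟨1, p.2.one_notMem, Or.inr fun q hpq _ hq => hp ?_⟩
      have : p ⤳ q := (PrimeSpectrum.le_iff_specializes p q).1 hpq
      exact this.mem_open hU hq
  | union s hs t ht h1 h2 =>
    obtain ⟨f, hf, hf'⟩ := h1
    obtain ⟨g, hg, hg'⟩ := h2
    rcases hf' with h | h
    · exact ⟨f, hf, Or.inl fun q h1 h2 => Or.inl (h q h1 h2)⟩
    rcases hg' with h' | h'
    · exact ⟨g, hg, Or.inl fun q h1 h2 => Or.inr (h' q h1 h2)⟩
    refine ⟨f * g, fun hfg => (p.2.mem_or_mem hfg).elim hf hg, Or.inr fun q h1 h2 h3 => ?_⟩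
    rcases h3 with h3 | h3
    · exact h q h1 (fun hh => h2 (Ideal.mul_mem_right _ _ hh)) h3
    · exact h' q h1 (fun hh => h2 (Ideal.mul_mem_left _ _ hh)) h3
  | compl s hs h1 =>
    obtain ⟨f, hf, hf'⟩ := h1
    refine ⟨f, hf, ?_⟩
    rcases hf' with h | h
    · exact Or.inr fun q h1 h2 h3 => h3 (h q h1 h2)
    · exact Or.inl fun q h1 h2 => h q h1 h2

theorem ZIrr.dichotomy {σ : Type*} {S : Set (σ → ℂ)} (h : ZIrr S)
    {C : Set (PrimeSpectrum (MvPolynomial σ ℂ))} (hC : Topology.IsConstructible C) :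
    ∃ f : MvPolynomial σ ℂ, (∃ x ∈ S, eval x f ≠ 0) ∧
      ((∀ x ∈ S, eval x f ≠ 0 → pointToPoint x ∈ C) ∨
       (∀ x ∈ S, eval x f ≠ 0 → pointToPoint x ∉ C)) := by
  obtain ⟨f, hf, hf'⟩ := constructible_dichotomy_s18 ⟨_, h.isPrime⟩ hC
  have key : ∀ x ∈ S, vanishingIdeal ℂ S ≤ (pointToPoint (k := ℂ) x).asIdeal := by
    intro x hx
    exact vanishingIdeal_anti_mono (by simpa using hx)
  refine ⟨f, ?_, ?_⟩
  · by_contra! hcon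
    exact hf (mem_vanishingIdeal_iff.2 fun x hx => by simpa [aeval_eq_eval] using hcon x hx)
  · refine hf'.imp (fun h x hx hfx => h _ (key x hx) ?_) (fun h x hx hfx => h _ (key x hx) ?_) <;>
    · rw [mem_pt]; exact hfx

/-- Points of the projection of a constructible set. -/
theorem pt_mem_image {σ τ : Type*} [Finite σ] [Finite τ]
    {E : Set (PrimeSpectrum (MvPolynomial (σ ⊕ τ) ℂ))} (hE : Topology.IsConstructible E)
    (x : σ → ℂ) :
    pointToPoint x ∈ PrimeSpectrum.comap
        (rename (Sum.inl : σ → σ ⊕ τ) : MvPolynomial σ ℂ →ₐ[ℂ] _).toRingHom '' E ↔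
      ∃ w : τ → ℂ, pointToPoint (Sum.elim x w) ∈ E := by
  have key : ∀ (y : σ ⊕ τ → ℂ), PrimeSpectrum.comap
        (rename (Sum.inl : σ → σ ⊕ τ) : MvPolynomial σ ℂ →ₐ[ℂ] _).toRingHom (pointToPoint y)
        = pointToPoint (y ∘ Sum.inl) := by
    intro y
    ext p
    rw [PrimeSpectrum.comap_asIdeal, Ideal.mem_comap, mem_pt, mem_pt]
    simp [eval_rename]
  constructor
  · rintro ⟨q, hq, hqx⟩
    obtain ⟨f, hf, hf'⟩ := constructible_dichotomy_s18 q hE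
    have hf1 := hf'.resolve_right (fun h => h q le_rfl hf hq)
    have hloc : IsLocallyClosed (PrimeSpectrum.zeroLocus (q.asIdeal : Set _) ∩
        (PrimeSpectrum.basicOpen f : Set (PrimeSpectrum (MvPolynomial (σ ⊕ τ) ℂ)))) :=
      (PrimeSpectrum.isClosed_zeroLocus _).isLocallyClosed.inter
        (PrimeSpectrum.basicOpen f).isOpen.isLocallyClosed
    have hne : (PrimeSpectrum.zeroLocus (q.asIdeal : Set _) ∩
        (PrimeSpectrum.basicOpen f :
          Set (PrimeSpectrum (MvPolynomial (σ ⊕ τ) ℂ)))).Nonempty := ⟨q, by simp, hf⟩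
    obtain ⟨m, ⟨hm1, hm2⟩, hm3⟩ := nonempty_inter_closedPoints hne hloc
    have hmax : m.asIdeal.IsMaximal := by
      rw [mem_closedPoints_iff] at hm3
      exact (PrimeSpectrum.isClosed_singleton_iff_isMaximal m).1 hm3
    obtain ⟨y, hy⟩ := isMaximal_iff_eq_vanishingIdeal_singleton.1 hmax
    have hmy : m = pointToPoint y := PrimeSpectrum.ext hy
    have hmE : m ∈ E := hf1 m hm1 hm2
    have hyx : y ∘ Sum.inl = x := by
      funext i
      have h1 : (X i - MvPolynomial.C (x i) : MvPolynomial σ ℂ) ∈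
          (pointToPoint (k := ℂ) x).asIdeal := by
        rw [mem_pt]; simp
      rw [← hqx, PrimeSpectrum.comap_asIdeal, Ideal.mem_comap] at h1
      have h2 := hm1 h1
      rw [hmy] at h2
      have h3 := (mem_pt _ _).1 h2
      simpa [sub_eq_zero] using h3
    refine ⟨y ∘ Sum.inr, ?_⟩
    rw [← hyx, Sum.elim_comp_inl_inr, ← hmy]
    exact hmE
  · rintro ⟨w, hw⟩
    exact ⟨_, hw, by rw [key]; simp⟩

theorem image_constructible {σ τ : Type*} [Finite σ] [Finite τ]
    {E : Set (PrimeSpectrum (MvPolynomial (σ ⊕ τ) ℂ))} (hE : Topology.IsConstructible E) :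
    Topology.IsConstructible (PrimeSpectrum.comap
        (rename (Sum.inl : σ → σ ⊕ τ) : MvPolynomial σ ℂ →ₐ[ℂ] _).toRingHom '' E) := by
  refine PrimeSpectrum.isConstructible_comap_image ?_ hE
  rw [← RingHom.FinitePresentation.of_finiteType]
  refine RingHom.FiniteType.of_comp_finiteType (f := MvPolynomial.C) ?_
  have : (rename (Sum.inl : σ → σ ⊕ τ) : MvPolynomial σ ℂ →ₐ[ℂ] _).toRingHom.comp
    MvPolynomial.C = algebraMap ℂ (MvPolynomial (σ ⊕ τ) ℂ) := by
    ext; simp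
  rw [this, RingHom.finiteType_algebraMap]
  infer_instance

theorem zeroLocus_constructible {σ : Type*} [Finite σ] (T : Set (MvPolynomial σ ℂ)) :
    Topology.IsConstructible (PrimeSpectrum.zeroLocus T) := by
  rw [← Topology.isConstructible_compl]
  have : TopologicalSpace.NoetherianSpace (PrimeSpectrum (MvPolynomial σ ℂ)) := inferInstance
  exact (TopologicalSpace.NoetherianSpace.isCompact _).isConstructible
    (PrimeSpectrum.isClosed_zeroLocus T).isOpen_compl

theorem pt_mem_zeroLocus {σ : Type*} (T : Set (MvPolynomial σ ℂ)) (x : σ → ℂ) :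
    pointToPoint x ∈ PrimeSpectrum.zeroLocus T ↔ ∀ p ∈ T, eval x p = 0 := by
  rw [PrimeSpectrum.mem_zeroLocus]
  exact ⟨fun h p hp => (mem_pt x p).1 (h hp), fun h p hp => (mem_pt x p).2 (h p hp)⟩

end Helpers

section Density

open MvPolynomial Filter Topology

theorem euclid_dense_nonzero {d : ℕ} (G : MvPolynomial (Fin d) ℂ) (hG : G ≠ 0) (t0 : Fin d → ℂ) :
    ∃ t : ℕ → (Fin d → ℂ), Tendsto t atTop (𝓝 t0) ∧ ∀ j, eval (t j) G ≠ 0 := by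
  obtain ⟨v, hv⟩ : ∃ v, eval v G ≠ 0 := by
    by_contra! h
    exact hG (MvPolynomial.funext fun x => by simpa using h x)
  obtain ⟨L, hL⟩ : ∃ L : Polynomial ℂ,
      ∀ s : ℂ, L.eval s = eval (fun i => t0 i + s * (v i - t0 i)) G := by
    refine ⟨MvPolynomial.aeval
      (fun i => Polynomial.C (t0 i) + Polynomial.X * Polynomial.C (v i - t0 i)) G, fun s => ?_⟩
    clear hG hv
    induction G using MvPolynomial.induction_on with
    | C a => simp
    | add p q hp hq => rw [map_add, Polynomial.eval_add, hp, hq, map_add]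
    | mul_X p i hp => rw [map_mul, Polynomial.eval_mul, hp, map_mul]; simp
  have hL0 : L ≠ 0 := by
    intro h
    have := hL 1
    rw [h] at this
    simp at this
    exact hv this.symm
  have hfin : {s : ℂ | L.IsRoot s}.Finite := Polynomial.finite_setOfPred_isRoot hL0
  have hev : ∀ᶠ s in 𝓝[≠] (0 : ℂ), ¬ L.IsRoot s := by
    have : ∀ᶠ s in cofinite, ¬ L.IsRoot s := by
      rw [eventually_cofinite]; simpa using hfin
    exact this.filter_mono (nhdsNE_le_cofinite 0)
  obtain ⟨s, hs, hs'⟩ := exists_seq_forall_of_frequently hev.frequently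
  refine ⟨fun j i => t0 i + s j * (v i - t0 i), ?_, fun j => ?_⟩
  · rw [tendsto_pi_nhds]
    intro i
    have h0 : Tendsto s atTop (𝓝 0) := hs.mono_right nhdsWithin_le_nhds
    simpa using (h0.mul_const (v i - t0 i)).const_add (t0 i)
  · rw [← hL]; exact hs' j

theorem small_root (p : Polynomial ℂ) (hp : p.Monic) (hd : p.natDegree ≠ 0) :
    ∃ y, p.IsRoot y ∧ ‖y‖ ^ p.natDegree ≤ ‖p.coeff 0‖ := by
  have hs : p.Splits := IsAlgClosed.splits p
  by_contra! h
  have hpos : 0 < ‖p.coeff 0‖ := by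
    rw [norm_pos_iff]
    intro h0
    have := h 0 (Polynomial.zero_isRoot_of_coeff_zero_eq_zero h0)
    simp [h0, hd] at this
  have h1 : ∀ y ∈ p.roots, ‖p.coeff 0‖ < ‖y‖ ^ p.natDegree := fun y hy =>
    h y (Polynomial.isRoot_of_mem_roots hy)
  have hc : ‖p.coeff 0‖ = (p.roots.map (fun y => ‖y‖)).prod := by
    rw [hs.coeff_zero_eq_prod_roots_of_monic hp, norm_mul, norm_pow, norm_neg, norm_one, one_pow,
      one_mul]
    exact (map_multiset_prod (normHom : ℂ →*₀ ℝ) p.roots)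
  have hcard : Multiset.card p.roots = p.natDegree := hs.natDegree_eq_card_roots.symm
  have h2 : ∀ y ∈ p.roots, ‖p.coeff 0‖ ^ ((1:ℝ) / p.natDegree) < ‖y‖ := by
    intro y hy
    have := Real.rpow_lt_rpow (norm_nonneg _) (h1 y hy) (z := (1:ℝ) / p.natDegree) (by positivity)
    rwa [one_div, Real.pow_rpow_inv_natCast (norm_nonneg _) hd, ← one_div] at this
  have hlt : (p.roots.map (fun _ => ‖p.coeff 0‖ ^ ((1:ℝ) / p.natDegree))).prod <
      (p.roots.map (fun y => ‖y‖)).prod := by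
    refine Multiset.prod_map_lt_prod_map ?_ _ _ (fun y _ => Real.rpow_pos_of_pos hpos _) h2
    rw [← Multiset.card_pos, hcard]; omega
  rw [← hc, Multiset.map_const', Multiset.prod_replicate, hcard, one_div,
    Real.rpow_inv_natCast_pow (norm_nonneg _) hd] at hlt
  exact lt_irrefl _ hlt

theorem lying_over_root {A B K : Type*} [CommRing A] [IsDomain A] [IsIntegrallyClosed A]
    [CommRing B] [IsDomain B] [Algebra A B] [Algebra.IsIntegral A B] [Field K]
    (hinj : Function.Injective (algebraMap A B))
    (ψ : A →+* K) (hψ : Function.Surjective ψ) (h : B) (y : K)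
    (hy : (minpoly A h).eval₂ ψ y = 0) :
    ∃ Q : Ideal B, Q.IsMaximal ∧ ∀ p : Polynomial A, Polynomial.aeval h p ∈ Q ↔ p.eval₂ ψ y = 0 := by
  have : FaithfulSMul A B := (faithfulSMul_iff_algebraMap_injective A B).2 hinj
  have : Module.IsTorsionFree A B := .trans_faithfulSMul A B B
  let _ : Algebra (Polynomial A) B := (Polynomial.aeval h).toRingHom.toAlgebra
  have hint : Algebra.IsIntegral (Polynomial A) B := by
    constructor
    have h1 : (algebraMap A B).IsIntegral := fun b => Algebra.IsIntegral.isIntegral b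
    have h2 : algebraMap A B = (algebraMap (Polynomial A) B).comp Polynomial.C := by
      ext a
      exact (Polynomial.aeval_C h a).symm
    rw [h2] at h1
    exact RingHom.IsIntegral.tower_top _ _ h1
  let Ψ : Polynomial A →+* K := Polynomial.eval₂RingHom ψ y
  have hΨ : Function.Surjective Ψ := fun z => by
    obtain ⟨a, ha⟩ := hψ z
    exact ⟨Polynomial.C a, by simp [Ψ, ha]⟩
  have hmax : (RingHom.ker Ψ).IsMaximal := RingHom.ker_isMaximal_of_surjective Ψ hΨ
  have hker : RingHom.ker (algebraMap (Polynomial A) B) ≤ RingHom.ker Ψ := by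
    intro p hp
    have hp' : Polynomial.aeval h p = 0 := hp
    obtain ⟨q, rfl⟩ := minpoly.isIntegrallyClosed_dvd (Algebra.IsIntegral.isIntegral h) hp'
    rw [RingHom.mem_ker, map_mul]
    have : Ψ (minpoly A h) = 0 := hy
    rw [this, zero_mul]
  obtain ⟨Q, hQ, hQ'⟩ := Ideal.exists_ideal_over_maximal_of_isIntegral (S := B) _ hker
  refine ⟨Q, hQ, fun p => ?_⟩
  have : p ∈ Q.comap (algebraMap (Polynomial A) B) ↔ p ∈ RingHom.ker Ψ := by rw [hQ']
  exact this

theorem noether_points {σ : Type*} [Finite σ] {S : Set (σ → ℂ)} (hcl : IsZClosed S)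
    (hirr : ZIrr S) :
    ∃ (d : ℕ) (τ : Fin d → MvPolynomial σ ℂ),
      (∀ g : MvPolynomial σ ℂ, (∃ x ∈ S, eval x g ≠ 0) → ∃ G : MvPolynomial (Fin d) ℂ, G ≠ 0 ∧
        ∀ x ∈ S, eval x g = 0 → eval (fun i => eval x (τ i)) G = 0) ∧
      (∀ h : MvPolynomial σ ℂ, ∃ F : Polynomial (MvPolynomial (Fin d) ℂ), F.Monic ∧
        (∀ x ∈ S, F.eval₂ (eval (fun i => eval x (τ i))) (eval x h) = 0) ∧
        ∀ t y, F.eval₂ (eval t) y = 0 → ∃ x ∈ S, (fun i => eval x (τ i)) = t ∧ eval x h = y) := by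
  have hprime := hirr.isPrime
  obtain ⟨d, ν, hinj, hint⟩ := exists_integral_inj_algHom_of_fg ℂ
    (MvPolynomial σ ℂ ⧸ vanishingIdeal ℂ S)
  let mk := Ideal.Quotient.mk (vanishingIdeal ℂ S)
  have hmks : Function.Surjective mk := Ideal.Quotient.mk_surjective
  choose τ hτ using fun i => hmks (ν (X i))
  let _ : Algebra (MvPolynomial (Fin d) ℂ) (MvPolynomial σ ℂ ⧸ vanishingIdeal ℂ S) :=
    ν.toRingHom.toAlgebra
  have halg : ∀ a, algebraMap (MvPolynomial (Fin d) ℂ)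
    (MvPolynomial σ ℂ ⧸ vanishingIdeal ℂ S) a = ν a := fun _ => rfl
  have hI : Algebra.IsIntegral (MvPolynomial (Fin d) ℂ)
    (MvPolynomial σ ℂ ⧸ vanishingIdeal ℂ S) := ⟨fun b => hint b⟩
  -- evaluation at points of S
  have hev : ∀ x ∈ S, ∃ e : (MvPolynomial σ ℂ ⧸ vanishingIdeal ℂ S) →+* ℂ,
      (∀ p, e (mk p) = eval x p) ∧
      e.comp (algebraMap (MvPolynomial (Fin d) ℂ) _) = eval (fun i => eval x (τ i)) := by
    intro x hx
    let e := Ideal.Quotient.lift (vanishingIdeal ℂ S) (eval x) (fun p hp => by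
      simpa [aeval_eq_eval] using mem_vanishingIdeal_iff.1 hp x hx)
    have he : ∀ p, e (mk p) = eval x p := fun p => Ideal.Quotient.lift_mk _ _ _
    refine ⟨e, he, ?_⟩
    apply MvPolynomial.ringHom_ext
    · intro a
      have : ν (MvPolynomial.C a) = mk (MvPolynomial.C a) := ν.commutes a
      simp [halg, this, he]
    · intro i
      simp [halg, ← hτ, he]
  refine ⟨d, τ, ?_, ?_⟩
  · rintro g ⟨x, hx, hgx⟩
    have hg0 : mk g ≠ 0 := by
      intro h0
      obtain ⟨e, he, -⟩ := hev x hx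
      apply hgx
      rw [← he, h0, map_zero]
    have hne := Ideal.comap_ne_bot_of_integral_mem (R := MvPolynomial (Fin d) ℂ) hg0
      (Ideal.mem_span_singleton_self (mk g)) (Algebra.IsIntegral.isIntegral (mk g))
    obtain ⟨G, hG, hG0⟩ := Submodule.exists_mem_ne_zero_of_ne_bot hne
    refine ⟨G, hG0, fun z hz hgz => ?_⟩
    rw [Ideal.mem_comap, Ideal.mem_span_singleton] at hG
    obtain ⟨b, hb⟩ := hG
    obtain ⟨e, he, he'⟩ := hev z hz
    rw [← he', RingHom.comp_apply, hb, map_mul, he, hgz, zero_mul]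
  · intro h
    have hh := Algebra.IsIntegral.isIntegral (R := MvPolynomial (Fin d) ℂ) (mk h)
    refine ⟨minpoly (MvPolynomial (Fin d) ℂ) (mk h), minpoly.monic hh, ?_, ?_⟩
    · intro x hx
      obtain ⟨e, he, he'⟩ := hev x hx
      rw [← he', ← he, ← Polynomial.hom_eval₂]
      have := minpoly.aeval (MvPolynomial (Fin d) ℂ) (mk h)
      rw [Polynomial.aeval_def] at this
      rw [this, map_zero]
    · intro t y hy
      obtain ⟨Q, hQ, hQ'⟩ := lying_over_root hinj (eval t)
        (fun z => ⟨MvPolynomial.C z, by simp⟩) (mk h) y hy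
      have hmax : (Q.comap mk).IsMaximal := Ideal.comap_isMaximal_of_surjective mk hmks
      obtain ⟨x, hx⟩ := isMaximal_iff_eq_vanishingIdeal_singleton.1 hmax
      have hmem : ∀ p, mk p ∈ Q ↔ eval x p = 0 := by
        intro p
        rw [← Ideal.mem_comap, hx, mem_vanishingIdeal_singleton_iff, aeval_eq_eval]
      refine ⟨x, ?_, ?_, ?_⟩
      · obtain ⟨T, rfl⟩ := hcl
        intro p hp
        rw [← hmem]
        have : mk p = 0 := by
          rw [Ideal.Quotient.eq_zero_iff_mem, mem_vanishingIdeal_iff]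
          intro z hz
          simpa [aeval_eq_eval] using hz p hp
        rw [this]; exact Q.zero_mem
      · funext i
        have h1 := (hQ' (Polynomial.C (X i - MvPolynomial.C (t i)))).2 (by simp)
        have h2 : ν (MvPolynomial.C (t i)) = mk (MvPolynomial.C (t i)) := ν.commutes (t i)
        rw [Polynomial.aeval_C, halg, map_sub, ← hτ, h2, ← map_sub, hmem] at h1
        simpa [sub_eq_zero] using h1
      · have h1 := (hQ' (Polynomial.X - Polynomial.C (MvPolynomial.C y))).2 (by simp)
        have h2 : ν (MvPolynomial.C y) = mk (MvPolynomial.C y) := ν.commutes y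
        rw [map_sub, Polynomial.aeval_C, Polynomial.aeval_X, halg, h2, ← map_sub, hmem] at h1
        simpa [sub_eq_zero] using h1


theorem cont_eval {σ : Type*} [Finite σ] (p : MvPolynomial σ ℂ) :
    Continuous fun x : σ → ℂ => eval x p := MvPolynomial.continuous_eval p

theorem separating {σ : Type*} (x0 : σ → ℂ) (Φ : Set (σ → ℂ)) (hΦ : Φ.Finite) :
    ∃ h : MvPolynomial σ ℂ, eval x0 h = 0 ∧ ∀ x ∈ Φ, eval x h = 0 → x = x0 := by
  classical
  have h1 : ∀ x : σ → ℂ, ∃ l : MvPolynomial σ ℂ, eval x0 l = 1 ∧ (x ≠ x0 → eval x l = 0) := by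
    intro x
    by_cases hx : x = x0
    · exact ⟨1, by simp, fun h => absurd hx h⟩
    · obtain ⟨i, hi⟩ := Function.ne_iff.1 hx
      refine ⟨MvPolynomial.C ((x0 i - x i)⁻¹) * (X i - MvPolynomial.C (x i)), ?_, fun _ => ?_⟩
      · have : x0 i - x i ≠ 0 := sub_ne_zero.2 (Ne.symm hi)
        simp [this]
      · simp
  choose l hl hl' using h1
  refine ⟨1 - ∏ x ∈ hΦ.toFinset, l x, ?_, ?_⟩
  · simp [map_prod, hl]
  · intro x hx h
    by_contra hne
    have : eval x (∏ x ∈ hΦ.toFinset, l x) = 0 := by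
      rw [map_prod]
      exact Finset.prod_eq_zero (hΦ.mem_toFinset.2 hx) (hl' x hne)
    rw [map_sub, this] at h
    simp at h

theorem root_bound_s18 {d : ℕ} (F : Polynomial (MvPolynomial (Fin d) ℂ)) (hF : F.Monic)
    (t : ℕ → Fin d → ℂ) (t0 : Fin d → ℂ) (ht : Tendsto t atTop (𝓝 t0)) :
    ∃ K : ℝ, ∀ j y, F.eval₂ (eval (t j)) y = 0 → ‖y‖ ≤ K := by
  have hb : ∀ m, ∃ K : NNReal, ∀ j, ‖eval (t j) (F.coeff m)‖₊ ≤ K := by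
    intro m
    have h1 : Tendsto (fun j => eval (t j) (F.coeff m)) atTop (𝓝 (eval t0 (F.coeff m))) :=
      ((cont_eval (F.coeff m)).tendsto t0).comp ht
    obtain ⟨K, hK⟩ := (Metric.isBounded_range_of_tendsto _ h1).exists_norm_le
    exact ⟨K.toNNReal, fun j =>
      NNReal.coe_le_coe.1 ((hK _ ⟨j, rfl⟩).trans (Real.le_coe_toNNReal K))⟩
  choose K hK using hb
  refine ⟨((∑ m ∈ Finset.range F.natDegree, K m) + 1 : NNReal), fun j y hy => ?_⟩
  have hm : (F.map (eval (t j))).Monic := hF.map _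
  have hroot : (F.map (eval (t j))).IsRoot y := by
    rw [Polynomial.IsRoot, Polynomial.eval_map]; exact hy
  have hlt := hroot.norm_lt_cauchyBound hm.ne_zero
  have hle : Polynomial.cauchyBound (F.map (eval (t j))) ≤
      (∑ m ∈ Finset.range F.natDegree, K m) + 1 := by
    rw [Polynomial.cauchyBound, hm.leadingCoeff, hF.natDegree_map, nnnorm_one, div_one]
    gcongr
    apply Finset.sup_le
    intro m hm
    rw [Polynomial.coeff_map]
    exact (hK m j).trans (Finset.single_le_sum (f := K) (fun m _ => zero_le) hm)
  exact NNReal.coe_le_coe.2 (hlt.le.trans hle)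

/-- Zariski-open nonempty subsets of an irreducible variety are Euclidean-dense. -/
theorem zariski_dense_s18 {σ : Type*} [Finite σ] {S : Set (σ → ℂ)} (hcl : IsZClosed S)
    (hirr : ZIrr S) (g : MvPolynomial σ ℂ) (hg : ∃ x ∈ S, eval x g ≠ 0) (x0 : σ → ℂ) (hx0 : x0 ∈ S)
    (U : Set (σ → ℂ)) (hU : IsOpen U) (hxU : x0 ∈ U) : ∃ x ∈ U ∩ S, eval x g ≠ 0 := by
  have := Fintype.ofFinite σ
  obtain ⟨d, τ, hN1, hN2⟩ := noether_points hcl hirr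
  obtain ⟨G, hG0, hG⟩ := hN1 g hg
  obtain ⟨t, ht, htG⟩ := euclid_dense_nonzero G hG0 (fun i => eval x0 (τ i))
  choose Fc hFc1 hFc2 _ using fun i : σ => hN2 (X i)
  -- finite fibre
  have hfin : {x | x ∈ S ∧ (fun i => eval x (τ i)) = fun i => eval x0 (τ i)}.Finite := by
    refine (Set.Finite.pi' (t := fun i : σ =>
      {y | ((Fc i).map (eval (fun i => eval x0 (τ i)))).IsRoot y}) fun i =>
        Polynomial.finite_setOfPred_isRoot ((hFc1 i).map _).ne_zero).subset ?_
    rintro x ⟨hx, hxt⟩ i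
    have := hFc2 i x hx
    rw [hxt] at this
    simpa [Polynomial.IsRoot, Polynomial.eval_map] using this
  obtain ⟨h, hh0, hh⟩ := separating x0 _ hfin
  obtain ⟨F, hF1, hF2, hF3⟩ := hN2 h
  have hFx0 := hF2 x0 hx0
  rw [hh0, Polynomial.eval₂_at_zero] at hFx0
  have hdeg : F.natDegree ≠ 0 := by
    intro h0
    have h1 := hF1.natDegree_eq_zero.1 h0
    rw [h1] at hFx0
    simp at hFx0
  have hroots : ∀ j, ∃ x ∈ S, (fun i => eval x (τ i)) = t j ∧
      ‖eval x h‖ ^ F.natDegree ≤ ‖eval (t j) (F.coeff 0)‖ := by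
    intro j
    obtain ⟨y, hy, hy'⟩ := small_root (F.map (eval (t j))) (hF1.map _)
      (by rw [hF1.natDegree_map]; exact hdeg)
    rw [hF1.natDegree_map, Polynomial.coeff_map] at hy'
    rw [Polynomial.IsRoot, Polynomial.eval_map] at hy
    obtain ⟨x, hx, hxt, rfl⟩ := hF3 (t j) y hy
    exact ⟨x, hx, hxt, hy'⟩
  choose x hxS hxt hxh using hroots
  -- boundedness
  choose K hK using fun i : σ => root_bound_s18 (Fc i) (hFc1 i) t _ ht
  have hbd : ∀ j, x j ∈ Set.univ.pi fun i : σ => Metric.closedBall (0 : ℂ) (K i) := by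
    intro j i _
    rw [mem_closedBall_zero_iff]
    apply hK i j
    have := hFc2 i (x j) (hxS j)
    rw [hxt j] at this
    simpa using this
  obtain ⟨z, -, ψ, hψ, hz⟩ :=
    (isCompact_univ_pi fun i : σ => isCompact_closedBall (0 : ℂ) (K i)).tendsto_subseq hbd
  have hSclosed : IsClosed S := by
    obtain ⟨T, rfl⟩ := hcl
    have : {x : σ → ℂ | ∀ p ∈ T, eval x p = 0} = ⋂ p ∈ T, {x | eval x p = 0} := by
      ext; simp
    rw [this]
    exact isClosed_biInter fun p _ => isClosed_eq (cont_eval p) continuous_const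
  have hzS : z ∈ S := hSclosed.mem_of_tendsto hz (Eventually.of_forall fun j => hxS _)
  have hzt : (fun i => eval z (τ i)) = fun i => eval x0 (τ i) := by
    funext i
    have h1 : Tendsto (fun j => eval (x (ψ j)) (τ i)) atTop (𝓝 (eval z (τ i))) :=
      ((cont_eval (τ i)).tendsto z).comp hz
    have h2 : Tendsto (fun j => t (ψ j) i) atTop (𝓝 (eval x0 (τ i))) :=
      (tendsto_pi_nhds.1 ht i).comp hψ.tendsto_atTop
    refine tendsto_nhds_unique h1 (h2.congr fun j => ?_)
    exact (congrFun (hxt (ψ j)) i).symm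
  have hzh : eval z h = 0 := by
    have h1 : Tendsto (fun j => ‖eval (x (ψ j)) h‖ ^ F.natDegree) atTop
        (𝓝 (‖eval z h‖ ^ F.natDegree)) :=
      ((((cont_eval h).norm.pow F.natDegree).tendsto z).comp hz)
    have h2 : Tendsto (fun j => ‖eval (t (ψ j)) (F.coeff 0)‖) atTop (𝓝 0) := by
      have := (((cont_eval (F.coeff 0)).norm.tendsto _).comp ht).comp hψ.tendsto_atTop
      rw [hFx0, norm_zero] at this
      exact this
    have h3 := le_of_tendsto_of_tendsto' h1 h2 fun j => hxh (ψ j)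
    have h4 : ‖eval z h‖ ^ F.natDegree = 0 := le_antisymm h3 (by positivity)
    simpa using (pow_eq_zero_iff hdeg).1 h4
  have hzx : z = x0 := hh z ⟨hzS, hzt⟩ hzh
  rw [hzx] at hz
  obtain ⟨j, hj⟩ := (hz.eventually (hU.mem_nhds hxU)).exists
  refine ⟨x (ψ j), ⟨hj, hxS _⟩, fun h0 => htG (ψ j) ?_⟩
  rw [← hxt]
  exact hG _ (hxS _) h0

end Density

section Final

open MvPolynomial

theorem genericTuple_iff {γ n k : ℕ} (Pk : Set (TSpace γ n k)) (Q : TSpace γ n k → Prop) :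
    GenericTupleHas Pk Q ↔ ∃ f : MvPolynomial (TIdx γ n k) ℂ,
      (∃ A ∈ Pk, eval (tCoords A) f ≠ 0) ∧ ∀ A ∈ Pk, eval (tCoords A) f ≠ 0 → Q A := by
  constructor
  · rintro ⟨C, ⟨T, rfl⟩, hne, hsub⟩
    have : ∃ A ∈ Pk, A ∉ {A | ∀ p ∈ T, eval (tCoords A) p = 0} := by
      by_contra! hcon
      exact hne (Set.inter_eq_right.2 hcon)
    obtain ⟨A, hA, hAC⟩ := this
    simp only [Set.mem_setOf_eq, not_forall] at hAC
    obtain ⟨f, hf, hfA⟩ := hAC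
    refine ⟨f, ⟨A, hA, hfA⟩, fun B hB hfB => ?_⟩
    by_contra hQ
    exact hfB (hsub ⟨hB, hQ⟩ f hf)
  · rintro ⟨f, ⟨A, hA, hfA⟩, h⟩
    refine ⟨{A | eval (tCoords A) f = 0}, ⟨{f}, by simp⟩, fun he => ?_, ?_⟩
    · rw [Set.inter_eq_right] at he
      exact hfA (he hA)
    · rintro B ⟨hB, hQ⟩
      by_contra hfB
      exact hQ (h B hB hfB)

theorem genericallyIdentifying_iff {γ n k : ℕ} (S : Set (MSpace γ n)) (A : TSpace γ n k) :
    GenericallyIdentifying S A ↔ ∃ f : MvPolynomial (MIdx γ n) ℂ,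
      (∃ Z ∈ S, eval Z f ≠ 0) ∧ ∀ Z ∈ S, eval Z f ≠ 0 → Identifiable S A Z := by
  constructor
  · rintro ⟨C, ⟨T, rfl⟩, hne, hsub⟩
    have : ∃ A ∈ S, A ∉ {A | ∀ p ∈ T, eval A p = 0} := by
      by_contra! hcon
      exact hne (Set.inter_eq_right.2 hcon)
    obtain ⟨A, hA, hAC⟩ := this
    simp only [Set.mem_setOf_eq, not_forall] at hAC
    obtain ⟨f, hf, hfA⟩ := hAC
    refine ⟨f, ⟨A, hA, hfA⟩, fun B hB hfB => ?_⟩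
    by_contra hQ
    exact hfB (hsub ⟨hB, hQ⟩ f hf)
  · rintro ⟨f, ⟨A, hA, hfA⟩, h⟩
    refine ⟨{A | eval A f = 0}, ⟨{f}, by simp⟩, fun he => ?_, ?_⟩
    · rw [Set.inter_eq_right] at he
      exact hfA (he hA)
    · rintro B ⟨hB, hQ⟩
      by_contra hfB
      exact hQ (h B hB hfB)

theorem zIrr_prod {γ n k : ℕ} (Pfam : Fin k → Set (MSpace γ n)) (h : ∀ i, ZIrr (Pfam i)) :
    ZIrr (tCoords '' {A : TSpace γ n k | ∀ i, A i ∈ Pfam i}) := by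
  classical
  refine ⟨?_, ?_⟩
  · choose A hA using fun i => (h i).1
    exact ⟨_, A, hA, rfl⟩
  · rintro f g ⟨_, ⟨A, hA, rfl⟩, hfA⟩ ⟨_, ⟨B, hB, rfl⟩, hgB⟩
    have key : ∀ s : Finset (Fin k), ∃ A B : TSpace γ n k, (∀ i, A i ∈ Pfam i) ∧
        (∀ i, B i ∈ Pfam i) ∧ eval (tCoords A) f ≠ 0 ∧ eval (tCoords B) g ≠ 0 ∧
        ∀ i ∈ s, A i = B i := by
      intro s
      induction s using Finset.induction_on with
      | empty => exact ⟨A, B, hA, hB, hfA, hgB, by simp⟩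
      | insert i s his ih =>
        obtain ⟨A, B, hA, hB, hfA, hgB, hs⟩ := ih
        let sub : TSpace γ n k → TIdx γ n k → MvPolynomial (MIdx γ n) ℂ :=
          fun A p => if p.1 = i then X p.2 else MvPolynomial.C (A p.1 p.2)
        have hsub : ∀ (A : TSpace γ n k) (f : MvPolynomial (TIdx γ n k) ℂ) (x : MSpace γ n),
            eval x (bind₁ (sub A) f) = eval (tCoords (Function.update A i x)) f := by
          intro A f x
          rw [eval_bind_aux]
          congr 2
          funext p
          by_cases hp : p.1 = i
          · simp [sub, tCoords, hp]
          · simp [sub, tCoords, hp]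
        have hup : ∀ (A : TSpace γ n k), (∀ i, A i ∈ Pfam i) → ∀ x ∈ Pfam i,
            ∀ j, Function.update A i x j ∈ Pfam j := by
          intro A hA x hx j
          by_cases hj : j = i
          · subst hj; simpa using hx
          · simpa [hj] using hA j
        obtain ⟨x, hx, h1, h2⟩ := (h i).2 (bind₁ (sub A) f) (bind₁ (sub B) g)
          ⟨A i, hA i, by rw [hsub]; simpa using hfA⟩ ⟨B i, hB i, by rw [hsub]; simpa using hgB⟩
        rw [hsub] at h1 h2
        refine ⟨_, _, hup A hA x hx, hup B hB x hx, h1, h2, fun j hj => ?_⟩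
        by_cases hji : j = i
        · subst hji; simp
        · simpa [hji] using hs j ((Finset.mem_insert.1 hj).resolve_left hji)
    obtain ⟨A, B, hA, hB, hfA, hgB, hAB⟩ := key Finset.univ
    have : A = B := funext fun i => hAB i (Finset.mem_univ i)
    subst this
    exact ⟨_, ⟨A, hA, rfl⟩, hfA, hgB⟩

/-- Fix the right coordinates. -/
theorem eval_fixR {σ τ : Type*} (f : MvPolynomial (σ ⊕ τ) ℂ) (z : τ → ℂ) :
    ∃ f' : MvPolynomial σ ℂ, ∀ a, eval a f' = eval (Sum.elim a z) f := by
  refine ⟨bind₁ (Sum.elim X fun i => MvPolynomial.C (z i)) f, fun a => ?_⟩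
  rw [eval_bind_aux]
  congr 2
  funext p
  cases p <;> simp

/-- Fix the left coordinates. -/
theorem eval_fixL {σ τ : Type*} (f : MvPolynomial (σ ⊕ τ) ℂ) (a : σ → ℂ) :
    ∃ f' : MvPolynomial τ ℂ, ∀ z, eval z f' = eval (Sum.elim a z) f := by
  refine ⟨bind₁ (Sum.elim (fun i => MvPolynomial.C (a i)) X) f, fun z => ?_⟩
  rw [eval_bind_aux]
  congr 2
  funext p
  cases p <;> simp

theorem zIrr_pair {σ τ : Type*} {P : Set (σ → ℂ)} {S : Set (τ → ℂ)} (hP : ZIrr P) (hS : ZIrr S) :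
    ZIrr {y : σ ⊕ τ → ℂ | ∃ a ∈ P, ∃ z ∈ S, y = Sum.elim a z} := by
  refine ⟨?_, ?_⟩
  · obtain ⟨a, ha⟩ := hP.1
    obtain ⟨z, hz⟩ := hS.1
    exact ⟨_, a, ha, z, hz, rfl⟩
  · rintro f g ⟨_, ⟨a, ha, z, hz, rfl⟩, hf⟩ ⟨_, ⟨b, hb, w, hw, rfl⟩, hg⟩
    obtain ⟨f1, hf1⟩ := eval_fixR f z
    obtain ⟨g1, hg1⟩ := eval_fixR g w
    obtain ⟨c, hc, h1, h2⟩ := hP.2 f1 g1 ⟨a, ha, by rwa [hf1]⟩ ⟨b, hb, by rwa [hg1]⟩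
    rw [hf1] at h1
    rw [hg1] at h2
    obtain ⟨f2, hf2⟩ := eval_fixL f c
    obtain ⟨g2, hg2⟩ := eval_fixL g c
    obtain ⟨u, hu, h3, h4⟩ := hS.2 f2 g2 ⟨z, hz, by rwa [hf2]⟩ ⟨w, hw, by rwa [hg2]⟩
    exact ⟨_, ⟨c, hc, u, hu, rfl⟩, by rwa [← hf2], by rwa [← hg2]⟩

/-- The set of collisions `(A, Z, W)` as a constructible set. -/
theorem collision_constructible {γ n : ℕ} (k : ℕ) {S : Set (MSpace γ n)} (hS : IsZClosed S) :
    ∃ E : Set (PrimeSpectrum (MvPolynomial (PIdx γ n k ⊕ MIdx γ n) ℂ)),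
      Topology.IsConstructible E ∧ ∀ (A : TSpace γ n k) (Z W : MSpace γ n),
        pointToPoint (Sum.elim (Sum.elim (tCoords A) Z) W) ∈ E ↔
          Z ∈ S ∧ W ∈ S ∧ (∀ i, trPair W (A i) = trPair Z (A i)) ∧ W ≠ Z := by
  obtain ⟨T, rfl⟩ := hS
  let tr : Fin k → (MIdx γ n → PIdx γ n k ⊕ MIdx γ n) → MvPolynomial (PIdx γ n k ⊕ MIdx γ n) ℂ :=
    fun i e => ∑ g : Fin γ, ∑ a : Fin n, ∑ b : Fin n,
      X (e (g, a, b)) * X (Sum.inl (Sum.inl (i, (g, b, a))))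
  refine ⟨((PrimeSpectrum.zeroLocus (rename (Sum.inl ∘ Sum.inr) '' T) ∩
      PrimeSpectrum.zeroLocus (rename Sum.inr '' T)) ∩
      PrimeSpectrum.zeroLocus (Set.range fun i => tr i Sum.inr - tr i (Sum.inl ∘ Sum.inr))) \
      PrimeSpectrum.zeroLocus (Set.range fun m : MIdx γ n =>
        (X (Sum.inr m) - X (Sum.inl (Sum.inr m)) : MvPolynomial (PIdx γ n k ⊕ MIdx γ n) ℂ)),
    (((zeroLocus_constructible _).inter (zeroLocus_constructible _)).inter
      (zeroLocus_constructible _)).sdiff (zeroLocus_constructible _), ?_⟩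
  intro A Z W
  rw [Set.mem_diff, Set.mem_inter_iff, Set.mem_inter_iff, pt_mem_zeroLocus, pt_mem_zeroLocus,
    pt_mem_zeroLocus, pt_mem_zeroLocus, and_assoc, and_assoc]
  refine and_congr ?_ (and_congr ?_ (and_congr ?_ (not_congr ?_)))
  · simp only [Set.forall_mem_image, eval_rename, Set.mem_setOf_eq]
    rfl
  · simp only [Set.forall_mem_image, eval_rename, Set.mem_setOf_eq]
    rfl
  · simp [tr, sub_eq_zero, trPair, tCoords]
  · simp only [Set.forall_mem_range, map_sub, eval_X, Sum.elim_inr, Sum.elim_inl, sub_eq_zero]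
    exact funext_iff.symm

theorem not_identifiable_iff {γ n k : ℕ} {S : Set (MSpace γ n)} {A : TSpace γ n k}
    {Z : MSpace γ n} (hZ : Z ∈ S) : ¬ Identifiable S A Z ↔
      ∃ W ∈ S, (∀ i, trPair W (A i) = trPair Z (A i)) ∧ W ≠ Z := by
  constructor
  · intro h
    by_contra! hcon
    apply h
    ext W
    constructor
    · rintro ⟨hW, hW'⟩
      exact hcon W hW hW'
    · rintro rfl
      exact ⟨hZ, fun _ => rfl⟩
  · rintro ⟨W, hW, hW', hne⟩ h
    have : W ∈ prFiber S A Z := ⟨hW, hW'⟩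
    rw [h] at this
    exact hne this

theorem not_nonIdentifying {γ n k : ℕ} {S : Set (MSpace γ n)} {A : TSpace γ n k}
    (h : GenericallyIdentifying S A) : ¬ NonIdentifying S A := by
  obtain ⟨f, ⟨Z, hZ, hfZ⟩, hf⟩ := (genericallyIdentifying_iff S A).1 h
  intro hN
  refine hN Z hZ ⟨{W | eval W f ≠ 0}, ?_, hfZ, fun W hW => hf W hW.2 hW.1⟩
  exact isOpen_ne_fun (cont_eval f) continuous_const

theorem generic_both {γ n k : ℕ} {Pk : Set (TSpace γ n k)} {Q R : TSpace γ n k → Prop}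
    (hP : ZIrr (tCoords '' Pk)) (h1 : GenericTupleHas Pk Q) (h2 : GenericTupleHas Pk R) :
    GenericTupleHas Pk (fun A => Q A ∧ R A) ∧ ∃ A, Q A ∧ R A := by
  rw [genericTuple_iff] at h1 h2 ⊢
  obtain ⟨f, ⟨A, hA, hfA⟩, hf⟩ := h1
  obtain ⟨g, ⟨B, hB, hgB⟩, hg⟩ := h2
  obtain ⟨_, ⟨D, hD, rfl⟩, h3, h4⟩ := hP.2 f g ⟨_, ⟨A, hA, rfl⟩, hfA⟩ ⟨_, ⟨B, hB, rfl⟩, hgB⟩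
  refine ⟨⟨f * g, ⟨D, hD, ?_⟩, fun E hE hfg => ?_⟩, D, hf D hD h3, hg D hD h4⟩
  · rw [map_mul]; exact mul_ne_zero h3 h4
  · rw [map_mul] at hfg
    exact ⟨hf E hE (left_ne_zero_of_mul hfg), hg E hE (right_ne_zero_of_mul hfg)⟩

theorem generic_mono {γ n k : ℕ} {Pk : Set (TSpace γ n k)} {Q R : TSpace γ n k → Prop}
    (h : GenericTupleHas Pk Q) (hQR : ∀ A, Q A → R A) : GenericTupleHas Pk R := by
  obtain ⟨C, h1, h2, h3⟩ := h
  exact ⟨C, h1, h2, fun A hA => h3 ⟨hA.1, fun hq => hA.2 (hQR A hq)⟩⟩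

theorem trichotomy {γ n k : ℕ} {S : Set (MSpace γ n)} (hScl : IsZClosed S) (hS : ZIrr S)
    {Pk : Set (TSpace γ n k)} (hP : ZIrr (tCoords '' Pk)) :
    GenericTupleHas Pk (fun A => NonIdentifying S A) ∨
    GenericTupleHas Pk (fun A => IncompletelyIdentifying S A) ∨
    GenericTupleHas Pk (fun A => CompletelyIdentifying S A) := by
  obtain ⟨E, hE, hE'⟩ := collision_constructible k hScl
  have hN := image_constructible hE
  have hN' : ∀ (A : TSpace γ n k), ∀ Z ∈ S, (pointToPoint (Sum.elim (tCoords A) Z) ∈ _ ↔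
      ¬ Identifiable S A Z) := fun A Z hZ =>
    (pt_mem_image hE (Sum.elim (tCoords A) Z)).trans <| by
      rw [not_identifiable_iff hZ]
      exact exists_congr fun W => by rw [hE']; simp [hZ]
  have hN'' : ∀ (A : TSpace γ n k) (Z), pointToPoint (Sum.elim (tCoords A) Z) ∈ _ → Z ∈ S :=
    fun A Z h => by
      obtain ⟨W, hW⟩ := (pt_mem_image hE (Sum.elim (tCoords A) Z)).1 h
      exact ((hE' A Z W).1 hW).1
  have hM := image_constructible hN
  have hM' : ∀ (A : TSpace γ n k), (pointToPoint (tCoords A) ∈ _ ↔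
      ¬ CompletelyIdentifying S A) := fun A =>
    (pt_mem_image hN (tCoords A)).trans <| by
      simp only [CompletelyIdentifying, not_forall]
      constructor
      · rintro ⟨Z, hZ⟩
        exact ⟨Z, hN'' A Z hZ, (hN' A Z (hN'' A Z hZ)).1 hZ⟩
      · rintro ⟨Z, hZS, hZ⟩
        exact ⟨Z, (hN' A Z hZS).2 hZ⟩
  obtain ⟨f, ⟨_, ⟨_, ⟨A0, hA0, rfl⟩, Z0, hZ0, rfl⟩, hf0⟩, hf⟩ := (zIrr_pair hP hS).dichotomy hN
  obtain ⟨f1, hf1⟩ := eval_fixR f Z0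
  rcases hf with hf | hf
  · left
    rw [genericTuple_iff]
    refine ⟨f1, ⟨A0, hA0, by rwa [hf1]⟩, fun A hA hfA => ?_⟩
    rw [hf1] at hfA
    obtain ⟨f2, hf2⟩ := eval_fixL f (tCoords A)
    rintro Z hZ ⟨U, hU, hZU, hUi⟩
    obtain ⟨W, hW, hfW⟩ := zariski_dense_s18 hScl hS f2 ⟨Z0, hZ0, by rwa [hf2]⟩ Z hZ U hU hZU
    rw [hf2] at hfW
    exact (hN' A W hW.2).1 (hf _ ⟨_, ⟨A, hA, rfl⟩, W, hW.2, rfl⟩ hfW) (hUi W hW)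
  · right
    have hgen : GenericTupleHas Pk (fun A => GenericallyIdentifying S A) := by
      rw [genericTuple_iff]
      refine ⟨f1, ⟨A0, hA0, by rwa [hf1]⟩, fun A hA hfA => ?_⟩
      rw [hf1] at hfA
      obtain ⟨f2, hf2⟩ := eval_fixL f (tCoords A)
      rw [genericallyIdentifying_iff]
      refine ⟨f2, ⟨Z0, hZ0, by rwa [hf2]⟩, fun Z hZ hfZ => ?_⟩
      rw [hf2] at hfZ
      by_contra hcon
      exact hf _ ⟨_, ⟨A, hA, rfl⟩, Z, hZ, rfl⟩ hfZ ((hN' A Z hZ).2 hcon)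
    obtain ⟨g, ⟨_, ⟨B, hB, rfl⟩, hgB⟩, hg⟩ := hP.dichotomy hM
    rcases hg with hg | hg
    · left
      have h2 : GenericTupleHas Pk (fun A => ¬ CompletelyIdentifying S A) :=
        (genericTuple_iff _ _).2 ⟨g, ⟨B, hB, hgB⟩, fun A hA hgA =>
          (hM' A).1 (hg _ ⟨A, hA, rfl⟩ hgA)⟩
      exact (generic_both hP hgen h2).1
    · right
      refine (genericTuple_iff _ _).2 ⟨g, ⟨B, hB, hgB⟩, fun A hA hgA => ?_⟩
      by_contra hcon
      exact hg _ ⟨A, hA, rfl⟩ hgA ((hM' A).2 hcon)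

end Final

/-- Let `S ⊆ (ℂ^{n×n})^γ` (`γ ∈ {1,2}`) be an irreducible
Zariski-closed signal set, `𝒫_1, …, 𝒫_k` irreducible Zariski-closed measurement
sets with product `𝒫^{(k)}`, and assume the extended forward map
`φ(A, Z) = (A, Tr(Z·A_1), …, Tr(Z·A_k))` is generically unramified. Then exactly
one of the following holds: (a) a generic measurement regime in `𝒫^{(k)}` is
non-identifying; (b) a generic measurement regime is incompletely identifying;
(c) a generic measurement regime is completely identifying. -/
theorem stmt_18 (n k γ : ℕ) (hn : 1 ≤ n) (hk : 1 ≤ k) (hγ : γ = 1 ∨ γ = 2)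
    (S : Set (MSpace γ n)) (hScl : IsZClosed S)
    (hSirr : @IsIrreducible _ (zTop (MIdx γ n)) S)
    (Pfam : Fin k → Set (MSpace γ n))
    (hPcl : ∀ i, IsZClosed (Pfam i))
    (hPirr : ∀ i, @IsIrreducible _ (zTop (MIdx γ n)) (Pfam i))
    (hgu : GenUnramifiedP {A : TSpace γ n k | ∀ i, A i ∈ Pfam i} S) :
    let Pk : Set (TSpace γ n k) := {A | ∀ i, A i ∈ Pfam i}
    let a : Prop := GenericTupleHas Pk (fun A => NonIdentifying S A)
    let b : Prop := GenericTupleHas Pk (fun A => IncompletelyIdentifying S A)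
    let c : Prop := GenericTupleHas Pk (fun A => CompletelyIdentifying S A)
    (a ∨ b ∨ c) ∧ ¬ (a ∧ b) ∧ ¬ (a ∧ c) ∧ ¬ (b ∧ c) := by
  intro Pk a b c
  have hS := zIrr_of_isIrreducible hSirr
  have hP : ZIrr (tCoords '' Pk) := zIrr_prod Pfam fun i => zIrr_of_isIrreducible (hPirr i)
  have hcg : ∀ A : TSpace γ n k, CompletelyIdentifying S A → GenericallyIdentifying S A := by
    intro A hA
    obtain ⟨Z, hZ⟩ := hS.1
    exact (genericallyIdentifying_iff S A).2 ⟨1, ⟨Z, hZ, by simp⟩, fun W hW _ => hA W hW⟩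
  refine ⟨trichotomy hScl hS hP, ?_, ?_, ?_⟩
  · rintro ⟨ha, hb⟩
    obtain ⟨-, A, h1, h2⟩ := generic_both hP ha hb
    exact not_nonIdentifying h2.1 h1
  · rintro ⟨ha, hc⟩
    obtain ⟨-, A, h1, h2⟩ := generic_both hP ha hc
    exact not_nonIdentifying (hcg A h2) h1
  · rintro ⟨hb, hc⟩
    obtain ⟨-, A, h1, h2⟩ := generic_both hP hb hc
    exact h1.2 h2
end
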